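/- arXiv:0905.1881 — 2 statements merged into one kernel-verified Lean document; each statement's English description precedes it below -/
import Mathlib

section
/- Let Ω ⊆ ℂ^n be a Runge domain. Then for every open set Ω₀ relatively compact in Ω there exists a compact polynomial polyhedron P ⊆ Ω such that Ω₀ is relatively compact in the interior of P. -/
open Set Filter Topology MvPolynomial

noncomputable section

/-- The complex Euclidean space `ℂ^N`. -/
abbrev CE (N : ℕ) := Fin N → ℂ

/-- The natural projection `ℂ^{a+b} → ℂ^a` (onto the first `a` coordinates). -/
def projFst (a b : ℕ) (z : CE (a + b)) : CE a := fun i => z (Fin.castAdd b i)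

/-- The natural projection `ℂ^{a+b} → ℂ^b` (onto the last `b` coordinates). -/
def projSnd (a b : ℕ) (z : CE (a + b)) : CE b := fun i => z (Fin.natAdd a i)

/-- The cylinder `U × ℂ^b ⊆ ℂ^{a+b}` over `U ⊆ ℂ^a`. -/
def cylOver {a : ℕ} (b : ℕ) (U : Set (CE a)) : Set (CE (a + b)) :=
  {z | projFst a b z ∈ U}

/-- The product `U × B ⊆ ℂ^{a+b}` of `U ⊆ ℂ^a` and `B ⊆ ℂ^b`. -/
def prodSet {a b : ℕ} (U : Set (CE a)) (B : Set (CE b)) : Set (CE (a + b)) :=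
  {z | projFst a b z ∈ U ∧ projSnd a b z ∈ B}

/-- The open ball of radius `r` in `ℂ = ℂ^1`. -/
def ball1 (r : ℝ) : Set (CE 1) := {w | ‖w 0‖ < r}

/-- The open Euclidean ball of radius `t` in `ℂ^l`. -/
def eball (l : ℕ) (t : ℝ) : Set (CE l) := {x | ∑ i, ‖x i‖ ^ 2 < t ^ 2}

/-- An algebraic subset of `ℂ^N`: the common zero set of finitely many polynomials. -/
def IsAlgebraicSet {N : ℕ} (X : Set (CE N)) : Prop :=
  ∃ s : Finset (MvPolynomial (Fin N) ℂ), X = {z | ∀ p ∈ s, eval z p = 0}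

/-- An analytic subset `X` of an open set `Ω ⊆ ℂ^N`: locally (at every point of `Ω`)
the common zero set of finitely many holomorphic functions. -/
def IsAnalyticSet {N : ℕ} (Ω X : Set (CE N)) : Prop :=
  X ⊆ Ω ∧ ∀ z ∈ Ω, ∃ U : Set (CE N), IsOpen U ∧ z ∈ U ∧ U ⊆ Ω ∧
    ∃ s : Finset (CE N → ℂ), (∀ f ∈ s, AnalyticOnNhd ℂ f U) ∧
      X ∩ U = {w ∈ U | ∀ f ∈ s, f w = 0}

/-- `X` is, near `a`, a `d`-dimensional complex submanifold of `ℂ^N`: there is a local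
biholomorphism straightening `X` to the linear subspace `{z : z_i = 0 for i ≥ d}`. -/
def IsSubmanifoldPtOfDim {N : ℕ} (X : Set (CE N)) (d : ℕ) (a : CE N) : Prop :=
  ∃ (V W : Set (CE N)) (φ ψ : CE N → CE N),
    IsOpen V ∧ a ∈ V ∧ IsOpen W ∧
    AnalyticOnNhd ℂ φ V ∧ AnalyticOnNhd ℂ ψ W ∧
    MapsTo φ V W ∧ MapsTo ψ W V ∧
    (∀ x ∈ V, ψ (φ x) = x) ∧ (∀ y ∈ W, φ (ψ y) = y) ∧
    φ '' (X ∩ V) = W ∩ {z | ∀ i : Fin N, d ≤ (i : ℕ) → z i = 0}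

/-- `X` is purely `k`-dimensional: every point of `X` near which `X` is a submanifold is a
point of dimension exactly `k`, and such (regular) points are dense in `X`. -/
def PureDimOf {N : ℕ} (X : Set (CE N)) (k : ℕ) : Prop :=
  (∀ a ∈ X, a ∈ closure {b | b ∈ X ∧ IsSubmanifoldPtOfDim X k b}) ∧
  (∀ b ∈ X, ∀ d, IsSubmanifoldPtOfDim X d b → d = k)

/-- The singular locus of `X`: the points of `X` at which `X` is not locally a submanifold. -/
def singLocus {N : ℕ} (X : Set (CE N)) : Set (CE N) :=
  {a ∈ X | ¬ ∃ d, IsSubmanifoldPtOfDim X d a}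

/-- An irreducible analytic subset of the open set `Ω`. -/
def IsIrreducibleAnalyticSet {N : ℕ} (Ω X : Set (CE N)) : Prop :=
  IsAnalyticSet Ω X ∧ X.Nonempty ∧
  ∀ A B : Set (CE N), IsAnalyticSet Ω A → IsAnalyticSet Ω B → X = A ∪ B → X = A ∨ X = B

/-- `C` is an (analytic) irreducible component of the analytic set `X ⊆ Ω`:
an irreducible analytic subset of `Ω` contained in `X`, maximal among such. -/
def IsIrreducibleComponent {N : ℕ} (Ω X C : Set (CE N)) : Prop :=
  IsIrreducibleAnalyticSet Ω C ∧ C ⊆ X ∧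
  ∀ C' : Set (CE N), IsIrreducibleAnalyticSet Ω C' → C ⊆ C' → C' ⊆ X → C' = C

/-- `A` is the union of some of the analytic irreducible components of `X` in `Ω`. -/
def IsUnionOfComponents {N : ℕ} (Ω X A : Set (CE N)) : Prop :=
  ∃ 𝒞 : Set (Set (CE N)), (∀ C ∈ 𝒞, IsIrreducibleComponent Ω X C) ∧ A = ⋃₀ 𝒞

/-- The germ of the analytic set `Z` at `a` is irreducible. -/
def GermIrreducibleAt {N : ℕ} (Z : Set (CE N)) (a : CE N) : Prop :=
  ∀ U A B : Set (CE N), IsOpen U → a ∈ U → IsAnalyticSet U A → IsAnalyticSet U B →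
    Z ∩ U = A ∪ B →
    (∃ V, IsOpen V ∧ a ∈ V ∧ Z ∩ V = A ∩ V) ∨ (∃ V, IsOpen V ∧ a ∈ V ∧ Z ∩ V = B ∩ V)

/-- A Nash function on the open set `U ⊆ ℂ^N`: a holomorphic function annihilated,
locally around every point of `U`, by a nonzero polynomial `P(x, f(x)) = 0`. -/
def IsNashFn {N : ℕ} (U : Set (CE N)) (f : CE N → ℂ) : Prop :=
  AnalyticOnNhd ℂ f U ∧ ∀ x₀ ∈ U, ∃ V : Set (CE N), IsOpen V ∧ x₀ ∈ V ∧ V ⊆ U ∧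
    ∃ P : MvPolynomial (Fin (N + 1)) ℂ, P ≠ 0 ∧
      ∀ x ∈ V, eval (Fin.snoc x (f x)) P = 0

/-- A Nash subset `Y` of the open set `Ω ⊆ ℂ^N`: locally (at every point of `Ω`) the common
zero set of finitely many Nash functions. -/
def IsNashSet {N : ℕ} (Ω Y : Set (CE N)) : Prop :=
  Y ⊆ Ω ∧ ∀ y ∈ Ω, ∃ U : Set (CE N), IsOpen U ∧ y ∈ U ∧ U ⊆ Ω ∧
    ∃ s : Finset (CE N → ℂ), (∀ f ∈ s, IsNashFn U f) ∧
      Y ∩ U = {x ∈ U | ∀ f ∈ s, f x = 0}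

/-- `U` is a domain of holomorphy in `ℂ^N`. -/
def IsDomainOfHolomorphy {N : ℕ} (U : Set (CE N)) : Prop :=
  IsOpen U ∧ ¬ ∃ U₁ U₂ : Set (CE N), IsOpen U₁ ∧ IsOpen U₂ ∧ U₁.Nonempty ∧
    U₁ ⊆ U ∩ U₂ ∧ IsConnected U₂ ∧ ¬ U₂ ⊆ U ∧
    ∀ f : CE N → ℂ, AnalyticOnNhd ℂ f U →
      ∃ F : CE N → ℂ, AnalyticOnNhd ℂ F U₂ ∧ EqOn f F U₁

/-- A Runge domain in `ℂ^N`: a domain of holomorphy on which every holomorphic function can be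
approximated uniformly on compact subsets by polynomials. -/
def IsRungeDomain {N : ℕ} (U : Set (CE N)) : Prop :=
  IsDomainOfHolomorphy U ∧
  ∀ f : CE N → ℂ, AnalyticOnNhd ℂ f U → ∀ K : Set (CE N), IsCompact K → K ⊆ U →
    ∀ ε : ℝ, 0 < ε → ∃ p : MvPolynomial (Fin N) ℂ, ∀ z ∈ K, ‖f z - eval z p‖ < ε

/-- The projection `ℂ^{a+b} → ℂ^a` restricted to `X` maps `X` into `U` and is proper over `U`. -/
def ProperProjTo {a b : ℕ} (X : Set (CE (a + b))) (U : Set (CE a)) : Prop :=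
  (∀ z ∈ X, projFst a b z ∈ U) ∧
  ∀ K : Set (CE a), IsCompact K → K ⊆ U → IsCompact {z ∈ X | projFst a b z ∈ K}

/-- Local uniform convergence of the closed subsets `Y ν` of `W` to `Y'`. -/
def LocUnifConvSets {N : ℕ} (W : Set (CE N)) (Y : ℕ → Set (CE N)) (Y' : Set (CE N)) : Prop :=
  (∀ a ∈ Y', ∃ u : ℕ → CE N, (∀ ν, u ν ∈ Y ν) ∧ Tendsto u atTop (𝓝 a)) ∧
  ∀ K : Set (CE N), IsCompact K → K ⊆ W → K ∩ Y' = ∅ → ∀ᶠ ν in atTop, K ∩ Y ν = ∅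

/-- `X` and `T` meet transversally at `a`: their tangent spaces at `a` span `ℂ^N`. -/
def TransversalAt {N : ℕ} (X T : Set (CE N)) (a : CE N) : Prop :=
  Submodule.span ℂ (tangentConeAt ℂ X a ∪ tangentConeAt ℂ T a) = ⊤

/-- `T` is a `d`-dimensional complex submanifold of the open set `W`. -/
def IsSubmanifoldOfDim {N : ℕ} (W T : Set (CE N)) (d : ℕ) : Prop :=
  T ⊆ W ∧ ∀ a ∈ T, IsSubmanifoldPtOfDim T d a

/-- Convergence, in the open set `W ⊆ ℂ^N`, of the purely `k`-dimensional analytic sets `Z ν`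
to the purely `k`-dimensional analytic set `Z'` in the sense of holomorphic chains (all
multiplicities being `1`): local uniform convergence of supports, together with the degree
condition: for every regular point `a` of `Z'` and every `(N-k)`-dimensional submanifold `T`
transversal to `Z'` at `a`, with compact closure contained in `W` and meeting `Z'` only at `a`
(so that `deg(Z' · T) = 1`), for almost all `ν` the chain `Z ν · T` also has degree one, i.e.
`Z ν` meets `T` in exactly one point, which is a regular point of `Z ν` where the intersection
is transversal. -/
def ChainsConvTo {N : ℕ} (W : Set (CE N)) (k : ℕ) (Z : ℕ → Set (CE N))
    (Z' : Set (CE N)) : Prop :=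
  LocUnifConvSets W Z Z' ∧
  ∀ (a : CE N) (T : Set (CE N)), a ∈ Z' → IsSubmanifoldPtOfDim Z' k a →
    IsSubmanifoldOfDim W T (N - k) → IsCompact (closure T) → closure T ⊆ W →
    Z' ∩ closure T = {a} → TransversalAt Z' T a →
    ∀ᶠ ν in atTop, ∃ b, Z ν ∩ T = {b} ∧ IsSubmanifoldPtOfDim (Z ν) k b ∧
      TransversalAt (Z ν) T b

/-- A polynomial polyhedron in `ℂ^N`: a set of the form `{z : |q₁ z| ≤ c₁, …, |q_s z| ≤ c_s}`. -/
def IsPolyPolyhedron {N : ℕ} (P : Set (CE N)) : Prop :=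
  ∃ (s : Finset (MvPolynomial (Fin N) ℂ)) (c : MvPolynomial (Fin N) ℂ → ℝ),
    P = {z | ∀ q ∈ s, ‖eval z q‖ ≤ c q}

/-- A compact set `K ⊆ ℂ^N` is polynomially convex: it equals its polynomially convex hull. -/
def PolyConvex {N : ℕ} (K : Set (CE N)) : Prop :=
  K = {z | ∀ p : MvPolynomial (Fin N) ℂ,
    ‖eval z p‖ ≤ sSup ((fun w => ‖eval w p‖) '' K)}

/-- Sign condition used in the definition of semialgebraic sets. -/
def signCond (c : Ordering) (t : ℝ) : Prop :=
  match c with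
  | .lt => t < 0
  | .eq => t = 0
  | .gt => 0 < t

/-- Evaluation of a real polynomial in the `2m` real coordinates of `z ∈ ℂ^m`. -/
def realizeRe {m : ℕ} (p : MvPolynomial (Fin m ⊕ Fin m) ℝ) (z : CE m) : ℝ :=
  MvPolynomial.eval (Sum.elim (fun i => (z i).re) (fun i => (z i).im)) p

/-- A subset of `ℂ^m ≅ ℝ^{2m}` is semialgebraic: a finite union of finite intersections of
sets defined by polynomial sign conditions in the real coordinates. -/
def IsSemialgebraic {m : ℕ} (S : Set (CE m)) : Prop :=
  ∃ (n r : ℕ) (P : Fin n → Fin r → MvPolynomial (Fin m ⊕ Fin m) ℝ)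
    (σ : Fin n → Fin r → Ordering),
    S = ⋃ i, ⋂ j, {z | signCond (σ i j) (realizeRe (P i j) z)}

end

noncomputable section

/-- bundle a function as a continuous map, if possible -/
def cmk {X F : Type} [TopologicalSpace X] [TopologicalSpace F] [Zero F] (f : X → F) : C(X, F) :=
  open Classical in if h : Continuous f then ⟨f, h⟩ else 0

lemma cmk_apply {X F : Type} [TopologicalSpace X] [TopologicalSpace F] [Zero F] {f : X → F}
    (h : Continuous f) (x : X) : cmk f x = f x := by
  simp [cmk, h]

lemma cmk_continuousOn {Y X F : Type} [TopologicalSpace Y] [TopologicalSpace X]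
    [TopologicalSpace F] [Zero F]
    {U : Set Y} {f : Y → X → F} (h : ContinuousOn (fun p : Y × X => f p.1 p.2) (U ×ˢ univ)) :
    ContinuousOn (fun y => cmk (f y)) U := by
  rw [continuousOn_iff_continuous_domRestrict]
  apply ContinuousMap.continuous_of_continuous_uncurry
  have h1 : Continuous (fun p : U × X => f p.1 p.2) := by
    have h2 : Continuous (fun p : U × X => ((p.1 : Y), p.2)) := by fun_prop
    exact h.comp_continuous h2 (fun p => ⟨p.1.2, mem_univ _⟩)
  convert h1 using 1
  ext p
  have : Continuous (f p.1) := by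
    have h2 : Continuous (fun x : X => (p.1, x)) := by fun_prop
    exact h1.comp h2
  simp [Function.uncurry, cmk_apply this]

lemma lemV {X F : Type} [TopologicalSpace X] [CompactSpace X] [NormedAddCommGroup F]
    [NormedSpace ℂ F] [CompleteSpace F] {g : ℂ → C(X, F)} {U : Set ℂ} (hU : IsOpen U)
    (hc : ContinuousOn g U) (hd : ∀ x, DifferentiableOn ℂ (fun s => g s x) U) :
    DifferentiableOn ℂ g U := by
  intro s0 hs0
  obtain ⟨R, hR, hRU⟩ := Metric.nhds_basis_closedBall.mem_iff.1 (hU.mem_nhds hs0)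
  lift R to NNReal using hR.le
  have hR' : 0 < R := by exact_mod_cast hR
  have hci : CircleIntegrable g s0 R := by
    apply ContinuousOn.circleIntegrable R.2
    exact hc.mono (Metric.sphere_subset_closedBall.trans hRU)
  have hp := hasFPowerSeriesOn_cauchy_integral hci hR'
  have := hp.analyticAt.differentiableAt
  apply DifferentiableAt.differentiableWithinAt
  refine this.congr_of_eventuallyEq ?_
  filter_upwards [Metric.ball_mem_nhds s0 hR] with s hs
  ext x
  have e : (∮ z in C(s0, R), (z - s)⁻¹ • g z) x = ∮ z in C(s0, R), (z - s)⁻¹ • g z x := by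
    simp only [circleIntegral]
    have hI : IntervalIntegrable (fun θ => deriv (circleMap s0 R) θ • (circleMap s0 R θ - s)⁻¹ •
        g (circleMap s0 R θ)) MeasureTheory.volume 0 (2 * Real.pi) := by
      refine CircleIntegrable.out (f := fun z => (z - s)⁻¹ • g z) ?_
      apply ContinuousOn.circleIntegrable R.2
      apply ContinuousOn.fun_smul
      · apply ContinuousOn.inv₀ (by fun_prop)
        intro z hz
        rw [sub_ne_zero]
        rintro rfl
        simp only [Metric.mem_ball, Metric.mem_sphere] at hs hz
        exact hs.ne hz
      · exact hc.mono (Metric.sphere_subset_closedBall.trans hRU)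
    have := (ContinuousMap.evalCLM ℂ x : C(X, F) →L[ℂ] F).intervalIntegral_comp_comm hI
    simpa using this.symm
  simp only [ContinuousMap.smul_apply]
  rw [e]
  have hdx : DifferentiableOn ℂ (fun s => g s x) (Metric.closedBall s0 R) := (hd x).mono hRU
  have := hdx.circleIntegral_sub_inv_smul hs
  rw [this, smul_smul, inv_mul_cancel₀ Complex.two_pi_I_ne_zero, one_smul]

def SepHol {n : ℕ} {F : Type} [NormedAddCommGroup F] [NormedSpace ℂ F]
    (f : (Fin n → ℂ) → F) (U : Set (Fin n → ℂ)) : Prop :=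
  ∀ x ∈ U, ∀ i, DifferentiableAt ℂ (fun s => f (Function.update x i s)) (x i)

lemma sep_cmk {n : ℕ} {X F : Type} [TopologicalSpace X] [CompactSpace X] [NormedAddCommGroup F]
    [NormedSpace ℂ F] [CompleteSpace F] {f : (Fin n → ℂ) → X → F} {U : Set (Fin n → ℂ)}
    (hU : IsOpen U)
    (hc : ContinuousOn (fun p : (Fin n → ℂ) × X => f p.1 p.2) (U ×ˢ univ))
    (hs : ∀ x, SepHol (fun z => f z x) U) : SepHol (fun z => cmk (f z)) U := by
  intro z hz i
  have hcu : Continuous (fun s : ℂ => Function.update z i s) := by fun_prop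
  set V : Set ℂ := (fun s : ℂ => Function.update z i s) ⁻¹' U with hV
  have hVo : IsOpen V := hU.preimage hcu
  have hzV : z i ∈ V := by simpa [hV] using hz
  have hcont : ∀ y ∈ U, Continuous (f y) := by
    intro y hy
    exact hc.comp_continuous (f := fun x => (y, x)) (by fun_prop) (fun x => ⟨hy, mem_univ _⟩)
  have := lemV (g := fun s => cmk (f (Function.update z i s))) hVo
    ((cmk_continuousOn hc).comp hcu.continuousOn (fun s hs => hs)) ?_
  · exact this.differentiableAt (hVo.mem_nhds hzV)
  · intro x s hsV
    apply DifferentiableAt.differentiableWithinAt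
    have h1 := hs x _ hsV i
    simp only [Function.update_idem, Function.update_self] at h1
    refine h1.congr_of_eventuallyEq ?_
    filter_upwards [hVo.mem_nhds hsV] with s' hs'
    rw [cmk_apply (hcont _ hs')]

/-- circle kernel pairing -/
def circB {F : Type} [NormedAddCommGroup F] [NormedSpace ℂ F] [CompleteSpace F]
    (c : ℂ) (R : ℝ) (hR : 0 ≤ R) :
    C(Metric.sphere c R, ℂ) →L[ℂ] C(Metric.sphere c R, F) →L[ℂ] F :=
  LinearMap.mkContinuous₂
    (LinearMap.mk₂ ℂ (fun k φ => ∫ θ in (0:ℝ)..(2 * Real.pi), deriv (circleMap c R) θ •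
      (k ⟨circleMap c R θ, circleMap_mem_sphere c hR θ⟩ •
        φ ⟨circleMap c R θ, circleMap_mem_sphere c hR θ⟩))
      (by
        intro m1 m2 φ
        rw [← intervalIntegral.integral_add]
        · simp [add_smul, smul_add]
        all_goals
          apply Continuous.intervalIntegrable
          simp only [deriv_circleMap]
          fun_prop)
      (by
        intro a m φ
        rw [← intervalIntegral.integral_smul]
        congr 1; ext θ
        simp only [ContinuousMap.smul_apply, smul_smul, smul_eq_mul]
        congr 1; ring)
      (by
        intro m φ1 φ2
        rw [← intervalIntegral.integral_add]
        · simp [add_smul, smul_add]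
        all_goals
          apply Continuous.intervalIntegrable
          simp only [deriv_circleMap]
          fun_prop)
      (by
        intro a m φ
        rw [← intervalIntegral.integral_smul]
        congr 1; ext θ
        simp only [ContinuousMap.smul_apply, smul_smul, smul_eq_mul]
        congr 1; ring))
    (R * |2 * Real.pi - 0|) (by
      intro k φ
      simp only [LinearMap.mk₂_apply]
      refine (intervalIntegral.norm_integral_le_of_norm_le_const (C := R * (‖k‖ * ‖φ‖)) ?_).trans
        (le_of_eq (by ring))
      intro θ _
      rw [norm_smul, norm_smul]
      have : ‖deriv (circleMap c R) θ‖ = R := by simp [deriv_circleMap, abs_of_nonneg hR]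
      rw [this]
      gcongr
      · exact k.norm_coe_le_norm _
      · exact φ.norm_coe_le_norm _)

lemma circB_apply {F : Type} [NormedAddCommGroup F] [NormedSpace ℂ F] [CompleteSpace F]
    (c : ℂ) (R : ℝ) (hR : 0 ≤ R) (k : C(Metric.sphere c R, ℂ)) (φ : C(Metric.sphere c R, F))
    (k' : ℂ → ℂ) (φ' : ℂ → F) (hk : ∀ z, k z = k' z) (hφ : ∀ z, φ z = φ' z) :
    circB c R hR k φ = ∮ z in C(c, R), k' z • φ' z := by
  simp [circB, circleIntegral, hk, hφ]

theorem osgood (n : ℕ) : ∀ {F : Type} [NormedAddCommGroup F] [NormedSpace ℂ F] [CompleteSpace F]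
    {f : (Fin n → ℂ) → F} {U : Set (Fin n → ℂ)}, IsOpen U → ContinuousOn f U → SepHol f U →
    AnalyticOnNhd ℂ f U := by
  induction n with
  | zero =>
    intro F _ _ _ f U hU hc hs x hx
    have : f = fun _ => f x := by
      ext y; rw [Subsingleton.elim y x]
    rw [this]; exact analyticAt_const
  | succ n ih =>
    intro F _ _ _ f U hU hc hs x0 hx0
    obtain ⟨R, hR, hRU⟩ := Metric.nhds_basis_closedBall.mem_iff.1 (hU.mem_nhds hx0)
    have hmem : ∀ (w : ℂ) (z : Fin n → ℂ), w ∈ Metric.closedBall (x0 0) R →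
        z ∈ Metric.closedBall (Fin.tail x0) R → (Fin.cons w z : Fin (n+1) → ℂ) ∈ U := by
      intro w z hw hz
      apply hRU
      rw [Metric.mem_closedBall, dist_pi_le_iff hR.le] at *
      intro i
      refine Fin.cases ?_ (fun j => ?_) i
      · simpa using hw
      · simpa [Fin.tail] using hz j
    set S := Metric.sphere (x0 0) R
    have hSb : ∀ ζ : S, (ζ : ℂ) ∈ Metric.closedBall (x0 0) R :=
      fun ζ => Metric.sphere_subset_closedBall ζ.2
    let Φ : (Fin n → ℂ) → S → F := fun z ζ => f (Fin.cons ζ z)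
    have hΦc : ContinuousOn (fun p : (Fin n → ℂ) × S => Φ p.1 p.2)
        (Metric.ball (Fin.tail x0) R ×ˢ univ) := by
      refine hc.comp (t := U) (f := fun p : (Fin n → ℂ) × S => (Fin.cons (p.2 : ℂ) p.1 : Fin (n+1) → ℂ)) ?_ ?_
      · apply Continuous.continuousOn
        fun_prop
      · rintro ⟨z, ζ⟩ ⟨hz, -⟩
        exact hmem _ _ (hSb ζ) (Metric.ball_subset_closedBall hz)
    have hΦs : ∀ ζ, SepHol (fun z => Φ z ζ) (Metric.ball (Fin.tail x0) R) := by
      intro ζ z hz i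
      have := hs _ (hmem _ _ (hSb ζ) (Metric.ball_subset_closedBall hz)) i.succ
      simpa [Φ, Fin.cons_update] using this
    have hΦa : AnalyticOnNhd ℂ (fun z => cmk (Φ z)) (Metric.ball (Fin.tail x0) R) :=
      ih Metric.isOpen_ball (cmk_continuousOn hΦc) (sep_cmk Metric.isOpen_ball hΦc hΦs)
    let k : ℂ → S → ℂ := fun w ζ => ((ζ : ℂ) - w)⁻¹
    have hne : ∀ w ∈ Metric.ball (x0 0) R, ∀ ζ : S, (ζ : ℂ) - w ≠ 0 := by
      intro w hw ζ h
      rw [sub_eq_zero] at h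
      have := ζ.2
      rw [h] at this
      simp only [S, Metric.mem_sphere, Metric.mem_ball] at this hw
      linarith
    have hkc : ContinuousOn (fun p : ℂ × S => k p.1 p.2) (Metric.ball (x0 0) R ×ˢ univ) := by
      apply ContinuousOn.inv₀
      · fun_prop
      · rintro ⟨w, ζ⟩ ⟨hw, -⟩
        exact hne w hw ζ
    have hkcont : ∀ w ∈ Metric.ball (x0 0) R, Continuous (k w) := by
      intro w hw
      exact hkc.comp_continuous (f := fun x => (w, x)) (by fun_prop) (fun x => ⟨hw, mem_univ _⟩)
    have hΦcont : ∀ w ∈ Metric.ball (Fin.tail x0) R, Continuous (Φ w) := by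
      intro w hw
      exact hΦc.comp_continuous (f := fun x => (w, x)) (by fun_prop) (fun x => ⟨hw, mem_univ _⟩)
    have hka : AnalyticOnNhd ℂ (fun w => cmk (k w)) (Metric.ball (x0 0) R) := by
      apply DifferentiableOn.analyticOnNhd _ Metric.isOpen_ball
      apply lemV Metric.isOpen_ball (cmk_continuousOn hkc)
      intro ζ
      have : DifferentiableOn ℂ (fun w => ((ζ : ℂ) - w)⁻¹) (Metric.ball (x0 0) R) := by
        apply DifferentiableOn.inv
        · fun_prop
        · intro w hw; exact hne w hw ζ
      refine this.congr ?_
      intro w hw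
      rw [cmk_apply (hkcont w hw)]
    let B := circB (F := F) (x0 0) R hR.le
    have hx00 : x0 0 ∈ Metric.ball (x0 0) R := Metric.mem_ball_self hR
    have hx0t : Fin.tail x0 ∈ Metric.ball (Fin.tail x0) R := Metric.mem_ball_self hR
    have h0 : AnalyticAt ℂ (fun x : Fin (n+1) → ℂ => x 0) x0 :=
      (ContinuousLinearMap.proj (R := ℂ) (φ := fun _ : Fin (n+1) => ℂ) 0).analyticAt x0
    have ht : AnalyticAt ℂ (fun x : Fin (n+1) → ℂ => Fin.tail x) x0 :=
      (ContinuousLinearMap.pi (fun i : Fin n => ContinuousLinearMap.proj (R := ℂ)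
        (φ := fun _ : Fin (n+1) => ℂ) i.succ)).analyticAt x0
    have hk1 : AnalyticAt ℂ (fun x : Fin (n+1) → ℂ => cmk (k (x 0))) x0 :=
      AnalyticAt.comp (g := fun w => cmk (k w)) (hka _ hx00) h0
    have hΦ1 : AnalyticAt ℂ (fun x : Fin (n+1) → ℂ => cmk (Φ (Fin.tail x))) x0 :=
      AnalyticAt.comp (g := fun w => cmk (Φ w)) (hΦa _ hx0t) ht
    have hB : AnalyticAt ℂ (fun x : Fin (n+1) → ℂ => B (cmk (k (x 0))) (cmk (Φ (Fin.tail x)))) x0 :=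
      AnalyticAt.comp (g := fun p : C(S, ℂ) × C(S, F) => B p.1 p.2)
        (B.analyticAt_bilinear _) (AnalyticAt.prod hk1 hΦ1)
    have hB' : AnalyticAt ℂ (fun x : Fin (n+1) → ℂ => (2 * Real.pi * Complex.I : ℂ)⁻¹ •
      B (cmk (k (x 0))) (cmk (Φ (Fin.tail x)))) x0 := analyticAt_const.smul hB
    refine hB'.congr ?_
    have e1 : ∀ᶠ x in 𝓝 x0, x 0 ∈ Metric.ball (x0 0) R :=
      h0.continuousAt.eventually (Metric.ball_mem_nhds _ hR)
    have e2 : ∀ᶠ x : Fin (n+1) → ℂ in 𝓝 x0, (Fin.tail x : Fin n → ℂ) ∈ Metric.ball (Fin.tail x0) R :=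
      ht.continuousAt.eventually (Metric.ball_mem_nhds _ hR)
    filter_upwards [e1, e2] with x hx1 hx2
    have := circB_apply (F := F) (x0 0) R hR.le (cmk (k (x 0))) (cmk (Φ (Fin.tail x)))
      (fun z => (z - x 0)⁻¹) (fun z => f (Fin.cons z (Fin.tail x)))
      (fun z => cmk_apply (hkcont _ hx1) z) (fun z => cmk_apply (hΦcont _ hx2) z)
    simp only [B]
    rw [this]
    have hd : DifferentiableOn ℂ (fun z => f (Fin.cons z (Fin.tail x))) (Metric.closedBall (x0 0) R) := by
      intro z hz
      apply DifferentiableAt.differentiableWithinAt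
      have := hs _ (hmem _ _ hz (Metric.ball_subset_closedBall hx2)) 0
      simpa using this
    rw [hd.circleIntegral_sub_inv_smul hx1, smul_smul, inv_mul_cancel₀ Complex.two_pi_I_ne_zero,
      one_smul, Fin.cons_self_tail]

def intCLM : C(Icc (0:ℝ) 1, ℂ) →L[ℂ] ℂ :=
  LinearMap.mkContinuous
    { toFun := fun φ => ∫ t in (0:ℝ)..1, φ (projIcc 0 1 zero_le_one t)
      map_add' := by
        intro a b
        rw [← intervalIntegral.integral_add]
        · rfl
        all_goals
          apply Continuous.intervalIntegrable
          have := continuous_projIcc (h := zero_le_one (α := ℝ))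
          fun_prop
      map_smul' := by
        intro c a
        simp [intervalIntegral.integral_const_mul] }
    1 (by
      intro φ
      have := intervalIntegral.norm_integral_le_of_norm_le_const (a := (0:ℝ)) (b := 1)
        (C := ‖φ‖) (f := fun t => φ (projIcc 0 1 zero_le_one t))
        (fun t _ => φ.norm_coe_le_norm _)
      simpa using this)

lemma param_int {n : ℕ} {f : (Fin n → ℂ) → ℝ → ℂ} {U : Set (Fin n → ℂ)} (hU : IsOpen U)
    (hc : ContinuousOn (fun p : (Fin n → ℂ) × ℝ => f p.1 p.2) (U ×ˢ Icc 0 1))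
    (hs : ∀ t ∈ Icc (0:ℝ) 1, SepHol (fun z => f z t) U) :
    AnalyticOnNhd ℂ (fun z => ∫ t in (0:ℝ)..1, f z t) U := by
  let Φ : (Fin n → ℂ) → Icc (0:ℝ) 1 → ℂ := fun z t => f z t
  have hΦ : ContinuousOn (fun p : (Fin n → ℂ) × Icc (0:ℝ) 1 => Φ p.1 p.2) (U ×ˢ univ) := by
    refine hc.comp (f := fun p : (Fin n → ℂ) × Icc (0:ℝ) 1 => (p.1, (p.2 : ℝ))) ?_ ?_
    · fun_prop
    · rintro ⟨z, t⟩ ⟨hz, -⟩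
      exact ⟨hz, t.2⟩
  have h := osgood n hU (cmk_continuousOn hΦ) (sep_cmk hU hΦ (fun t => hs t t.2))
  have h2 : AnalyticOnNhd ℂ (fun z => intCLM (cmk (Φ z))) U :=
    intCLM.comp_analyticOnNhd h
  refine h2.congr hU ?_
  intro z hz
  have hcz : Continuous (Φ z) :=
    hΦ.comp_continuous (f := fun x => (z, x)) (by fun_prop) (fun x => ⟨hz, mem_univ _⟩)
  simp only [intCLM, LinearMap.mkContinuous_apply, LinearMap.coe_mk, AddHom.coe_mk]
  apply intervalIntegral.integral_congr
  intro t ht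
  rw [uIcc_of_le zero_le_one] at ht
  simp only [cmk_apply hcz, Φ, projIcc_of_mem zero_le_one ht]

lemma sepHol_of_analytic {n : ℕ} {F : Type} [NormedAddCommGroup F] [NormedSpace ℂ F]
    {f : (Fin n → ℂ) → F} {U : Set (Fin n → ℂ)} (h : AnalyticOnNhd ℂ f U) : SepHol f U := by
  intro x hx i
  have h1 : DifferentiableAt ℂ f (Function.update x i (x i)) := by
    simpa using (h x hx).differentiableAt
  exact DifferentiableAt.comp (x i) h1 (by
    rw [differentiableAt_pi]
    intro j
    by_cases hj : j = i
    · subst hj; simp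
    · simp [hj])

def seg (g : ℂ → ℂ) (p q : ℂ) : ℂ := ∫ t in (0:ℝ)..1, (q - p) * g (p + t * (q - p))

lemma seg_h (g : ℂ → ℂ) (a b c : ℝ) :
    seg g (⟨a, c⟩ : ℂ) ⟨b, c⟩ = ∫ x in a..b, g (x + c * Complex.I) := by
  have h := intervalIntegral.smul_integral_comp_mul_add (a := 0) (b := 1)
    (fun x : ℝ => g (x + c * Complex.I)) (b - a) a
  simp only [mul_zero, zero_add, mul_one, sub_add_cancel] at h
  rw [← h, seg, ← intervalIntegral.integral_smul]
  congr 1; ext t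
  have e1 : (⟨b, c⟩ : ℂ) - ⟨a, c⟩ = ((b - a : ℝ) : ℂ) := by
    apply Complex.ext <;> simp
  rw [e1, Complex.real_smul]
  congr 2
  apply Complex.ext <;> simp
  ring

lemma seg_v (g : ℂ → ℂ) (a c d : ℝ) :
    seg g (⟨a, c⟩ : ℂ) ⟨a, d⟩ = Complex.I * ∫ y in c..d, g (a + y * Complex.I) := by
  have h := intervalIntegral.smul_integral_comp_mul_add (a := 0) (b := 1)
    (fun y : ℝ => g (a + y * Complex.I)) (d - c) c
  simp only [mul_zero, zero_add, mul_one, sub_add_cancel] at h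
  rw [← h, seg, ← intervalIntegral.integral_smul, ← intervalIntegral.integral_const_mul]
  congr 1; ext t
  have e1 : (⟨a, d⟩ : ℂ) - ⟨a, c⟩ = Complex.I * ((d - c : ℝ) : ℂ) := by
    apply Complex.ext <;> simp
  rw [e1, Complex.real_smul, mul_assoc]
  congr 3
  apply Complex.ext <;> simp
  ring

lemma seg_symm (g : ℂ → ℂ) (p q : ℂ) : seg g q p = - seg g p q := by
  have h := intervalIntegral.integral_comp_sub_left (a := 0) (b := 1)
    (fun t : ℝ => (q - p) * g (p + t * (q - p))) 1
  simp only [sub_zero, sub_self] at h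
  rw [seg, seg, ← h, ← intervalIntegral.integral_neg]
  congr 1; ext t
  have : q + t * (p - q) = p + ((1 - t : ℝ) : ℂ) * (q - p) := by push_cast; ring
  rw [this]; ring

lemma rect_zero {g : ℂ → ℂ} {a b c d : ℝ} (hab : a ≤ b) (hcd : c ≤ d)
    (hg : DifferentiableOn ℂ g (Icc a b ×ℂ Icc c d)) :
    seg g ⟨a, c⟩ ⟨b, c⟩ + seg g ⟨b, c⟩ ⟨b, d⟩ + seg g ⟨b, d⟩ ⟨a, d⟩ + seg g ⟨a, d⟩ ⟨a, c⟩ = 0 := by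
  have h := Complex.integral_boundary_rect_eq_zero_of_differentiableOn g ⟨a, c⟩ ⟨b, d⟩
    (by simpa [uIcc_of_le hab, uIcc_of_le hcd] using hg)
  simp only [smul_eq_mul] at h
  rw [seg_symm g ⟨a, d⟩ ⟨b, d⟩, seg_symm g ⟨a, c⟩ ⟨a, d⟩, seg_h, seg_h, seg_v, seg_v, ← h]
  ring

lemma seg_log {p q z : ℂ} (h : ∀ t ∈ Icc (0:ℝ) 1, p + t * (q - p) - z ∈ Complex.slitPlane) :
    seg (fun ζ => (ζ - z)⁻¹) p q = Complex.log (q - z) - Complex.log (p - z) := by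
  have := intervalIntegral.integral_eq_sub_of_hasDerivAt (a := 0) (b := 1)
    (f := fun t : ℝ => Complex.log (p + t * (q - p) - z))
    (f' := fun t : ℝ => (q - p) * (p + t * (q - p) - z)⁻¹) ?_ ?_
  · rw [seg, this]; simp
  · intro t ht
    rw [uIcc_of_le zero_le_one] at ht
    have h1 : HasDerivAt (fun t : ℝ => p + t * (q - p) - z) (q - p) t := by
      have := ((Complex.ofRealCLM.hasDerivAt (x := t)).mul_const (q - p)).const_add p |>.sub_const z
      simpa using this
    have := h1.clog_real (h t ht)
    simpa [div_eq_mul_inv] using this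
  · apply ContinuousOn.intervalIntegrable
    rw [uIcc_of_le zero_le_one]
    apply ContinuousOn.mul (by fun_prop)
    apply ContinuousOn.inv₀ (by fun_prop)
    intro t ht
    exact Complex.slitPlane_ne_zero (h t ht)

lemma seg_neg {p q z : ℂ} : seg (fun ζ => (ζ - z)⁻¹) p q = seg (fun ζ => (ζ - (-z))⁻¹) (-p) (-q) := by
  unfold seg
  congr 1; ext t
  have : -p + t * (-q - -p) - -z = -(p + t * (q - p) - z) := by ring
  simp only [this, inv_neg]; ring

lemma log_neg_im {w : ℂ} (h : 0 < w.im) : Complex.log w - Complex.log (-w) = Real.pi * Complex.I := by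
  have hw : w ≠ 0 := by rintro rfl; simp at h
  simp only [Complex.log, norm_neg, Complex.arg_neg_eq_arg_sub_pi_of_im_pos h]
  push_cast; ring

lemma rect_wind {a b c d : ℝ} {z : ℂ} (h1 : a < z.re) (h2 : z.re < b) (h3 : c < z.im)
    (h4 : z.im < d) :
    seg (fun ζ => (ζ - z)⁻¹) ⟨a, c⟩ ⟨b, c⟩ + seg (fun ζ => (ζ - z)⁻¹) ⟨b, c⟩ ⟨b, d⟩ +
      seg (fun ζ => (ζ - z)⁻¹) ⟨b, d⟩ ⟨a, d⟩ + seg (fun ζ => (ζ - z)⁻¹) ⟨a, d⟩ ⟨a, c⟩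
      = 2 * Real.pi * Complex.I := by
  rw [seg_log (p := ⟨a, c⟩), seg_log (p := ⟨b, c⟩), seg_log (p := ⟨b, d⟩), seg_neg (p := ⟨a, d⟩),
    seg_log (p := -⟨a, d⟩)]
  · have e1 := log_neg_im (w := ⟨a, d⟩ - z) (by simpa using h4)
    have e2 := log_neg_im (w := -(⟨a, c⟩ - z)) (by simpa using h3)
    rw [neg_neg] at e2
    have e3 : -(⟨a, d⟩ : ℂ) - -z = -(⟨a, d⟩ - z) := by ring
    have e4 : -(⟨a, c⟩ : ℂ) - -z = -(⟨a, c⟩ - z) := by ring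
    rw [e3, e4]
    linear_combination e1 + e2
  all_goals intro t ht
  · left
    simp; linarith
  · right
    simp; linarith
  · left
    simp; linarith
  · right
    simp; linarith

lemma rect_cauchy {f : ℂ → ℂ} {a b c d : ℝ} {z : ℂ} (h1 : a < z.re) (h2 : z.re < b) (h3 : c < z.im)
    (h4 : z.im < d) (hf : DifferentiableOn ℂ f (Icc a b ×ℂ Icc c d)) :
    seg (fun ζ => f ζ * (ζ - z)⁻¹) ⟨a, c⟩ ⟨b, c⟩ + seg (fun ζ => f ζ * (ζ - z)⁻¹) ⟨b, c⟩ ⟨b, d⟩ +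
      seg (fun ζ => f ζ * (ζ - z)⁻¹) ⟨b, d⟩ ⟨a, d⟩ + seg (fun ζ => f ζ * (ζ - z)⁻¹) ⟨a, d⟩ ⟨a, c⟩
      = 2 * Real.pi * Complex.I * f z := by
  have hnh : Icc a b ×ℂ Icc c d ∈ 𝓝 z := by
    have := Complex.continuous_re.continuousAt.preimage_mem_nhds (Icc_mem_nhds h1 h2)
    have h' := Complex.continuous_im.continuousAt.preimage_mem_nhds (Icc_mem_nhds h3 h4)
    exact inter_mem this h'
  have hd := (Complex.differentiableOn_dslope hnh).2 hf
  have h0 := rect_zero (h1.trans h2).le (h3.trans h4).le hd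
  have hw := rect_wind h1 h2 h3 h4
  have key : ∀ p q : ℂ, (∀ t ∈ Icc (0:ℝ) 1, p + t * (q - p) ≠ z) →
      (∀ t ∈ Icc (0:ℝ) 1, p + t * (q - p) ∈ Icc a b ×ℂ Icc c d) →
      seg (fun ζ => f ζ * (ζ - z)⁻¹) p q = seg (dslope f z) p q + f z * seg (fun ζ => (ζ - z)⁻¹) p q := by
    intro p q hne hmem
    unfold seg
    rw [← intervalIntegral.integral_const_mul, ← intervalIntegral.integral_add]
    · apply intervalIntegral.integral_congr
      intro t ht
      rw [uIcc_of_le zero_le_one] at ht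
      simp only
      rw [dslope_of_ne _ (hne t ht), slope_def_field]
      field_simp
      ring
    · apply ContinuousOn.intervalIntegrable
      rw [uIcc_of_le zero_le_one]
      apply ContinuousOn.mul (by fun_prop)
      exact hd.continuousOn.comp (by fun_prop) hmem
    · apply ContinuousOn.intervalIntegrable
      rw [uIcc_of_le zero_le_one]
      apply ContinuousOn.mul (by fun_prop)
      apply ContinuousOn.mul (by fun_prop)
      apply ContinuousOn.inv₀ (by fun_prop)
      intro t ht
      exact sub_ne_zero.2 (hne t ht)
  have hab := h1.trans h2
  have hcd := h3.trans h4
  rw [key ⟨a, c⟩ ⟨b, c⟩, key ⟨b, c⟩ ⟨b, d⟩, key ⟨b, d⟩ ⟨a, d⟩, key ⟨a, d⟩ ⟨a, c⟩]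
  · linear_combination h0 + f z * hw
  all_goals
    rintro t ⟨ht0, ht1⟩
    first
      | (intro h; rw [Complex.ext_iff] at h; simp at h; linarith [h.1, h.2])
      | (rw [Complex.mem_reProdIm]; refine ⟨⟨?_, ?_⟩, ⟨?_, ?_⟩⟩ <;> simp <;> nlinarith)

def ell {n : ℕ} (i : Fin n × Bool) (z : Fin n → ℂ) : ℝ := if i.2 then (z i.1).re else (z i.1).im

lemma ell_cont {n : ℕ} (i : Fin n × Bool) : Continuous (ell i) := by
  unfold ell
  split_ifs <;> fun_prop

def box {n : ℕ} (a b : Fin n × Bool → ℝ) : Set (Fin n → ℂ) := {z | ∀ i, a i ≤ ell i z ∧ ell i z ≤ b i}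

lemma box_closed {n : ℕ} (a b : Fin n × Bool → ℝ) : IsClosed (box a b) := by
  have : box a b = ⋂ i, {z | a i ≤ ell i z} ∩ {z | ell i z ≤ b i} := by
    ext z; simp [box]
  rw [this]
  exact isClosed_iInter fun i =>
    (isClosed_le continuous_const (ell_cont i)).inter (isClosed_le (ell_cont i) continuous_const)

lemma dist_le_ell {n : ℕ} {z y : Fin n → ℂ} {ε : ℝ} (hε : 0 ≤ ε)
    (h : ∀ i, |ell i z - ell i y| ≤ ε) : dist z y ≤ 2 * ε := by
  rw [dist_pi_le_iff (by linarith)]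
  intro j
  have h1 := h (j, true)
  have h2 := h (j, false)
  simp only [ell, if_true] at h1 h2
  rw [dist_eq_norm]
  refine (Complex.norm_le_abs_re_add_abs_im _).trans ?_
  simp only [Complex.sub_re, Complex.sub_im]
  simp at h2
  linarith

lemma box_compact {n : ℕ} (a b : Fin n × Bool → ℝ) : IsCompact (box a b) := by
  apply Metric.isCompact_of_isClosed_isBounded (box_closed a b)
  rw [Metric.isBounded_iff]
  refine ⟨2 * ∑ i, |b i - a i|, fun z hz y hy => dist_le_ell (by positivity) fun i => ?_⟩
  have : |ell i z - ell i y| ≤ |b i - a i| := by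
    have h1 := hz i
    have h2 := hy i
    rw [abs_of_nonneg (by linarith : 0 ≤ b i - a i), abs_le]
    constructor <;> linarith
  exact this.trans (Finset.single_le_sum (f := fun i => |b i - a i|) (fun i _ => abs_nonneg _)
    (Finset.mem_univ i))

lemma box_thick {n : ℕ} {a b : Fin n × Bool → ℝ} (hab : ∀ i, a i ≤ b i) {O : Set (Fin n → ℂ)}
    (hO : IsOpen O) (h : box a b ⊆ O) : ∃ ε > 0, box (fun i => a i - ε) (fun i => b i + ε) ⊆ O := by
  obtain ⟨δ, hδ, hδO⟩ := (box_compact a b).exists_cthickening_subset_open hO h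
  refine ⟨δ / 2, by positivity, fun z hz => hδO ?_⟩
  let y : Fin n → ℂ := fun j => ⟨max (a (j, true)) (min (b (j, true)) (z j).re),
    max (a (j, false)) (min (b (j, false)) (z j).im)⟩
  have hy : ∀ i, ell i y = max (a i) (min (b i) (ell i z)) := by
    rintro ⟨j, _ | _⟩ <;> simp [ell, y]
  have hyb : y ∈ box a b := by
    intro i
    rw [hy]
    exact ⟨le_max_left _ _, max_le (hab i) (min_le_left _ _)⟩
  refine Metric.mem_cthickening_of_dist_le z y δ _ hyb ?_
  have : dist z y ≤ 2 * (δ / 2) := by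
    apply dist_le_ell (by positivity)
    intro i
    have h1 := hz i
    have h2 := hab i
    simp only at h1
    rw [hy, abs_le]
    rcases le_total (b i) (ell i z) with h4 | h4
    · rw [min_eq_left h4, max_eq_right h2]
      constructor <;> linarith
    · rw [min_eq_right h4]
      rcases le_total (a i) (ell i z) with h3 | h3
      · rw [max_eq_right h3]
        constructor <;> linarith
      · rw [max_eq_left h3]
        constructor <;> linarith
  linarith

lemma edge_an {n : ℕ} {H : (Fin n → ℂ) → ℂ} {j : Fin n} {p q : ℂ} {x0 : Fin n → ℂ}
    (h : ∀ t ∈ Icc (0:ℝ) 1, p + t * (q - p) ≠ x0 j ∧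
      AnalyticAt ℂ H (Function.update x0 j (p + t * (q - p)))) :
    AnalyticAt ℂ (fun x => seg (fun ζ => H (Function.update x j ζ) * (ζ - x j)⁻¹) p q) x0 := by
  let ζ : ℝ → ℂ := fun t => p + t * (q - p)
  have hζ : Continuous ζ := by fun_prop
  have hup : Continuous (fun y : (Fin n → ℂ) × ℝ => Function.update y.1 j (ζ y.2)) := by fun_prop
  let O : Set ((Fin n → ℂ) × ℝ) := {y | ζ y.2 ≠ y.1 j} ∩
    (fun y : (Fin n → ℂ) × ℝ => Function.update y.1 j (ζ y.2)) ⁻¹' {z | AnalyticAt ℂ H z}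
  have hO : IsOpen O := by
    apply IsOpen.inter
    · exact isOpen_ne_fun (by fun_prop) (by fun_prop)
    · exact (isOpen_analyticAt ℂ H).preimage hup
  obtain ⟨U, V, hU, hV, hxU, hIV, hUV⟩ := generalized_tube_lemma (s := {x0}) isCompact_singleton
    (t := Icc (0:ℝ) 1) isCompact_Icc hO (by
      rintro ⟨x, t⟩ ⟨hx, ht⟩
      rw [mem_singleton_iff] at hx
      simp only at hx ht
      subst hx
      exact h t ht)
  have hmem : ∀ x ∈ U, ∀ t ∈ Icc (0:ℝ) 1, ζ t ≠ x j ∧ AnalyticAt ℂ H (Function.update x j (ζ t)) :=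
    fun x hx t ht => hUV (mk_mem_prod hx (hIV ht))
  refine param_int (f := fun x t => (q - p) * (H (Function.update x j (ζ t)) * (ζ t - x j)⁻¹)) hU ?_ ?_ x0
    (hxU rfl)
  · apply ContinuousOn.mul continuousOn_const
    apply ContinuousOn.mul
    · intro y hy
      have := (hmem _ hy.1 _ hy.2).2.continuousAt
      exact (ContinuousAt.comp (f := fun y : (Fin n → ℂ) × ℝ => Function.update y.1 j (ζ y.2)) (x := y)
        this hup.continuousAt).continuousWithinAt
    · apply ContinuousOn.inv₀ (by fun_prop)
      intro y hy
      exact sub_ne_zero.2 (hmem _ hy.1 _ hy.2).1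
  · intro t ht
    apply sepHol_of_analytic
    intro x hx
    have hpr : ∀ k, AnalyticAt ℂ (fun x : Fin n → ℂ => x k) x := fun k =>
      (ContinuousLinearMap.proj (R := ℂ) (φ := fun _ : Fin n => ℂ) k).analyticAt x
    apply AnalyticAt.fun_mul analyticAt_const
    apply AnalyticAt.fun_mul
    · refine AnalyticAt.comp_of_eq (f := fun x => Function.update x j (ζ t)) (hmem x hx t ht).2 ?_ rfl
      have : (fun x : Fin n → ℂ => Function.update x j (ζ t)) =
          fun x k => if k = j then ζ t else x k := by
        ext x k; simp [Function.update_apply]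
      rw [this]
      apply AnalyticAt.pi
      intro k
      by_cases hk : k = j
      · simp only [hk, if_true]; exact analyticAt_const
      · simp only [hk, if_false]; exact hpr k
    · apply AnalyticAt.fun_inv
      · exact analyticAt_const.sub (hpr j)
      · exact sub_ne_zero.2 (hmem x hx t ht).1

lemma edge_h {n : ℕ} {H : (Fin n → ℂ) → ℂ} {j : Fin n} {p q y A B C D : ℝ} {x0 : Fin n → ℂ}
    (hp : p ∈ Icc A B) (hq : q ∈ Icc A B) (hy : y ∈ Icc C D) (hne : y ≠ (x0 j).im)
    (h : ∀ ζ ∈ Icc A B ×ℂ Icc C D, AnalyticAt ℂ H (Function.update x0 j ζ)) :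
    AnalyticAt ℂ (fun x => seg (fun ζ => H (Function.update x j ζ) * (ζ - x j)⁻¹) ⟨p, y⟩ ⟨q, y⟩) x0 := by
  apply edge_an
  intro t ht
  have him : ((⟨p, y⟩ : ℂ) + t * ((⟨q, y⟩ : ℂ) - ⟨p, y⟩)).im = y := by simp
  have hre : ((⟨p, y⟩ : ℂ) + t * ((⟨q, y⟩ : ℂ) - ⟨p, y⟩)).re = p + t * (q - p) := by simp
  refine ⟨fun e => hne (by rw [← e, him]), h _ ?_⟩
  rw [Complex.mem_reProdIm, him, hre]
  exact ⟨(convex_Icc A B).add_smul_sub_mem hp hq ht, hy⟩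

lemma edge_v {n : ℕ} {H : (Fin n → ℂ) → ℂ} {j : Fin n} {p q y A B C D : ℝ} {x0 : Fin n → ℂ}
    (hp : p ∈ Icc C D) (hq : q ∈ Icc C D) (hy : y ∈ Icc A B) (hne : y ≠ (x0 j).re)
    (h : ∀ ζ ∈ Icc A B ×ℂ Icc C D, AnalyticAt ℂ H (Function.update x0 j ζ)) :
    AnalyticAt ℂ (fun x => seg (fun ζ => H (Function.update x j ζ) * (ζ - x j)⁻¹) ⟨y, p⟩ ⟨y, q⟩) x0 := by
  apply edge_an
  intro t ht
  have him : ((⟨y, p⟩ : ℂ) + t * ((⟨y, q⟩ : ℂ) - ⟨y, p⟩)).re = y := by simp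
  have hre : ((⟨y, p⟩ : ℂ) + t * ((⟨y, q⟩ : ℂ) - ⟨y, p⟩)).im = p + t * (q - p) := by simp
  refine ⟨fun e => hne (by rw [← e, him]), h _ ?_⟩
  rw [Complex.mem_reProdIm, him, hre]
  exact ⟨hy, (convex_Icc C D).add_smul_sub_mem hp hq ht⟩

def Splits {n : ℕ} (Q : Set (Fin n → ℂ)) : Prop :=
  ∀ (a b : Fin n × Bool → ℝ) (i : Fin n × Bool) (c : ℝ) (H : (Fin n → ℂ) → ℂ),
    AnalyticOnNhd ℂ H (Q ∩ box a b ∩ {z | ell i z = c}) →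
    ∃ H1 H2 : (Fin n → ℂ) → ℂ, AnalyticOnNhd ℂ H1 (Q ∩ box a b ∩ {z | ell i z ≤ c}) ∧
      AnalyticOnNhd ℂ H2 (Q ∩ box a b ∩ {z | c ≤ ell i z}) ∧
      ∀ x ∈ Q ∩ box a b ∩ {z | ell i z = c}, ∀ᶠ y in 𝓝 x, H y = H1 y - H2 y

lemma splits_univ (n : ℕ) : Splits (univ : Set (Fin n → ℂ)) := by
  intro a b i c H hH
  simp only [univ_inter] at *
  by_cases hne : (box a b ∩ {z | ell i z = c}) = ∅
  · refine ⟨if c < a i then 0 else 0, 0, ?_, ?_, ?_⟩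
    · split_ifs <;> exact fun x _ => analyticAt_const
    · exact fun x _ => analyticAt_const
    · intro x hx; rw [hne] at hx; exact hx.elim
  obtain ⟨z0, hz0, hz0c⟩ := nonempty_iff_ne_empty.2 hne
  have hab : ∀ k, a k ≤ b k := fun k => (hz0 k).1.trans (hz0 k).2
  have hac : a i ≤ c := hz0c ▸ (hz0 i).1
  have hcb : c ≤ b i := hz0c ▸ (hz0 i).2
  let a' := Function.update a i c
  let b' := Function.update b i c
  have hai : a' i = c := by simp [a']
  have hbi : b' i = c := by simp [b']
  have hak : ∀ k, k ≠ i → a' k = a k := fun k hk => by simp [a', hk]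
  have hbk : ∀ k, k ≠ i → b' k = b k := fun k hk => by simp [b', hk]
  have hab' : ∀ k, a' k ≤ b' k := by
    intro k
    by_cases hk : k = i
    · subst hk; rw [hai, hbi]
    · rw [hak k hk, hbk k hk]; exact hab k
  have hsl : box a' b' ⊆ {z | AnalyticAt ℂ H z} := by
    intro z hz
    have hzi := hz i
    rw [hai, hbi] at hzi
    refine hH z ⟨fun k => ?_, le_antisymm hzi.2 hzi.1⟩
    by_cases hk : k = i
    · subst hk; exact ⟨hac.trans hzi.1, hzi.2.trans hcb⟩
    · have := hz k; rwa [hak k hk, hbk k hk] at this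
  obtain ⟨ε, hε, hεH⟩ := box_thick hab' (isOpen_analyticAt ℂ H) hsl
  obtain ⟨j, s⟩ := i
  set A := a' (j, true) - ε with hA
  set B := b' (j, true) + ε with hB
  set C := a' (j, false) - ε with hC
  set D := b' (j, false) + ε with hD
  have hAB : A ≤ B := by have := hab' (j, true); linarith
  have hCD : C ≤ D := by have := hab' (j, false); linarith
  have hAn : ∀ x, (∀ k : Fin n × Bool, k.1 ≠ j → a k - ε ≤ ell k x ∧ ell k x ≤ b k + ε) →
      ∀ ζ ∈ Icc A B ×ℂ Icc C D, AnalyticAt ℂ H (Function.update x j ζ) := by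
    intro x hx ζ hζ
    rw [Complex.mem_reProdIm] at hζ
    refine hεH fun k => ?_
    obtain ⟨k, r⟩ := k
    by_cases hk : k = j
    · subst hk
      cases r
      · have := hζ.2
        simp only [ell, Function.update_self]
        exact this
      · have := hζ.1
        simp only [ell, Function.update_self, if_true]
        exact this
    · have h1 := hx (k, r) hk
      simp only
      rw [hak _ (by simp [hk]), hbk _ (by simp [hk])]
      simpa [ell, hk] using h1
  have hAn' : ∀ x ∈ box a b, ∀ ζ ∈ Icc A B ×ℂ Icc C D, AnalyticAt ℂ H (Function.update x j ζ) :=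
    fun x hx => hAn x fun k _ => ⟨by linarith [(hx k).1], by linarith [(hx k).2]⟩
  let G : ℂ → ℂ → (Fin n → ℂ) → ℂ := fun p q x =>
    seg (fun ζ => H (Function.update x j ζ) * (ζ - x j)⁻¹) p q
  let Bo := G ⟨A, C⟩ ⟨B, C⟩
  let Ri := G ⟨B, C⟩ ⟨B, D⟩
  let To := G ⟨B, D⟩ ⟨A, D⟩
  let Le := G ⟨A, D⟩ ⟨A, C⟩
  let κ : ℂ := (2 * Real.pi * Complex.I)⁻¹
  have hA1 : A ∈ Icc A B := ⟨le_rfl, hAB⟩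
  have hB1 : B ∈ Icc A B := ⟨hAB, le_rfl⟩
  have hC1 : C ∈ Icc C D := ⟨le_rfl, hCD⟩
  have hD1 : D ∈ Icc C D := ⟨hCD, le_rfl⟩
  have hBo : ∀ x ∈ box a b, C ≠ (x j).im → AnalyticAt ℂ Bo x := fun x hx hn =>
    edge_h hA1 hB1 hC1 hn (hAn' x hx)
  have hTo : ∀ x ∈ box a b, D ≠ (x j).im → AnalyticAt ℂ To x := fun x hx hn =>
    edge_h hB1 hA1 hD1 hn (hAn' x hx)
  have hRi : ∀ x ∈ box a b, B ≠ (x j).re → AnalyticAt ℂ Ri x := fun x hx hn =>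
    edge_v hC1 hD1 hB1 hn (hAn' x hx)
  have hLe : ∀ x ∈ box a b, A ≠ (x j).re → AnalyticAt ℂ Le x := fun x hx hn =>
    edge_v hD1 hC1 hA1 hn (hAn' x hx)
  have key : ∀ x ∈ box a b ∩ {z | ell (j, s) z = c}, ∀ᶠ y in 𝓝 x,
      κ * (Bo y + Ri y + To y + Le y) = H y := by
    intro x hx
    have hx' : x ∈ box a' b' := by
      intro k
      by_cases hk : k = (j, s)
      · subst hk; rw [hai, hbi]; exact ⟨hx.2.ge, hx.2.le⟩
      · rw [hak k hk, hbk k hk]; exact hx.1 k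
    have hev : ∀ᶠ y in 𝓝 x, ∀ k, a' k - ε < ell k y ∧ ell k y < b' k + ε := by
      rw [eventually_all]
      intro k
      have hk := hx' k
      exact ((ell_cont k).continuousAt.eventually (lt_mem_nhds (by linarith [hk.1]))).and
        ((ell_cont k).continuousAt.eventually (gt_mem_nhds (by linarith [hk.2])))
    filter_upwards [hev] with y hy
    have h1 := hy (j, true)
    have h2 := hy (j, false)
    simp only [ell, if_true] at h1 h2
    simp at h2
    have hd : DifferentiableOn ℂ (fun ζ => H (Function.update y j ζ)) (Icc A B ×ℂ Icc C D) := by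
      intro ζ hζ
      have h3 := hAn y (fun k hk => by
        have hki : k ≠ (j, s) := fun e => hk (by rw [e])
        have := hy k
        rw [hak k hki, hbk k hki] at this
        exact ⟨this.1.le, this.2.le⟩) ζ hζ
      have h4 : DifferentiableAt ℂ (fun ζ => Function.update y j ζ) ζ :=
        (hasDerivAt_update y j ζ).differentiableAt
      exact (DifferentiableAt.comp ζ (g := H) (f := fun ζ => Function.update y j ζ)
        h3.differentiableAt h4).differentiableWithinAt
    have hc := rect_cauchy h1.1 h1.2 h2.1 h2.2 hd
    have hpi : (2 * Real.pi * Complex.I : ℂ) ≠ 0 := by simp [Real.pi_ne_zero]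
    show κ * (_ + _ + _ + _) = _
    change κ * (seg _ _ _ + seg _ _ _ + seg _ _ _ + seg _ _ _) = _
    rw [hc, Function.update_eq_self]
    simp only [κ]
    rw [← mul_assoc, inv_mul_cancel₀ hpi, one_mul]
  cases s
  · refine ⟨fun x => κ * (Ri x + To x + Le x), fun x => - (κ * Bo x), ?_, ?_, ?_⟩
    · intro x hx
      have h1 := hx.1 (j, true)
      have h2 : ell (j, false) x ≤ c := hx.2
      rw [hak _ (by simp)] at hA
      rw [hbk _ (by simp)] at hB
      rw [hbi] at hD
      simp [ell] at h1 h2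
      exact analyticAt_const.fun_mul (((hRi x hx.1 (ne_of_gt (by linarith))).fun_add
        (hTo x hx.1 (ne_of_gt (by linarith)))).fun_add (hLe x hx.1 (ne_of_lt (by linarith))))
    · intro x hx
      have h2 : c ≤ ell (j, false) x := hx.2
      rw [hai] at hC
      simp [ell] at h2
      exact (analyticAt_const.fun_mul (hBo x hx.1 (ne_of_lt (by linarith)))).fun_neg
    · intro x hx
      filter_upwards [key x hx] with y hy
      rw [← hy]; ring
  · refine ⟨fun x => κ * (Bo x + Ri x + To x), fun x => - (κ * Le x), ?_, ?_, ?_⟩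
    · intro x hx
      have h1 := hx.1 (j, false)
      have h2 : ell (j, true) x ≤ c := hx.2
      rw [hak _ (by simp)] at hC
      rw [hbk _ (by simp)] at hD
      rw [hbi] at hB
      simp [ell] at h1 h2
      exact analyticAt_const.fun_mul (((hBo x hx.1 (ne_of_lt (by linarith))).fun_add
        (hRi x hx.1 (ne_of_gt (by linarith)))).fun_add (hTo x hx.1 (ne_of_gt (by linarith))))
    · intro x hx
      have h2 : c ≤ ell (j, true) x := hx.2
      rw [hai] at hA
      simp [ell] at h2
      exact (analyticAt_const.fun_mul (hLe x hx.1 (ne_of_lt (by linarith)))).fun_neg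
    · intro x hx
      filter_upwards [key x hx] with y hy
      rw [← hy]; ring

def Sol {n : ℕ} (h f : (Fin n → ℂ) → ℂ) (K : Set (Fin n → ℂ)) : Prop :=
  ∃ F : (Fin n → ℂ) → ℂ, AnalyticOnNhd ℂ F K ∧ ∀ x ∈ K, h x = 0 →
    ∃ g : (Fin n → ℂ) → ℂ, AnalyticAt ℂ g x ∧ ∀ᶠ y in 𝓝 x, F y = f y + h y * g y

lemma quot_ext {n : ℕ} {h D g : (Fin n → ℂ) → ℂ} (hd : Dense {y | h y ≠ 0}) {x : Fin n → ℂ}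
    (hg : AnalyticAt ℂ g x) (he : ∀ᶠ y in 𝓝 x, D y = h y * g y) :
    ∀ᶠ y in 𝓝 x, extendFrom {y | h y ≠ 0} (fun y => D y / h y) y = g y := by
  filter_upwards [he.eventually_nhds, hg.eventually_analyticAt] with y hy hgy
  refine extendFrom_eq (hd y) ?_
  have h1 : Tendsto g (𝓝[{y | h y ≠ 0}] y) (𝓝 (g y)) := hgy.continuousAt.tendsto.mono_left nhdsWithin_le_nhds
  refine h1.congr' ?_
  filter_upwards [nhdsWithin_le_nhds hy, self_mem_nhdsWithin] with w hw hw'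
  have : h w ≠ 0 := hw'
  rw [hw]; field_simp

lemma sol_glue {n : ℕ} {Q : Set (Fin n → ℂ)} (hQ : Splits Q) {h f : (Fin n → ℂ) → ℂ}
    (hh : ∀ x, AnalyticAt ℂ h x) (hd : Dense {y | h y ≠ 0}) {a b : Fin n × Bool → ℝ}
    {i : Fin n × Bool} {c : ℝ}
    (h1 : Sol h f (Q ∩ box a b ∩ {z | ell i z ≤ c})) (h2 : Sol h f (Q ∩ box a b ∩ {z | c ≤ ell i z})) :
    Sol h f (Q ∩ box a b) := by
  obtain ⟨F1, hF1, hg1⟩ := h1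
  obtain ⟨F2, hF2, hg2⟩ := h2
  let D := fun y => F1 y - F2 y
  let H := extendFrom {y | h y ≠ 0} (fun y => D y / h y)
  have key : ∀ x ∈ Q ∩ box a b ∩ {z | ell i z = c}, AnalyticAt ℂ H x ∧ ∀ᶠ y in 𝓝 x, D y = h y * H y := by
    rintro x ⟨hx, hxc⟩
    have hx1 : x ∈ Q ∩ box a b ∩ {z | ell i z ≤ c} := ⟨hx, le_of_eq hxc⟩
    have hx2 : x ∈ Q ∩ box a b ∩ {z | c ≤ ell i z} := ⟨hx, ge_of_eq hxc⟩
    have : ∃ g : (Fin n → ℂ) → ℂ, AnalyticAt ℂ g x ∧ ∀ᶠ y in 𝓝 x, D y = h y * g y := by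
      by_cases h0 : h x = 0
      · obtain ⟨g1, hg1, e1⟩ := hg1 x hx1 h0
        obtain ⟨g2, hg2, e2⟩ := hg2 x hx2 h0
        refine ⟨fun y => g1 y - g2 y, hg1.sub hg2, ?_⟩
        filter_upwards [e1, e2] with y e1 e2
        simp only [D, e1, e2]; ring
      · refine ⟨fun y => D y / h y, ((hF1 x hx1).sub (hF2 x hx2)).div (hh x) h0, ?_⟩
        filter_upwards [(hh x).continuousAt.eventually_ne h0] with y hy
        field_simp
    obtain ⟨g, hg, e⟩ := this
    have hq := quot_ext hd hg e
    refine ⟨hg.congr ?_, ?_⟩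
    · filter_upwards [hq] with y hy; exact hy.symm
    · filter_upwards [hq, e] with y hy e; rw [e]; congr 1; exact hy.symm
  obtain ⟨H1, H2, hH1, hH2, hH⟩ := hQ a b i c H (fun x hx => (key x hx).1)
  let L := fun y => F1 y - h y * H1 y
  let R := fun y => F2 y - h y * H2 y
  let F := fun y => if ell i y ≤ c then L y else R y
  have hFL : ∀ x ∈ Q ∩ box a b, ell i x ≤ c → ∀ᶠ y in 𝓝 x, F y = L y := by
    intro x hx hc
    rcases hc.lt_or_eq with hc | hc
    · filter_upwards [(ell_cont i).continuousAt.eventually (gt_mem_nhds hc)] with y hy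
      simp [F, hy.le]
    · filter_upwards [hH x ⟨hx, hc⟩, (key x ⟨hx, hc⟩).2] with y h1 h2
      simp only [F]
      split_ifs
      · rfl
      · simp only [D] at h2
        simp only [L, R]
        rw [h1] at h2
        linear_combination -h2
  have hFR : ∀ x ∈ Q ∩ box a b, ¬ ell i x ≤ c → ∀ᶠ y in 𝓝 x, F y = R y := by
    intro x hx hc
    filter_upwards [(ell_cont i).continuousAt.eventually (lt_mem_nhds (not_le.1 hc))] with y hy
    simp [F, not_le.2 hy]
  refine ⟨F, ?_, ?_⟩
  · intro x hx
    by_cases hc : ell i x ≤ c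
    · refine AnalyticAt.congr (f := L) ((hF1 x ⟨hx, hc⟩).sub ((hh x).mul (hH1 x ⟨hx, hc⟩))) ?_
      filter_upwards [hFL x hx hc] with y hy; exact hy.symm
    · have hc' : c ≤ ell i x := (not_le.1 hc).le
      refine AnalyticAt.congr (f := R) ((hF2 x ⟨hx, hc'⟩).sub ((hh x).mul (hH2 x ⟨hx, hc'⟩))) ?_
      filter_upwards [hFR x hx hc] with y hy; exact hy.symm
  · intro x hx h0
    by_cases hc : ell i x ≤ c
    · obtain ⟨g1, hg1, e1⟩ := hg1 x ⟨hx, hc⟩ h0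
      refine ⟨fun y => g1 y - H1 y, hg1.sub (hH1 x ⟨hx, hc⟩), ?_⟩
      filter_upwards [hFL x hx hc, e1] with y hy e1
      rw [hy]; simp only [L, e1]; ring
    · have hc' : c ≤ ell i x := (not_le.1 hc).le
      obtain ⟨g1, hg1, e1⟩ := hg2 x ⟨hx, hc'⟩ h0
      refine ⟨fun y => g1 y - H2 y, hg1.sub (hH2 x ⟨hx, hc'⟩), ?_⟩
      filter_upwards [hFR x hx hc, e1] with y hy e1
      rw [hy]; simp only [R, e1]; ring

lemma sol_mono {n : ℕ} {h f : (Fin n → ℂ) → ℂ} {K K' : Set (Fin n → ℂ)} (hK : K' ⊆ K)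
    (hs : Sol h f K) : Sol h f K' := by
  obtain ⟨F, h1, h2⟩ := hs
  exact ⟨F, h1.mono hK, fun x hx => h2 x (hK hx)⟩

lemma step {n : ℕ} {Q : Set (Fin n → ℂ)} (hQc : IsClosed Q) (hQ : Splits Q) {h f : (Fin n → ℂ) → ℂ}
    (hh : ∀ x, AnalyticAt ℂ h x) (hd : Dense {y | h y ≠ 0}) {a b : Fin n × Bool → ℝ}
    (hf : ∀ x ∈ Q ∩ box a b, h x = 0 → AnalyticAt ℂ f x) : Sol h f (Q ∩ box a b) := by
  have hloc : ∀ x : (Q ∩ box a b : Set _), ∃ U : Set (Fin n → ℂ), IsOpen U ∧ x.1 ∈ U ∧ Sol h f U := by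
    rintro ⟨x, hx⟩
    by_cases h0 : h x = 0
    · refine ⟨{y | AnalyticAt ℂ f y}, isOpen_analyticAt ℂ f, hf x hx h0, f, fun y hy => hy, ?_⟩
      intro y _ _
      exact ⟨0, analyticAt_const, by simp⟩
    · refine ⟨{y | h y ≠ 0}, ?_, h0, 0, fun y _ => analyticAt_const, fun y hy hy' => (hy hy').elim⟩
      exact isOpen_ne_fun (continuous_iff_continuousAt.2 fun x => (hh x).continuousAt) continuous_const
  choose U hUo hxU hUs using hloc
  have hK : IsCompact (Q ∩ box a b) := (box_compact a b).inter_left hQc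
  obtain ⟨δ, hδ, hL⟩ := lebesgue_number_lemma_of_metric hK hUo (fun x hx => mem_iUnion.2 ⟨⟨x, hx⟩, hxU _⟩)
  set η := δ / 3 with hη
  have hη0 : 0 < η := by positivity
  have claim : ∀ S : Finset (Fin n × Bool), ∀ a' b' : Fin n × Bool → ℝ, box a' b' ⊆ box a b →
      (∀ k ∉ S, b' k - a' k ≤ η) → Sol h f (Q ∩ box a' b') := by
    intro S
    induction S using Finset.induction_on with
    | empty =>
      intro a' b' hsub hw
      rcases (Q ∩ box a' b').eq_empty_or_nonempty with he | ⟨x, hxQ, hx⟩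
      · rw [he]; exact ⟨0, fun x hx => hx.elim, fun x hx => hx.elim⟩
      · obtain ⟨i, hi⟩ := hL x ⟨hxQ, hsub hx⟩
        refine sol_mono ?_ (hUs i)
        refine Subset.trans ?_ hi
        rintro y ⟨_, hy⟩
        have := dist_le_ell (z := y) (y := x) hη0.le (fun k => by
          have h1 := hx k
          have h2 := hy k
          have h3 := hw k (by simp)
          rw [abs_le]; constructor <;> linarith)
        rw [Metric.mem_ball]; linarith
    | insert i S hi ih =>
      have inner : ∀ N : ℕ, ∀ a' b' : Fin n × Bool → ℝ, box a' b' ⊆ box a b →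
          (∀ k ∉ insert i S, b' k - a' k ≤ η) → b' i - a' i ≤ N * η → Sol h f (Q ∩ box a' b') := by
        intro N
        have base : ∀ a' b' : Fin n × Bool → ℝ, box a' b' ⊆ box a b →
          (∀ k ∉ insert i S, b' k - a' k ≤ η) → b' i - a' i ≤ η → Sol h f (Q ∩ box a' b') := by
          intro a' b' hs hw hwi
          apply ih a' b' hs
          intro k hk
          by_cases hki : k = i
          · rw [hki]; exact hwi
          · exact hw k (by simp [hki, hk])
        induction N with
        | zero =>
          intro a' b' hs hw hwi
          exact base a' b' hs hw (by simp at hwi; linarith)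
        | succ N ihN =>
          intro a' b' hs hw hwi
          by_cases hwi' : b' i - a' i ≤ η
          · exact base a' b' hs hw hwi'
          push Not at hwi'
          apply sol_glue hQ hh hd (i := i) (c := a' i + η)
          · have hsub : box a' b' ∩ {z | ell i z ≤ a' i + η} = box a' (Function.update b' i (a' i + η)) := by
              ext z
              constructor
              · rintro ⟨hz, hz'⟩ k
                by_cases hk : k = i
                · subst hk; rw [Function.update_self]; exact ⟨(hz k).1, hz'⟩
                · rw [Function.update_of_ne hk]; exact hz k
              · intro hz
                have hzi := (hz i).2
                rw [Function.update_self] at hzi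
                refine ⟨fun k => ?_, hzi⟩
                by_cases hk : k = i
                · subst hk; exact ⟨(hz k).1, by linarith⟩
                · have := hz k; rwa [Function.update_of_ne hk] at this
            rw [inter_assoc, hsub]
            apply base
            · rw [← hsub]; exact inter_subset_left.trans hs
            · intro k hk
              rw [Function.update_of_ne (by rintro rfl; simp at hk)]
              exact hw k hk
            · simp
          · have hsub : box a' b' ∩ {z | a' i + η ≤ ell i z} = box (Function.update a' i (a' i + η)) b' := by
              ext z
              constructor
              · rintro ⟨hz, hz'⟩ k
                by_cases hk : k = i
                · subst hk; rw [Function.update_self]; exact ⟨hz', (hz k).2⟩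
                · rw [Function.update_of_ne hk]; exact hz k
              · intro hz
                have hzi := (hz i).1
                rw [Function.update_self] at hzi
                refine ⟨fun k => ?_, hzi⟩
                by_cases hk : k = i
                · subst hk; exact ⟨by linarith, (hz k).2⟩
                · have := hz k; rwa [Function.update_of_ne hk] at this
            rw [inter_assoc, hsub]
            apply ihN
            · rw [← hsub]; exact inter_subset_left.trans hs
            · intro k hk
              rw [Function.update_of_ne (by rintro rfl; simp at hk)]
              exact hw k hk
            · rw [Function.update_self]; push_cast at hwi; linarith
      intro a' b' hs hw
      obtain ⟨N, hN⟩ := exists_nat_ge ((b' i - a' i) / η)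
      exact inner N a' b' hs hw ((div_le_iff₀ hη0).1 hN)
  exact claim Finset.univ a b Subset.rfl (by simp)

lemma poly_an {n : ℕ} (q : MvPolynomial (Fin n) ℂ) (x : Fin n → ℂ) :
    AnalyticAt ℂ (fun z => eval z q) x := by
  induction q using MvPolynomial.induction_on with
  | C a => simp only [eval_C]; exact analyticAt_const
  | add p q hp hq => simp only [map_add]; exact hp.fun_add hq
  | mul_X p i hp =>
    simp only [map_mul, eval_X]
    exact hp.fun_mul ((ContinuousLinearMap.proj (R := ℂ) (φ := fun _ : Fin n => ℂ) i).analyticAt x)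

lemma poly_cont {n : ℕ} (q : MvPolynomial (Fin n) ℂ) : Continuous (fun z => eval z q) :=
  continuous_iff_continuousAt.2 fun x => (poly_an q x).continuousAt

def PQ {n : ℕ} (M : ℝ) (L : List (MvPolynomial (Fin n) ℂ)) : Set (Fin n → ℂ) :=
  {z | ∀ q ∈ L, |(eval z q).re| ≤ M ∧ |(eval z q).im| ≤ M}

lemma PQ_closed {n : ℕ} (M : ℝ) (L : List (MvPolynomial (Fin n) ℂ)) : IsClosed (PQ M L) := by
  have : PQ M L = ⋂ q ∈ L, {z | |(eval z q).re| ≤ M} ∩ {z | |(eval z q).im| ≤ M} := by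
    ext z; simp [PQ]
  rw [this]
  refine isClosed_biInter fun q _ => IsClosed.inter ?_ ?_
  · exact isClosed_le (Complex.continuous_re.comp (poly_cont q)).abs continuous_const
  · exact isClosed_le (Complex.continuous_im.comp (poly_cont q)).abs continuous_const

def bp {n : ℕ} (M : ℝ) (a : Fin n × Bool → ℝ) : Fin (n + 1) × Bool → ℝ :=
  fun k => Fin.cases (motive := fun _ => ℝ) M (fun j => a (j, k.2)) k.1

def tl {n : ℕ} (y : Fin (n + 1) → ℂ) : Fin n → ℂ := fun j => y j.succ

def gam {n : ℕ} (q : MvPolynomial (Fin n) ℂ) (z : Fin n → ℂ) : Fin (n + 1) → ℂ :=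
  Fin.cons (eval z q) z

def up {n : ℕ} (p : MvPolynomial (Fin n) ℂ) : MvPolynomial (Fin (n + 1)) ℂ := rename Fin.succ p

lemma tl_gam {n : ℕ} (q : MvPolynomial (Fin n) ℂ) (z : Fin n → ℂ) : tl (gam q z) = z := by
  ext j; simp [tl, gam]

lemma gam_zero {n : ℕ} (q : MvPolynomial (Fin n) ℂ) (z : Fin n → ℂ) : gam q z 0 = eval z q := by
  simp [gam]

lemma eval_up {n : ℕ} (p : MvPolynomial (Fin n) ℂ) (y : Fin (n + 1) → ℂ) :
    eval y (up p) = eval (tl y) p := by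
  rw [up, eval_rename]; rfl

lemma tl_an {n : ℕ} (y : Fin (n + 1) → ℂ) : AnalyticAt ℂ (tl (n := n)) y := by
  apply AnalyticAt.pi
  intro j
  exact (ContinuousLinearMap.proj (R := ℂ) (φ := fun _ : Fin (n+1) => ℂ) j.succ).analyticAt y

lemma gam_an {n : ℕ} (q : MvPolynomial (Fin n) ℂ) (z : Fin n → ℂ) : AnalyticAt ℂ (gam q) z := by
  apply AnalyticAt.pi
  intro j
  refine Fin.cases ?_ (fun j => ?_) j
  · simp only [gam, Fin.cons_zero]; exact poly_an q z
  · simp only [gam, Fin.cons_succ]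
    exact (ContinuousLinearMap.proj (R := ℂ) (φ := fun _ : Fin n => ℂ) j).analyticAt z

lemma mem_box_bp {n : ℕ} {M : ℝ} {a b : Fin n × Bool → ℝ} {y : Fin (n + 1) → ℂ} :
    y ∈ box (bp (-M) a) (bp M b) ↔ tl y ∈ box a b ∧ |(y 0).re| ≤ M ∧ |(y 0).im| ≤ M := by
  constructor
  · intro h
    refine ⟨fun k => ?_, ?_, ?_⟩
    · exact h (k.1.succ, k.2)
    · exact abs_le.2 (h (0, true))
    · exact abs_le.2 (h (0, false))
  · rintro ⟨h1, h2, h3⟩ ⟨k, s⟩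
    refine Fin.cases ?_ (fun j => ?_) k
    · cases s
      · exact abs_le.1 h3
      · exact abs_le.1 h2
    · exact h1 (j, s)

lemma mem_PQ_up {n : ℕ} {M : ℝ} {L : List (MvPolynomial (Fin n) ℂ)} {y : Fin (n + 1) → ℂ} :
    y ∈ PQ M (L.map up) ↔ tl y ∈ PQ M L := by
  simp [PQ, eval_up]

lemma gam_mem {n : ℕ} {M : ℝ} {q : MvPolynomial (Fin n) ℂ} {L : List (MvPolynomial (Fin n) ℂ)}
    {a b : Fin n × Bool → ℝ} {z : Fin n → ℂ} (hz : z ∈ PQ M (q :: L) ∩ box a b) :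
    gam q z ∈ PQ M (L.map up) ∩ box (bp (-M) a) (bp M b) := by
  refine ⟨mem_PQ_up.2 ?_, mem_box_bp.2 ⟨?_, ?_⟩⟩
  · rw [tl_gam]; exact fun p hp => hz.1 p (List.mem_cons_of_mem _ hp)
  · rw [tl_gam]; exact hz.2
  · rw [gam_zero]; exact hz.1 q List.mem_cons_self

lemma dense_graph {n : ℕ} (q : MvPolynomial (Fin n) ℂ) :
    Dense {y : Fin (n + 1) → ℂ | y 0 - eval (tl y) q ≠ 0} := by
  intro y
  by_cases h : y 0 - eval (tl y) q = 0
  · have ht : Tendsto (fun k : ℕ => (Fin.cons (y 0 + 1 / ((k : ℂ) + 1)) (tl y) : Fin (n + 1) → ℂ)) atTop (𝓝 y) := by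
      rw [tendsto_pi_nhds]
      intro j
      refine Fin.cases ?_ (fun j => ?_) j
      · simp only [Fin.cons_zero]
        simpa using (tendsto_one_div_add_atTop_nhds_zero_nat (𝕜 := ℂ)).const_add (y 0)
      · simp only [Fin.cons_succ]; exact tendsto_const_nhds
    refine mem_closure_of_tendsto ht (Eventually.of_forall fun k => ?_)
    have e : tl (Fin.cons (y 0 + 1 / ((k : ℂ) + 1)) (tl y) : Fin (n + 1) → ℂ) = tl y := by
      ext j; simp [tl]
    simp only [mem_setOf_eq, e, Fin.cons_zero]
    have : y 0 + 1 / ((k : ℂ) + 1) - eval (tl y) q = 1 / ((k : ℂ) + 1) := by linear_combination h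
    rw [this]
    exact one_div_ne_zero (Nat.cast_add_one_ne_zero k)
  · exact subset_closure h

lemma oka_ext {n : ℕ} {M : ℝ} {q : MvPolynomial (Fin n) ℂ} {L : List (MvPolynomial (Fin n) ℂ)}
    (hS : Splits (PQ M (L.map up))) {a b : Fin n × Bool → ℝ} {f : (Fin n → ℂ) → ℂ}
    (hf : AnalyticOnNhd ℂ f (PQ M (q :: L) ∩ box a b)) :
    ∃ F : (Fin (n + 1) → ℂ) → ℂ, AnalyticOnNhd ℂ F (PQ M (L.map up) ∩ box (bp (-M) a) (bp M b)) ∧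
      ∀ x ∈ PQ M (q :: L) ∩ box a b, ∀ᶠ z in 𝓝 x, F (gam q z) = f z := by
  obtain ⟨F, hF, hg⟩ := step (PQ_closed M (L.map up)) hS (h := fun y => y 0 - eval (tl y) q)
    (f := fun y => f (tl y)) (a := bp (-M) a) (b := bp M b) (fun y => by
      refine AnalyticAt.fun_sub ?_ ?_
      · exact (ContinuousLinearMap.proj (R := ℂ) (φ := fun _ : Fin (n+1) => ℂ) 0).analyticAt y
      · exact AnalyticAt.comp_of_eq (f := tl) (poly_an q (tl y)) (tl_an y) rfl) (dense_graph q) (by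
      rintro y ⟨hy1, hy2⟩ h0
      have h0' : y 0 = eval (tl y) q := sub_eq_zero.1 h0
      rw [mem_PQ_up] at hy1
      rw [mem_box_bp, h0'] at hy2
      refine AnalyticAt.comp_of_eq (f := tl) (hf (tl y) ⟨?_, hy2.1⟩) (tl_an y) rfl
      intro p hp
      rcases List.mem_cons.1 hp with rfl | hp
      · exact hy2.2
      · exact hy1 p hp)
  refine ⟨F, hF, fun x hx => ?_⟩
  obtain ⟨g, -, e⟩ := hg (gam q x) (gam_mem hx) (by simp [gam_zero, tl_gam])
  filter_upwards [(gam_an q x).continuousAt.eventually e] with z hz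
  rw [hz]; simp [gam_zero, tl_gam]

lemma box_slice {n : ℕ} (a b : Fin n × Bool → ℝ) (i : Fin n × Bool) (c : ℝ) :
    box (Function.update a i (max (a i) c)) (Function.update b i (min (b i) c)) =
      box a b ∩ {z | ell i z = c} := by
  ext z
  constructor
  · intro hz
    have h1 := hz i
    simp only [Function.update_self, max_le_iff, le_min_iff] at h1
    refine ⟨fun k => ?_, le_antisymm h1.2.2 h1.1.2⟩
    by_cases hk : k = i
    · subst hk; exact ⟨h1.1.1, h1.2.1⟩
    · have := hz k; rwa [Function.update_of_ne hk, Function.update_of_ne hk] at this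
  · rintro ⟨hz, hc⟩ k
    by_cases hk : k = i
    · subst hk
      simp only [Function.update_self, max_le_iff, le_min_iff]
      exact ⟨⟨(hz k).1, ge_of_eq hc⟩, (hz k).2, le_of_eq hc⟩
    · rw [Function.update_of_ne hk, Function.update_of_ne hk]; exact hz k

lemma splits_PQ (M : ℝ) (m : ℕ) : ∀ (n : ℕ) (L : List (MvPolynomial (Fin n) ℂ)), L.length = m →
    Splits (PQ M L) := by
  induction m with
  | zero =>
    intro n L hL
    have : PQ M L = univ := by
      rw [List.length_eq_zero_iff] at hL
      subst hL; ext z; simp [PQ]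
    rw [this]; exact splits_univ n
  | succ m ih =>
    intro n L hL
    match L, hL with
    | q :: L, hL =>
    have hS := ih (n + 1) (L.map up) (by simpa using hL)
    intro a b i c H hH
    rw [inter_assoc, ← box_slice] at hH
    obtain ⟨F, hF, hFH⟩ := oka_ext hS hH
    have hsl : PQ M (L.map up) ∩ box (bp (-M) (Function.update a i (max (a i) c)))
        (bp M (Function.update b i (min (b i) c))) = PQ M (L.map up) ∩ box (bp (-M) a) (bp M b) ∩
        {z | ell (i.1.succ, i.2) z = c} := by
      ext y
      simp only [mem_inter_iff, mem_box_bp, box_slice]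
      have : y ∈ {z | ell (i.1.succ, i.2) z = c} ↔ tl y ∈ {z | ell i z = c} := Iff.rfl
      tauto
    rw [hsl] at hF
    obtain ⟨F1, F2, h1, h2, h3⟩ := hS _ _ _ _ F hF
    have hell : ∀ z : Fin n → ℂ, ell (i.1.succ, i.2) (gam q z) = ell i z := by
      intro z; simp [ell, gam]
    refine ⟨fun z => F1 (gam q z), fun z => F2 (gam q z), ?_, ?_, ?_⟩
    · intro z hz
      refine AnalyticAt.comp_of_eq (f := gam q) (h1 (gam q z) ⟨gam_mem hz.1, ?_⟩) (gam_an q z) rfl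
      exact (hell z).le.trans hz.2
    · intro z hz
      refine AnalyticAt.comp_of_eq (f := gam q) (h2 (gam q z) ⟨gam_mem hz.1, ?_⟩) (gam_an q z) rfl
      exact le_trans hz.2 (hell z).ge
    · intro x hx
      have hx' := hx
      rw [inter_assoc, ← box_slice] at hx'
      have := h3 (gam q x) ⟨gam_mem hx.1, (hell x).trans hx.2⟩
      filter_upwards [hFH x hx', (gam_an q x).continuousAt.eventually this] with y h1 h2
      rw [← h1, h2]

lemma diag_poly {n k : ℕ} (p : ContinuousMultilinearMap ℂ (fun _ : Fin k => Fin n → ℂ) ℂ) :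
    ∃ P : MvPolynomial (Fin n) ℂ, ∀ v, eval v P = p (fun _ => v) := by
  refine ⟨∑ r : Fin k → Fin n, C (p fun i => Pi.single (r i) 1) * ∏ i, X (r i), fun v => ?_⟩
  have hv : v = ∑ j, v j • (Pi.single j 1 : Fin n → ℂ) := by
    ext k; simp [Finset.sum_apply, Pi.single_apply]
  conv_rhs => rw [hv]
  rw [p.map_sum]
  simp only [map_sum, map_mul, eval_C, map_prod, eval_X]
  refine Finset.sum_congr rfl fun r _ => ?_
  rw [p.map_smul_univ]
  simp [mul_comm]

lemma slice_bound {φ : ℂ → ℂ} {R C : ℝ} (hR : 1 < R) (hd : DifferentiableOn ℂ φ (Metric.closedBall 0 R))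
    (hC : ∀ t ∈ Metric.closedBall (0:ℂ) R, ‖φ t‖ ≤ C) {p : FormalMultilinearSeries ℂ ℂ ℂ}
    (hp : HasFPowerSeriesAt φ p 0) (N : ℕ) :
    ‖(∑ k ∈ Finset.range N, p k (fun _ => 1)) - φ 1‖ ≤ C * R⁻¹ ^ N / (1 - R⁻¹) := by
  have hR0 : 0 < R := by linarith
  lift R to NNReal using hR0.le
  have h1 := hd.hasFPowerSeriesOnBall (by exact_mod_cast hR0)
  have h2 : p = cauchyPowerSeries φ 0 R := hp.eq_formalMultilinearSeries h1.hasFPowerSeriesAt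
  have h3 := h1.hasSum (y := 1) (by
    simp only [Metric.mem_eball, edist_zero_right]
    rw [enorm_eq_nnnorm]; simp; exact_mod_cast hR)
  rw [zero_add, ← h2] at h3
  refine norm_sub_le_of_geometric_bound_of_hasSum (inv_lt_one_of_one_lt₀ hR) (fun k => ?_) h3 N
  have h4 : ‖p k (fun _ => 1)‖ ≤ ‖p k‖ := by
    have := (p k).le_opNorm (fun _ => 1)
    simpa using this
  refine h4.trans ?_
  rw [h2]
  refine (norm_cauchyPowerSeries_le φ 0 R k).trans ?_
  rw [abs_of_pos hR0]
  gcongr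
  have h5 : ‖∫ θ : ℝ in (0:ℝ)..2 * Real.pi, ‖φ (circleMap 0 R θ)‖‖ ≤ C * |2 * Real.pi - 0| := by
    apply intervalIntegral.norm_integral_le_of_norm_le_const
    intro θ _
    rw [norm_norm]
    exact hC _ (circleMap_mem_closedBall _ hR0.le _)
  have hpi : 0 < 2 * Real.pi := by positivity
  rw [sub_zero, abs_of_pos hpi] at h5
  have h6 := (le_abs_self _).trans h5
  rw [inv_mul_le_iff₀ hpi]
  linarith

lemma runge_ball {n : ℕ} {F : (Fin n → ℂ) → ℂ} {M : ℝ} (hM : 0 < M)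
    (hF : AnalyticOnNhd ℂ F (Metric.closedBall 0 M)) {ε : ℝ} (hε : 0 < ε) :
    ∃ P : MvPolynomial (Fin n) ℂ, ∀ z ∈ Metric.closedBall (0 : Fin n → ℂ) M, ‖F z - eval z P‖ < ε := by
  obtain ⟨δ, hδ, hδF⟩ := (isCompact_closedBall (0 : Fin n → ℂ) M).exists_cthickening_subset_open
    (isOpen_analyticAt ℂ F) hF
  have hbig : ∀ z ∈ Metric.closedBall (0 : Fin n → ℂ) (M + δ), AnalyticAt ℂ F z := by
    intro z hz
    apply hδF
    rw [cthickening_closedBall hδ.le hM.le]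
    rwa [add_comm]
  have hcont : ContinuousOn F (Metric.closedBall 0 (M + δ)) := fun z hz => (hbig z hz).continuousAt.continuousWithinAt
  obtain ⟨C, hC⟩ := (isCompact_closedBall (0 : Fin n → ℂ) (M + δ)).exists_bound_of_continuousOn hcont
  set R := (M + δ) / M with hRdef
  have hR : 1 < R := by rw [hRdef, lt_div_iff₀ hM]; linarith
  obtain ⟨p, hp⟩ := hbig 0 (Metric.mem_closedBall_self (by linarith))
  choose P hP using fun k => diag_poly (p k)
  have hlim : Tendsto (fun N : ℕ => C * R⁻¹ ^ N / (1 - R⁻¹)) atTop (𝓝 0) := by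
    have := ((tendsto_pow_atTop_nhds_zero_of_lt_one (by positivity : 0 ≤ R⁻¹) (inv_lt_one_of_one_lt₀ hR)).const_mul C).div_const (1 - R⁻¹)
    simpa using this
  obtain ⟨N, hN⟩ := (hlim.eventually (gt_mem_nhds hε)).exists
  refine ⟨∑ k ∈ Finset.range N, P k, fun z hz => ?_⟩
  let u := ContinuousLinearMap.toSpanSingleton ℂ z
  have hu : ∀ t ∈ Metric.closedBall (0:ℂ) R, u t ∈ Metric.closedBall (0 : Fin n → ℂ) (M + δ) := by
    intro t ht
    rw [mem_closedBall_zero_iff] at *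
    simp only [u, ContinuousLinearMap.toSpanSingleton_apply, norm_smul]
    calc ‖t‖ * ‖z‖ ≤ R * M := by gcongr
      _ = M + δ := by rw [hRdef]; field_simp
  have hp' : HasFPowerSeriesAt F p (u 0) := by simpa using hp
  have := slice_bound (φ := F ∘ u) hR (C := C) (fun t ht =>
    ((hbig _ (hu t ht)).differentiableAt.comp t u.differentiableAt).differentiableWithinAt)
    (fun t ht => hC _ (hu t ht)) hp'.compContinuousLinearMap N
  rw [norm_sub_rev]
  refine lt_of_le_of_lt ?_ hN
  have e1 : eval z (∑ k ∈ Finset.range N, P k) =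
      ∑ k ∈ Finset.range N, (p.compContinuousLinearMap u k) fun _ => 1 := by
    rw [map_sum]
    refine Finset.sum_congr rfl fun k _ => ?_
    rw [hP]
    simp [FormalMultilinearSeries.compContinuousLinearMap, u, Function.comp_def]
  have e2 : (F ∘ u) 1 = F z := by simp [u]
  rw [e1, ← e2]
  exact this

lemma eval_subst {n m : ℕ} (φ : Fin m → MvPolynomial (Fin n) ℂ) (P : MvPolynomial (Fin m) ℂ) (z : Fin n → ℂ) :
    eval z (bind₁ φ P) = eval (fun i => eval z (φ i)) P := by
  induction P using MvPolynomial.induction_on with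
  | C a => simp
  | add p q hp hq => simp [hp, hq]
  | mul_X p i hp => simp [hp]

lemma oka_weil {M : ℝ} (hM : 0 < M) (m : ℕ) : ∀ (n : ℕ) (L : List (MvPolynomial (Fin n) ℂ)), L.length = m →
    ∀ f : (Fin n → ℂ) → ℂ, AnalyticOnNhd ℂ f (PQ M L ∩ box (fun _ => -M) (fun _ => M)) →
    ∀ ε > 0, ∃ p : MvPolynomial (Fin n) ℂ, ∀ z : Fin n → ℂ, (∀ i, ‖z i‖ ≤ M) → (∀ q ∈ L, ‖eval z q‖ ≤ M) →
      ‖f z - eval z p‖ < ε := by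
  have hbox : ∀ (n : ℕ) (z : Fin n → ℂ), (∀ i, ‖z i‖ ≤ M) → z ∈ box (fun _ => -M) (fun _ => M) := by
    rintro n z hz ⟨k, s⟩
    cases s
    · simpa [ell] using abs_le.1 ((Complex.abs_im_le_norm _).trans (hz k))
    · simpa [ell] using abs_le.1 ((Complex.abs_re_le_norm _).trans (hz k))
  induction m with
  | zero =>
    intro n L hL f hf ε hε
    rw [List.length_eq_zero_iff] at hL
    subst hL
    obtain ⟨P, hP⟩ := runge_ball (F := f) hM (fun z hz => hf z ⟨by simp [PQ], hbox n z fun i => by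
      rw [mem_closedBall_zero_iff] at hz
      exact (norm_le_pi_norm z i).trans hz⟩) hε
    exact ⟨P, fun z hz _ => hP z (by rw [mem_closedBall_zero_iff]; exact (pi_norm_le_iff_of_nonneg hM.le).2 hz)⟩
  | succ m ih =>
    intro n L hL f hf ε hε
    match L, hL with
    | q :: L, hL =>
    obtain ⟨F, hF, hFf⟩ := oka_ext (splits_PQ M m (n + 1) (L.map up) (by simpa using hL)) hf
    have hb : ∀ c : ℝ, bp c (fun _ : Fin n × Bool => c) = fun _ => c := by
      intro c; ext ⟨k, s⟩; refine Fin.cases ?_ (fun j => ?_) k <;> rfl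
    rw [hb, hb] at hF
    obtain ⟨P, hP⟩ := ih (n + 1) (L.map up) (by simpa using hL) F hF ε hε
    refine ⟨bind₁ (Fin.cons q (fun j => X j)) P, fun z hz hzL => ?_⟩
    have hzq := hzL q List.mem_cons_self
    have h1 := hP (gam q z) (fun i => by
      refine Fin.cases ?_ (fun j => ?_) i
      · rw [gam_zero]; exact hzq
      · simpa [gam] using hz j) (fun p hp => by
      obtain ⟨p', hp', rfl⟩ := List.mem_map.1 hp
      rw [eval_up, tl_gam]
      exact hzL p' (List.mem_cons_of_mem _ hp'))
    have h2 := (hFf z ⟨fun p hp => ⟨(Complex.abs_re_le_norm _).trans (hzL p hp),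
      (Complex.abs_im_le_norm _).trans (hzL p hp)⟩, hbox n z hz⟩).self_of_nhds
    rw [h2] at h1
    have h3 : (fun i => eval z ((Fin.cons q (fun j => X j) : Fin (n + 1) → MvPolynomial (Fin n) ℂ) i)) = gam q z := by
      ext i; refine Fin.cases ?_ (fun j => ?_) i <;> simp [gam]
    rw [eval_subst, h3]
    exact h1

def hull {n : ℕ} (K : Set (Fin n → ℂ)) : Set (Fin n → ℂ) :=
  {z | ∀ (p : MvPolynomial (Fin n) ℂ) (C : ℝ), (∀ w ∈ K, ‖eval w p‖ ≤ C) → ‖eval z p‖ ≤ C}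

lemma hull_closed {n : ℕ} (K : Set (Fin n → ℂ)) : IsClosed (hull K) := by
  have : hull K = ⋂ (p : MvPolynomial (Fin n) ℂ) (C : ℝ) (_ : ∀ w ∈ K, ‖eval w p‖ ≤ C),
      {z | ‖eval z p‖ ≤ C} := by
    ext z; simp [hull]
  rw [this]
  exact isClosed_iInter fun p => isClosed_iInter fun C => isClosed_iInter fun _ =>
    isClosed_le (poly_cont p).norm continuous_const

lemma subset_hull {n : ℕ} (K : Set (Fin n → ℂ)) : K ⊆ hull K := fun z hz _ _ h => h z hz

lemma hull_coord {n : ℕ} {K : Set (Fin n → ℂ)} {M : ℝ} (hK : ∀ z ∈ K, ∀ i, ‖z i‖ ≤ M) :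
    ∀ z ∈ hull K, ∀ i, ‖z i‖ ≤ M := by
  intro z hz i
  have := hz (X i) M (fun w hw => by simpa using hK w hw i)
  simpa using this

lemma hull_sep {n : ℕ} {K : Set (Fin n → ℂ)} {x : Fin n → ℂ} (hx : x ∉ hull K) {ε : ℝ} (hε : 0 < ε)
    (N : ℝ) : ∃ q : MvPolynomial (Fin n) ℂ, (∀ w ∈ K, ‖eval w q‖ < ε) ∧ N < ‖eval x q‖ := by
  rcases K.eq_empty_or_nonempty with rfl | ⟨w0, hw0⟩
  · refine ⟨C ((|N| + 1 : ℝ) : ℂ), by simp, ?_⟩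
    rw [eval_C, Complex.norm_real, Real.norm_of_nonneg (by positivity)]
    linarith [le_abs_self N]
  have : ∃ (p : MvPolynomial (Fin n) ℂ) (C : ℝ), (∀ w ∈ K, ‖eval w p‖ ≤ C) ∧ C < ‖eval x p‖ := by
    by_contra hcon
    push Not at hcon
    exact hx hcon
  obtain ⟨p, c, h1, h2⟩ := this
  have hc : 0 ≤ c := (norm_nonneg _).trans (h1 w0 hw0)
  set D := (c + ‖eval x p‖) / 2 with hD
  have hD0 : 0 < D := by linarith
  have hR : 1 < ‖eval x p‖ / D := by rw [lt_div_iff₀ hD0]; linarith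
  obtain ⟨k, hk⟩ := pow_unbounded_of_one_lt (N / (ε / 2)) hR
  refine ⟨C ((ε / 2 : ℝ) : ℂ) * (C ((D : ℂ)⁻¹) * p) ^ k, fun w hw => ?_, ?_⟩
  · simp only [map_mul, map_pow, eval_C, norm_mul, norm_pow, Complex.norm_real, norm_inv]
    rw [Real.norm_of_nonneg (by positivity), Real.norm_of_nonneg hD0.le]
    have h3 : D⁻¹ * ‖eval w p‖ ≤ 1 := by
      rw [inv_mul_le_iff₀ hD0]; linarith [h1 w hw]
    have h4 := pow_le_one₀ (n := k) (by positivity) h3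
    nlinarith
  · simp only [map_mul, map_pow, eval_C, norm_mul, norm_pow, Complex.norm_real, norm_inv]
    rw [Real.norm_of_nonneg (by positivity : (0:ℝ) ≤ ε / 2), Real.norm_of_nonneg hD0.le]
    rw [div_lt_iff₀ (by positivity)] at hk
    rw [mul_comm, inv_mul_eq_div]; exact hk

lemma hull_shift {n : ℕ} {K : Set (Fin n → ℂ)} {z v : Fin n → ℂ} (hz : z ∈ hull K) {r : ℝ}
    (hv : ‖v‖ ≤ r) (p : MvPolynomial (Fin n) ℂ) (c : ℝ)
    (h : ∀ w ∈ Metric.cthickening r K, ‖eval w p‖ ≤ c) : ‖eval (z + v) p‖ ≤ c := by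
  have key : ∀ x, eval x (bind₁ (fun i => X i + C (v i)) p) = eval (x + v) p := by
    intro x
    rw [eval_subst]
    congr 2; ext i; simp
  rw [← key]
  apply hz
  intro w hw
  rw [key]
  apply h
  exact Metric.mem_cthickening_of_dist_le _ w _ _ hw (by simpa using hv)

lemma lim_analytic {n : ℕ} {g : ℕ → MvPolynomial (Fin n) ℂ} {F : (Fin n → ℂ) → ℂ} {S : Set (Fin n → ℂ)}
    (hS : IsOpen S) (h : TendstoUniformlyOn (fun j y => eval y (g j)) F atTop S) : AnalyticOnNhd ℂ F S := by
  apply osgood n hS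
  · exact h.continuousOn (Frequently.of_forall fun j => (poly_cont (g j)).continuousOn)
  · intro x hx i
    have hc : Continuous (fun s : ℂ => Function.update x i s) := by fun_prop
    have ho : IsOpen ((fun s : ℂ => Function.update x i s) ⁻¹' S) := hS.preimage hc
    have h1 : TendstoUniformlyOn (fun j s => eval (Function.update x i s) (g j))
        (fun s => F (Function.update x i s)) atTop ((fun s : ℂ => Function.update x i s) ⁻¹' S) :=
      h.comp (fun s : ℂ => Function.update x i s)
    have h2 := h1.tendstoLocallyUniformlyOn.differentiableOn (Eventually.of_forall fun j s hs => by
      exact (DifferentiableAt.comp s (g := fun z => eval z (g j)) (f := fun ζ => Function.update x i ζ)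
        (poly_an (g j) _).differentiableAt (hasDerivAt_update x i s).differentiableAt).differentiableWithinAt) ho
    exact h2.differentiableAt (ho.mem_nhds (by simpa using hx))

lemma cartan_thullen {n : ℕ} {Ω K : Set (Fin n → ℂ)} (hΩ : IsRungeDomain Ω) (hK : IsCompact K) {r : ℝ} (hr : 0 < r)
    (hrK : Metric.cthickening r K ⊆ Ω) {z : Fin n → ℂ} (hz : z ∈ hull K) (hzΩ : z ∈ Ω) :
    Metric.ball z r ⊆ Ω := by
  by_contra hcon
  obtain ⟨⟨hΩo, hdom⟩, hrunge⟩ := hΩ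
  obtain ⟨δ0, hδ0, hδΩ⟩ := Metric.isOpen_iff.1 hΩo z hzΩ
  set δ := min (δ0 / 2) r with hδd
  have hδ : 0 < δ := lt_min (by linarith) hr
  have hcb : Metric.closedBall z δ ⊆ Ω :=
    (Metric.closedBall_subset_ball (lt_of_le_of_lt (min_le_left _ _) (by linarith))).trans hδΩ
  apply hdom
  refine ⟨Metric.ball z δ, Metric.ball z r, Metric.isOpen_ball, Metric.isOpen_ball,
    ⟨z, Metric.mem_ball_self hδ⟩, subset_inter (Metric.ball_subset_closedBall.trans hcb)
    (Metric.ball_subset_ball (min_le_right _ _)), ?_, hcon, ?_⟩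
  · exact ⟨⟨z, Metric.mem_ball_self hr⟩, (convex_ball z r).isPreconnected⟩
  intro f hf
  have hK1 : IsCompact (Metric.cthickening r K ∪ Metric.closedBall z δ) :=
    (hK.cthickening).union (isCompact_closedBall z δ)
  choose g hg using fun j : ℕ => hrunge f hf _ hK1 (union_subset hrK hcb) ((1 / 2 : ℝ) ^ j) (by positivity)
  have hdiff : ∀ N m k : ℕ, N ≤ m → N ≤ k → ∀ y ∈ Metric.ball z r,
      ‖eval y (g m) - eval y (g k)‖ ≤ 2 * (1 / 2 : ℝ) ^ N := by
    intro N m k hm hk y hy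
    have := hull_shift hz (v := y - z) (r := r) (by rw [← dist_eq_norm]; exact (Metric.mem_ball.1 hy).le)
      (g m - g k) (2 * (1 / 2 : ℝ) ^ N) (fun w hw => by
        have h1 := hg m w (Or.inl hw)
        have h2 := hg k w (Or.inl hw)
        have h3 : (1 / 2 : ℝ) ^ m ≤ (1 / 2 : ℝ) ^ N := pow_le_pow_of_le_one (by norm_num) (by norm_num) hm
        have h4 : (1 / 2 : ℝ) ^ k ≤ (1 / 2 : ℝ) ^ N := pow_le_pow_of_le_one (by norm_num) (by norm_num) hk
        rw [map_sub, show eval w (g m) - eval w (g k) = (f w - eval w (g k)) - (f w - eval w (g m)) by ring]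
        refine (norm_sub_le _ _).trans ?_
        linarith)
    rw [add_sub_cancel, map_sub] at this
    exact this
  have hpow : Tendsto (fun N : ℕ => 2 * (1 / 2 : ℝ) ^ N) atTop (𝓝 0) := by
    simpa using (tendsto_pow_atTop_nhds_zero_of_lt_one (by norm_num : (0:ℝ) ≤ 1 / 2) (by norm_num)).const_mul 2
  have hU : UniformCauchySeqOn (fun j y => eval y (g j)) atTop (Metric.ball z r) := by
    rw [Metric.uniformCauchySeqOn_iff]
    intro ε hε
    obtain ⟨N, hN⟩ := (hpow.eventually (gt_mem_nhds hε)).exists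
    exact ⟨N, fun m hm k hk y hy => by
      rw [dist_eq_norm]; exact (hdiff N m k hm hk y hy).trans_lt hN⟩
  have hlim : ∀ y ∈ Metric.ball z r, ∃ l, Tendsto (fun j => eval y (g j)) atTop (𝓝 l) := fun y hy =>
    cauchySeq_tendsto_of_complete (hU.cauchySeq hy)
  choose! F hF using hlim
  refine ⟨F, lim_analytic Metric.isOpen_ball (hU.tendstoUniformlyOn_of_tendsto hF), ?_⟩
  intro y hy
  refine tendsto_nhds_unique ?_ (hF y (Metric.ball_subset_ball (min_le_right _ _) hy))
  rw [tendsto_iff_norm_sub_tendsto_zero]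
  refine squeeze_zero (fun _ => norm_nonneg _) (fun j => ?_)
    (tendsto_pow_atTop_nhds_zero_of_lt_one (by norm_num : (0:ℝ) ≤ 1 / 2) (by norm_num))
  rw [norm_sub_rev]
  exact (hg j y (Or.inr (Metric.ball_subset_closedBall hy))).le

lemma hull_subset {n : ℕ} {Ω K : Set (Fin n → ℂ)} (hΩ : IsRungeDomain Ω) (hK : IsCompact K) (hKΩ : K ⊆ Ω) :
    hull K ⊆ Ω := by
  have hΩo := hΩ.1.1
  obtain ⟨r, hr, hrK⟩ := hK.exists_cthickening_subset_open hΩo hKΩ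
  obtain ⟨M0, hM0⟩ := hK.isBounded.exists_norm_le
  set M := max M0 1 with hMd
  have hM : 0 < M := lt_of_lt_of_le one_pos (le_max_right _ _)
  have hKM : ∀ z ∈ K, ∀ i, ‖z i‖ ≤ M := fun z hz i =>
    (norm_le_pi_norm z i).trans ((hM0 z hz).trans (le_max_left _ _))
  have hHM := hull_coord hKM
  have hHc : IsCompact (hull K) := by
    refine (isCompact_closedBall (0 : Fin n → ℂ) M).of_isClosed_subset (hull_closed K) fun z hz => ?_
    rw [mem_closedBall_zero_iff]; exact (pi_norm_le_iff_of_nonneg hM.le).2 (hHM z hz)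
  have hA : IsClosed (hull K ∩ Ω) := by
    refine isClosed_of_closure_subset fun y hy => ?_
    refine ⟨(hull_closed K).closure_subset_iff.2 inter_subset_left hy, ?_⟩
    obtain ⟨z, hz, hd⟩ := Metric.mem_closure_iff.1 hy r hr
    exact cartan_thullen hΩ hK hr hrK hz.1 hz.2 hd
  have hAc : IsCompact (hull K ∩ Ω) := hHc.of_isClosed_subset hA inter_subset_left
  have hBc : IsCompact (hull K \ Ω) := hHc.diff hΩo
  obtain ⟨UA, UB, hUA, hUB, hAU, hBU, hdis⟩ := SeparatedNhds.of_isCompact_isCompact hAc hBc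
    (disjoint_left.2 fun x hx hx' => hx'.2 hx.2)
  intro b hb
  by_contra hbΩ
  have hTc : IsCompact (box (fun _ : Fin n × Bool => -M) (fun _ => M) \ (UA ∪ UB)) :=
    (box_compact _ _).diff (hUA.union hUB)
  have hsep : ∀ x ∈ box (fun _ : Fin n × Bool => -M) (fun _ => M) \ (UA ∪ UB),
      ∃ q : MvPolynomial (Fin n) ℂ, (∀ w ∈ K, ‖eval w q‖ < M) ∧ 2 * M < ‖eval x q‖ := by
    intro x hx
    refine hull_sep (fun hxh => hx.2 ?_) hM _
    by_cases hxΩ : x ∈ Ω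
    · exact Or.inl (hAU ⟨hxh, hxΩ⟩)
    · exact Or.inr (hBU ⟨hxh, hxΩ⟩)
  choose! q hq1 hq2 using hsep
  obtain ⟨t, htT, ht⟩ := hTc.elim_nhds_subcover (fun x => {y | 2 * M < ‖eval y (q x)‖})
    (fun x hx => (isOpen_lt continuous_const (poly_cont (q x)).norm).mem_nhds (hq2 x hx))
  set L := t.toList.map q with hL
  have hLK : ∀ p ∈ L, ∀ w ∈ K, ‖eval w p‖ ≤ M := by
    intro p hp w hw
    obtain ⟨x, hx, rfl⟩ := List.mem_map.1 hp
    exact (hq1 x (htT x (Finset.mem_toList.1 hx)) w hw).le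
  have hcov : PQ M L ∩ box (fun _ => -M) (fun _ => M) ⊆ UA ∪ UB := by
    rintro y ⟨hy, hyb⟩
    by_contra hyU
    obtain ⟨x, hx, hxy⟩ := mem_iUnion₂.1 (ht ⟨hyb, hyU⟩)
    have h1 := hy (q x) (List.mem_map.2 ⟨x, Finset.mem_toList.2 hx, rfl⟩)
    have h2 := Complex.norm_le_abs_re_add_abs_im (eval y (q x))
    have h3 : 2 * M < ‖eval y (q x)‖ := hxy
    linarith [h1.1, h1.2]
  classical
  obtain ⟨p, hp⟩ := oka_weil hM L.length n L rfl (fun y => if y ∈ UB then 1 else 0) (by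
    intro x hx
    rcases hcov hx with hx | hx
    · refine AnalyticAt.congr (f := fun _ => 0) analyticAt_const ?_
      filter_upwards [hUA.mem_nhds hx] with y hy
      rw [if_neg (disjoint_left.1 hdis hy)]
    · refine AnalyticAt.congr (f := fun _ => 1) analyticAt_const ?_
      filter_upwards [hUB.mem_nhds hx] with y hy
      rw [if_pos hy]) (1 / 3) (by norm_num)
  have h1 : ‖eval b p‖ ≤ 1 / 3 := by
    apply hb
    intro w hw
    have := hp w (hKM w hw) (fun p hp => hLK p hp w hw)
    rw [if_neg (disjoint_left.1 hdis (hAU ⟨subset_hull K hw, hKΩ hw⟩)), zero_sub, norm_neg] at this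
    exact this.le
  have h2 := hp b (hHM b hb) (fun p hp => hb p M (hLK p hp))
  rw [if_pos (hBU ⟨hb, hbΩ⟩)] at h2
  have h3 : ‖(1 : ℂ)‖ ≤ ‖1 - eval b p‖ + ‖eval b p‖ := by
    simpa using norm_add_le (1 - eval b p) (eval b p)
  rw [norm_one] at h3
  linarith

end

/-- Lemma 2.3. If `Ω ⊆ ℂ^n` is a Runge domain, then every open
`Ω₀ ⊂⊂ Ω` is relatively compact in the interior of some compact polynomial polyhedron
`P ⊆ Ω`. -/
theorem polyhedron_exhaustion (n : ℕ) (Ω : Set (CE n)) (hΩ : IsRungeDomain Ω)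
    (Ω₀ : Set (CE n)) (hΩ₀o : IsOpen Ω₀) (hΩ₀c : IsCompact (closure Ω₀))
    (hΩ₀Ω : closure Ω₀ ⊆ Ω) :
    ∃ P : Set (CE n), IsPolyPolyhedron P ∧ IsCompact P ∧ P ⊆ Ω ∧
      closure Ω₀ ⊆ interior P := by
  classical
  set K := closure Ω₀ with hKd
  have hH := hull_subset hΩ hΩ₀c hΩ₀Ω
  obtain ⟨M0, hM0⟩ := hΩ₀c.isBounded.exists_norm_le
  set M := max M0 0 + 1 with hMd
  have hM : 0 < M := by positivity
  have hKM : ∀ z ∈ K, ∀ i, ‖z i‖ < M := fun z hz i =>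
    lt_of_le_of_lt ((norm_le_pi_norm z i).trans ((hM0 z hz).trans (le_max_left _ 0))) (by linarith)
  have hTc : IsCompact (Metric.closedBall (0 : Fin n → ℂ) M \ Ω) := (isCompact_closedBall _ _).diff hΩ.1.1
  have hsep : ∀ x ∈ Metric.closedBall (0 : Fin n → ℂ) M \ Ω,
      ∃ q : MvPolynomial (Fin n) ℂ, (∀ w ∈ K, ‖eval w q‖ < 1) ∧ 1 < ‖eval x q‖ := fun x hx =>
    hull_sep (fun hxh => hx.2 (hH hxh)) one_pos _
  choose! q hq1 hq2 using hsep
  obtain ⟨t, htT, ht⟩ := hTc.elim_nhds_subcover (fun x => {y | 1 < ‖eval y (q x)‖})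
    (fun x hx => (isOpen_lt continuous_const (poly_cont (q x)).norm).mem_nhds (hq2 x hx))
  let s : Finset (MvPolynomial (Fin n) ℂ) :=
    Finset.univ.image (fun i : Fin n => C ((M : ℂ)⁻¹) * X i) ∪ t.image q
  have hPM : {z : CE n | ∀ p ∈ s, ‖eval z p‖ ≤ 1} ⊆ Metric.closedBall (0 : Fin n → ℂ) M := by
    intro z hz
    rw [mem_closedBall_zero_iff]
    refine (pi_norm_le_iff_of_nonneg hM.le).2 fun i => ?_
    have := hz (C ((M : ℂ)⁻¹) * X i) (Finset.mem_union_left _ (Finset.mem_image_of_mem _ (Finset.mem_univ i)))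
    simp only [map_mul, eval_C, eval_X, norm_mul, norm_inv, Complex.norm_real] at this
    rwa [Real.norm_of_nonneg hM.le, inv_mul_le_iff₀ hM, mul_one] at this
  refine ⟨{z | ∀ p ∈ s, ‖eval z p‖ ≤ 1}, ⟨s, fun _ => 1, rfl⟩, ?_, ?_, ?_⟩
  · refine (isCompact_closedBall (0 : Fin n → ℂ) M).of_isClosed_subset ?_ hPM
    have : {z : CE n | ∀ p ∈ s, ‖eval z p‖ ≤ 1} = ⋂ p ∈ s, {z | ‖eval z p‖ ≤ 1} := by
      ext z; simp
    rw [this]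
    exact isClosed_biInter fun p _ => isClosed_le (poly_cont p).norm continuous_const
  · intro z hz
    by_contra hzΩ
    obtain ⟨x, hx, hxz⟩ := mem_iUnion₂.1 (ht ⟨hPM hz, hzΩ⟩)
    exact absurd (hz (q x) (Finset.mem_union_right _ (Finset.mem_image_of_mem _ hx))) (not_le.2 hxz)
  · have ho : IsOpen (⋂ p ∈ s, {z : CE n | ‖eval z p‖ < 1}) :=
      isOpen_biInter_finset fun p _ => isOpen_lt (poly_cont p).norm continuous_const
    refine Subset.trans ?_ (interior_maximal (t := ⋂ p ∈ s, {z : CE n | ‖eval z p‖ < 1}) ?_ ho)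
    · intro z hz
      refine mem_iInter₂.2 fun p hp => ?_
      rcases Finset.mem_union.1 hp with hp | hp
      · obtain ⟨i, -, rfl⟩ := Finset.mem_image.1 hp
        show ‖_‖ < 1
        simp only [map_mul, eval_C, eval_X, norm_mul, norm_inv, Complex.norm_real]
        rw [Real.norm_of_nonneg hM.le, inv_mul_lt_iff₀ hM, mul_one]
        exact hKM z hz i
      · obtain ⟨x, hx, rfl⟩ := Finset.mem_image.1 hp
        exact hq1 x (htT x hx) z hz
    · intro z hz p hp
      exact le_of_lt (mem_iInter₂.1 hz p hp)
end

section
/- Let P be any polynomial polyhedron in ℂ^n. Then the interior of P is a Runge domain in ℂ^n. -/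
open Set Filter Topology MvPolynomial

theorem deriv_prod_aux {R ι : Type*} [CommRing R] [DecidableEq ι] (D : Derivation ℤ R R) (s : Finset ι)
    (f : ι → R) : D (∏ i ∈ s, f i) = ∑ i ∈ s, ∏ j ∈ s, (if j = i then D (f j) else f j) := by
  induction s using Finset.induction_on with
  | empty => simp
  | insert a s ha ih =>
    rw [Finset.prod_insert ha, D.leibniz, ih, Finset.sum_insert ha, Finset.prod_insert ha]
    simp only [if_true, smul_eq_mul]
    rw [add_comm]
    congr 1
    · rw [mul_comm]
      congr 1
      exact Finset.prod_congr rfl fun j hj => by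
        rw [if_neg]; rintro rfl; exact ha hj
    · rw [Finset.mul_sum]
      refine Finset.sum_congr rfl fun i hi => ?_
      rw [Finset.prod_insert ha, if_neg]
      rintro rfl; exact ha hi

theorem deriv_det {R m : Type*} [CommRing R] [Fintype m] [DecidableEq m] (D : Derivation ℤ R R)
    (M : Matrix m m R) :
    D M.det = ∑ i, (M.updateRow i (fun j => D (M i j))).det := by
  simp only [← Matrix.det_transpose M]
  have h : ∀ i, (M.updateRow i (fun j => D (M i j))).det
      = ∑ σ : Equiv.Perm m, (Equiv.Perm.sign σ : ℤ) •
        ∏ j, (if j = i then D (M j (σ j)) else M j (σ j)) := by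
    intro i
    rw [← Matrix.det_transpose, Matrix.det_apply]
    refine Finset.sum_congr rfl fun σ _ => ?_
    rw [Units.smul_def]
    congr 1
    refine Finset.prod_congr rfl fun j _ => ?_
    rw [Matrix.transpose_apply, Matrix.updateRow_apply]
    split_ifs with h
    · rw [h]
    · rfl
  simp only [h]
  rw [Finset.sum_comm, Matrix.det_apply, map_sum]
  refine Finset.sum_congr rfl fun σ _ => ?_
  rw [Units.smul_def, map_zsmul, deriv_prod_aux, Finset.smul_sum]
  rfl

/-- The Piola identity for commuting derivations. -/
theorem piola {R : Type*} [CommRing R] [IsAddTorsionFree R] {n : ℕ} (D : Fin n → Derivation ℤ R R)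
    (hD : ∀ k l x, D k (D l x) = D l (D k x)) (s : Fin n → R) (a : Fin n) :
    ∑ k, D k ((Matrix.of fun i k => D k (s i)).adjugate k a) = 0 := by
  set J : Matrix (Fin n) (Fin n) R := Matrix.of fun i k => D k (s i) with hJ
  have h1 : ∀ k, D k (J.adjugate k a) = ∑ i, if i = a then 0 else
      ∑ l, D k (D l (s i)) * ((J.updateRow a (Pi.single k 1)).updateRow i (Pi.single l 1)).det := by
    intro k
    rw [Matrix.adjugate_apply, deriv_det]
    refine Finset.sum_congr rfl fun i _ => ?_
    split_ifs with h
    · subst h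
      apply Matrix.det_eq_zero_of_row_eq_zero i
      intro j
      rw [Matrix.updateRow_self, Matrix.updateRow_self]
      by_cases hj : j = k
      · subst hj; simp
      · simp [hj]
    · rw [Matrix.updateRow_ne h]
      have : (fun j => D k (J i j)) = ∑ l, D k (D l (s i)) • (Pi.single l (1 : R) : Fin n → R) := by
        funext j
        simp [hJ, Finset.sum_apply, Pi.single_apply]
      rw [this]
      have := (Matrix.detRowAlternating (n := Fin n) (R := R)).toMultilinearMap.map_update_sum
        (t := Finset.univ) (i := i) (g := fun l => D k (D l (s i)) • (Pi.single l (1 : R) : Fin n → R))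
        (m := (J.updateRow a (Pi.single k 1)))
      refine this.trans ?_
      refine Finset.sum_congr rfl fun l _ => ?_
      exact Matrix.det_updateRow_smul _ _ _ _
  simp only [h1]
  rw [Finset.sum_comm]
  refine Finset.sum_eq_zero fun i _ => ?_
  split_ifs with h
  · simp
  · have key : ∀ k l, ((J.updateRow a (Pi.single k 1)).updateRow i (Pi.single l 1)).det
        = - ((J.updateRow a (Pi.single l 1)).updateRow i (Pi.single k 1)).det := by
      intro k l
      have := Matrix.det_permute (Equiv.swap a i)
        ((J.updateRow a (Pi.single l 1)).updateRow i (Pi.single k 1))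
      rw [Equiv.Perm.sign_swap (Ne.symm h)] at this
      simp only [Units.val_neg, Units.val_one, Int.cast_neg, Int.cast_one, neg_mul, one_mul] at this
      rw [← this]
      congr 1
      ext x y
      simp only [Matrix.submatrix_apply, id, Matrix.updateRow_apply]
      by_cases hxa : x = a
      · subst hxa; simp [h, Ne.symm h]
      · by_cases hxi : x = i
        · subst hxi; simp [h, Ne.symm h]
        · rw [Equiv.swap_apply_of_ne_of_ne hxa hxi]; simp [hxa, hxi]
    set S := ∑ k, ∑ l, D k (D l (s i)) *
      ((J.updateRow a (Pi.single k 1)).updateRow i (Pi.single l 1)).det with hS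
    have : S = - S := by
      conv_lhs => rw [hS, Finset.sum_comm]
      rw [hS, ← Finset.sum_neg_distrib]
      refine Finset.sum_congr rfl fun k _ => ?_
      rw [← Finset.sum_neg_distrib]
      refine Finset.sum_congr rfl fun l _ => ?_
      rw [key l k, hD l k]; ring
    exact self_eq_neg.mp this


section DBar
variable {n : ℕ} {B : Type*} [NormedAddCommGroup B] [NormedSpace ℂ B]

/-- Twice the Wirtinger derivative with respect to the conjugate of the `k`-th variable. -/
noncomputable def dbar (k : Fin n) (g : CE n → B) (ζ : CE n) : B :=
  fderiv ℝ g ζ (Pi.single k 1) + Complex.I • fderiv ℝ g ζ (Pi.single k Complex.I)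

theorem HasFDerivAt.dbar {k : Fin n} {g : CE n → B} {ζ : CE n} {g' : CE n →L[ℝ] B}
    (h : HasFDerivAt g g' ζ) :
    dbar k g ζ = g' (Pi.single k 1) + Complex.I • g' (Pi.single k Complex.I) := by
  rw [_root_.dbar, h.fderiv]

theorem dbar_congr {k : Fin n} {g h : CE n → B} {ζ : CE n} (H : g =ᶠ[𝓝 ζ] h) :
    dbar k g ζ = dbar k h ζ := by
  rw [dbar, dbar, H.fderiv_eq]

theorem dbar_clm {k : Fin n} {g : CE n → B} {ζ : CE n} (L : B →L[ℂ] ℂ)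
    (hg : DifferentiableAt ℝ g ζ) : dbar k (fun x => L (g x)) ζ = L (dbar k g ζ) := by
  have := ((L.restrictScalars ℝ).hasFDerivAt (x := g ζ)).comp ζ hg.hasFDerivAt
  have h2 := HasFDerivAt.dbar (k := k) this
  refine Eq.trans ?_ (h2.trans ?_)
  · rfl
  · simp [dbar]

theorem dbar_mul {k : Fin n} {g h : CE n → ℂ} {ζ : CE n}
    (hg : DifferentiableAt ℝ g ζ) (hh : DifferentiableAt ℝ h ζ) :
    dbar k (fun x => g x * h x) ζ = g ζ * dbar k h ζ + h ζ * dbar k g ζ := by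
  refine ((hg.hasFDerivAt.mul hh.hasFDerivAt).dbar (k := k)).trans ?_
  simp [dbar]; ring

theorem dbar_add {k : Fin n} {g h : CE n → ℂ} {ζ : CE n}
    (hg : DifferentiableAt ℝ g ζ) (hh : DifferentiableAt ℝ h ζ) :
    dbar k (fun x => g x + h x) ζ = dbar k g ζ + dbar k h ζ := by
  refine ((hg.hasFDerivAt.add hh.hasFDerivAt).dbar (k := k)).trans ?_
  simp [dbar]; ring

theorem dbar_const {k : Fin n} (c : B) (ζ : CE n) : dbar k (fun _ => c) ζ = 0 := by
  rw [(hasFDerivAt_const c ζ).dbar]; simp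

theorem dbar_holo {k : Fin n} {f : CE n → ℂ} {ζ : CE n} (hf : DifferentiableAt ℂ f ζ) :
    dbar k f ζ = 0 := by
  rw [(hf.hasFDerivAt.restrictScalars ℝ).dbar]
  have : (Pi.single k Complex.I : CE n) = Complex.I • Pi.single k 1 := by
    rw [← Pi.single_smul]; simp
  simp only [ContinuousLinearMap.coe_restrictScalars', this, map_smul, smul_eq_mul, ← mul_assoc]
  simp

theorem dbar_contDiff {k : Fin n} {g : CE n → B} (hg : ContDiff ℝ (⊤ : ℕ∞) g) :
    ContDiff ℝ (⊤ : ℕ∞) (dbar k g) := by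
  have h := hg.fderiv_right (m := (⊤ : ℕ∞)) (by simp)
  unfold dbar
  exact (h.clm_apply contDiff_const).add (((h.clm_apply contDiff_const)).const_smul Complex.I)

theorem dbar_comm (k l : Fin n) {g : CE n → ℂ} (hg : ContDiff ℝ (⊤ : ℕ∞) g) :
    dbar k (dbar l g) = dbar l (dbar k g) := by
  have h := hg.fderiv_right (m := (⊤ : ℕ∞)) (by simp)
  have hd : Differentiable ℝ (fderiv ℝ g) := h.differentiable (by simp)
  have key : ∀ (k l : Fin n) ζ, dbar k (dbar l g) ζ =
      fderiv ℝ (fderiv ℝ g) ζ (Pi.single k 1) (Pi.single l 1)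
      + Complex.I * fderiv ℝ (fderiv ℝ g) ζ (Pi.single k 1) (Pi.single l Complex.I)
      + Complex.I * fderiv ℝ (fderiv ℝ g) ζ (Pi.single k Complex.I) (Pi.single l 1)
      - fderiv ℝ (fderiv ℝ g) ζ (Pi.single k Complex.I) (Pi.single l Complex.I) := by
    intro k l ζ
    have h1 : ∀ v, HasFDerivAt (fun x => fderiv ℝ g x v)
        ((fderiv ℝ (fderiv ℝ g) ζ).flip v) ζ := by
      intro v
      have := (hd ζ).hasFDerivAt.clm_apply (hasFDerivAt_const v ζ)
      refine this.congr_fderiv ?_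
      ext; simp
    have := ((h1 (Pi.single l 1)).add ((h1 (Pi.single l Complex.I)).const_smul Complex.I)).dbar (k := k)
    refine Eq.trans rfl (this.trans ?_)
    simp
    ring_nf
    simp
    ring
  have sym : ∀ ζ, IsSymmSndFDerivAt ℝ g ζ := fun ζ =>
    hg.contDiffAt.isSymmSndFDerivAt (by
      simp only [minSmoothness_of_isRCLikeNormedField]
      exact WithTop.coe_le_coe.mpr (le_top (a := (2 : ℕ∞))))
  funext ζ
  rw [key, key, (sym ζ).eq (Pi.single k 1) (Pi.single l 1),
    (sym ζ).eq (Pi.single k 1) (Pi.single l Complex.I),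
    (sym ζ).eq (Pi.single k Complex.I) (Pi.single l 1),
    (sym ζ).eq (Pi.single k Complex.I) (Pi.single l Complex.I)]
  ring

/-- The ring of smooth functions. -/
def SM (n : ℕ) : Subring (CE n → ℂ) where
  carrier := {g | ContDiff ℝ (⊤ : ℕ∞) g}
  mul_mem' := by
    intro a b ha hb
    rw [Set.mem_ofPred_eq] at *
    exact ContDiff.mul (f := a) (g := b) ha hb
  one_mem' := by
    rw [Set.mem_ofPred_eq]
    exact contDiff_const (𝕜 := ℝ) (E := CE n) (c := (1 : ℂ))
  add_mem' := by
    intro a b ha hb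
    rw [Set.mem_ofPred_eq] at *
    exact ContDiff.add (f := a) (g := b) ha hb
  zero_mem' := by
    rw [Set.mem_ofPred_eq]
    exact contDiff_const (𝕜 := ℝ) (E := CE n) (c := (0 : ℂ))
  neg_mem' := by
    intro a ha
    rw [Set.mem_ofPred_eq] at *
    exact ContDiff.neg (f := a) ha

theorem SM.contDiff (g : SM n) : ContDiff ℝ (⊤ : ℕ∞) (g : CE n → ℂ) := g.2
theorem SM.diff (g : SM n) (ζ : CE n) : DifferentiableAt ℝ (g : CE n → ℂ) ζ :=
  (SM.contDiff g).differentiable (by simp) ζ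

/-- `dbar` as a derivation. -/
noncomputable def dbarD (k : Fin n) : Derivation ℤ (SM n) (SM n) :=
  Derivation.mk' (AddMonoidHom.toIntLinearMap
    { toFun := fun g => ⟨dbar k g, dbar_contDiff g.2⟩
      map_zero' := by
        ext ζ; exact dbar_const (0 : ℂ) ζ
      map_add' := by
        intro g h; ext ζ; exact dbar_add (SM.diff g ζ) (SM.diff h ζ) })
    (by
      intro g h; ext ζ; exact dbar_mul (SM.diff g ζ) (SM.diff h ζ))

theorem dbarD_coe (k : Fin n) (g : SM n) : ((dbarD k g : SM n) : CE n → ℂ) = dbar k g := rfl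

/-- The complex Jacobian in the antiholomorphic directions. -/
noncomputable def Jac {B : Type*} [NormedCommRing B] [NormedAlgebra ℂ B]
    (s : Fin n → CE n → B) (ζ : CE n) : Matrix (Fin n) (Fin n) B :=
  Matrix.of fun i k => dbar k (s i) ζ

/-- The vector field whose divergence is the determinant of the Jacobian. -/
noncomputable def Vf {B : Type*} [NormedCommRing B] [NormedAlgebra ℂ B]
    (s : Fin n → CE n → B) (a k : Fin n) (ζ : CE n) : B :=
  s a ζ * (Jac s ζ).adjugate k a

theorem Vf_smooth_div (s : Fin n → CE n → ℂ) (hs : ∀ i, ContDiff ℝ (⊤ : ℕ∞) (s i)) (a : Fin n) :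
    (∀ k, ContDiff ℝ (⊤ : ℕ∞) (Vf s a k)) ∧ ContDiff ℝ (⊤ : ℕ∞) (fun ζ => (Jac s ζ).det) ∧
    ∀ ζ, ∑ k, dbar k (Vf s a k) ζ = (Jac s ζ).det := by
  let S : Fin n → SM n := fun i => ⟨s i, hs i⟩
  let M : Matrix (Fin n) (Fin n) (SM n) := Matrix.of fun i k => dbarD k (S i)
  let ev : CE n → SM n →+* ℂ := fun ζ => (Pi.evalRingHom (fun _ : CE n => ℂ) ζ).comp (SM n).subtype
  have hM : ∀ ζ, (ev ζ).mapMatrix M = Jac s ζ := by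
    intro ζ; ext i k; rfl
  have hV : ∀ k, ((S a * M.adjugate k a : SM n) : CE n → ℂ) = Vf s a k := by
    intro k
    funext ζ
    show ev ζ (S a * M.adjugate k a) = _
    rw [map_mul, Vf, ← hM, ← RingHom.map_adjugate]
    rfl
  have hdet : ((M.det : SM n) : CE n → ℂ) = fun ζ => (Jac s ζ).det := by
    funext ζ
    show ev ζ M.det = _
    rw [← hM, RingHom.map_det]
  refine ⟨fun k => hV k ▸ SM.contDiff _, hdet ▸ SM.contDiff _, fun ζ => ?_⟩
  have htf : IsAddTorsionFree (SM n) := by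
    refine Function.Injective.isAddTorsionFree (SM n).subtype.toAddMonoidHom Subtype.coe_injective
  have hp := piola (fun k => dbarD (n := n) k) (by
    intro k l x
    exact Subtype.ext (dbar_comm k l x.2)) S a
  have h1 : ∑ k, dbarD k (S a * M.adjugate k a) = M.det := by
    simp only [Derivation.leibniz, smul_eq_mul, Finset.sum_add_distrib, ← Finset.mul_sum]
    have : ∑ k, dbarD k (M.adjugate k a) = 0 := hp
    rw [this, mul_zero, zero_add]
    have h3 := congrFun (congrFun (Matrix.mul_adjugate M) a) a
    rw [Matrix.mul_apply] at h3
    simp only [Matrix.smul_apply, Matrix.one_apply_eq, smul_eq_mul, mul_one] at h3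
    rw [← h3]
    exact Finset.sum_congr rfl fun k _ => mul_comm _ _
  have h2 := congrArg (ev ζ) h1
  rw [map_sum] at h2
  refine Eq.trans ?_ (h2.trans (congrFun hdet ζ))
  refine Finset.sum_congr rfl fun k _ => ?_
  rw [← hV]; rfl

theorem integral_dbar_parts {F V : CE n → ℂ} (k : Fin n) (hF : ContDiff ℝ (⊤ : ℕ∞) F)
    (hc : HasCompactSupport F) (hV : ContDiff ℝ (⊤ : ℕ∞) V) :
    ∫ ζ, F ζ * dbar k V ζ = - ∫ ζ, dbar k F ζ * V ζ := by
  have hFd := (hF.fderiv_right (m := (⊤ : ℕ∞)) (by simp))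
  have hVd := (hV.fderiv_right (m := (⊤ : ℕ∞)) (by simp))
  have i1 : ∀ v, MeasureTheory.Integrable (fun ζ => fderiv ℝ F ζ v * V ζ) := fun v =>
    ((hFd.clm_apply contDiff_const).continuous.mul hV.continuous).integrable_of_hasCompactSupport
      ((hc.fderiv_apply (𝕜 := ℝ) v).mul_right)
  have i2 : ∀ v, MeasureTheory.Integrable (fun ζ => F ζ * fderiv ℝ V ζ v) := fun v =>
    (hF.continuous.mul (hVd.clm_apply contDiff_const).continuous).integrable_of_hasCompactSupport
      (hc.mul_right)
  have i3 : MeasureTheory.Integrable (fun ζ => F ζ * V ζ) :=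
    (hF.continuous.mul hV.continuous).integrable_of_hasCompactSupport (hc.mul_right)
  have key : ∀ v, ∫ ζ, F ζ * fderiv ℝ V ζ v = - ∫ ζ, fderiv ℝ F ζ v * V ζ := fun v =>
    integral_mul_fderiv_eq_neg_fderiv_mul_of_integrable (i1 v) (i2 v) i3
      (fun x _ => hF.differentiable (by simp) x) (fun x _ => hV.differentiable (by simp) x)
  have e1 : ∀ ζ, F ζ * dbar k V ζ = F ζ * fderiv ℝ V ζ (Pi.single k 1)
      + Complex.I * (F ζ * fderiv ℝ V ζ (Pi.single k Complex.I)) := by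
    intro ζ; simp [dbar]; ring
  have e2 : ∀ ζ, dbar k F ζ * V ζ = fderiv ℝ F ζ (Pi.single k 1) * V ζ
      + Complex.I * (fderiv ℝ F ζ (Pi.single k Complex.I) * V ζ) := by
    intro ζ; simp [dbar]; ring
  simp only [e1, e2]
  rw [MeasureTheory.integral_add (i2 _) ((i2 _).const_mul _),
    MeasureTheory.integral_add (i1 _) ((i1 _).const_mul _), MeasureTheory.integral_const_mul,
    MeasureTheory.integral_const_mul, key, key]
  ring

theorem integral_div_parts {F : CE n → ℂ} (hF : ContDiff ℝ (⊤ : ℕ∞) F)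
    (hc : HasCompactSupport F) (s : Fin n → CE n → ℂ) (hs : ∀ i, ContDiff ℝ (⊤ : ℕ∞) (s i))
    (a : Fin n) :
    ∫ ζ, F ζ * (Jac s ζ).det = - ∫ ζ, ∑ k, dbar k F ζ * Vf s a k ζ := by
  obtain ⟨h1, h2, h3⟩ := Vf_smooth_div s hs a
  simp only [← h3, Finset.mul_sum]
  rw [MeasureTheory.integral_finsetSum, MeasureTheory.integral_finsetSum,
    ← Finset.sum_neg_distrib]
  · exact Finset.sum_congr rfl fun k _ => integral_dbar_parts k hF hc (h1 k)
  · intro k _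
    refine ((dbar_contDiff hF).continuous.mul (h1 k).continuous).integrable_of_hasCompactSupport ?_
    refine HasCompactSupport.mul_right ?_
    exact (hc.fderiv_apply (𝕜 := ℝ) _).add ((hc.fderiv_apply (𝕜 := ℝ) _).smul_left (f := fun _ => Complex.I))
  · intro k _
    exact (hF.continuous.mul (dbar_contDiff (h1 k)).continuous).integrable_of_hasCompactSupport
      hc.mul_right
end DBar


section Local
variable {n : ℕ}

/-- The squared Euclidean norm. -/
noncomputable def nsq (w : CE n) : ℝ := ∑ i, ‖w i‖ ^ 2

theorem nsq_nonneg (w : CE n) : 0 ≤ nsq w := Finset.sum_nonneg fun _ _ => by positivity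

theorem nsq_smul (c : ℂ) (w : CE n) : nsq (c • w) = ‖c‖ ^ 2 * nsq w := by
  simp [nsq, mul_pow, Finset.mul_sum]

theorem nsq_pos {w : CE n} (h : w ≠ 0) : 0 < nsq w := by
  obtain ⟨i, hi⟩ := Function.ne_iff.mp h
  have : 0 < ‖w i‖ := norm_pos_iff.mpr hi
  refine lt_of_lt_of_le (by positivity : 0 < ‖w i‖ ^ 2) ?_
  exact Finset.single_le_sum (f := fun i => ‖w i‖ ^ 2) (fun _ _ => by positivity) (Finset.mem_univ i)

theorem nsq_contDiff : ContDiff ℝ (⊤ : ℕ∞) (nsq (n := n)) := by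
  unfold nsq
  exact ContDiff.sum fun i _ => (contDiff_apply ℝ ℂ i).norm_sq ℝ

theorem nsq_coe (w : CE n) : ((nsq w : ℝ) : ℂ) = ∑ i, w i * (starRingEnd ℂ) (w i) := by
  simp [nsq, Complex.mul_conj, Complex.normSq_eq_norm_sq]

theorem norm_sq_le_nsq (w : CE n) : ‖w‖ ^ 2 ≤ nsq w := by
  have h : ‖w‖ ≤ Real.sqrt (nsq w) := by
    rw [pi_norm_le_iff_of_nonneg (Real.sqrt_nonneg _)]
    intro i
    apply Real.le_sqrt_of_sq_le
    exact Finset.single_le_sum (f := fun i => ‖w i‖ ^ 2) (fun _ _ => by positivity) (Finset.mem_univ i)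
  calc ‖w‖ ^ 2 ≤ (Real.sqrt (nsq w)) ^ 2 := by gcongr
    _ = nsq w := Real.sq_sqrt (nsq_nonneg w)

theorem dbar_coord (i k : Fin n) (ζ : CE n) : dbar k (fun x : CE n => x i) ζ = 0 :=
  dbar_holo (by fun_prop)

theorem dbar_conj (i k : Fin n) (z ζ : CE n) :
    dbar k (fun x : CE n => (starRingEnd ℂ) (x i - z i)) ζ = if i = k then 2 else 0 := by
  have h0 : HasFDerivAt (fun x : CE n => x i - z i)
      (ContinuousLinearMap.proj (R := ℝ) (φ := fun _ : Fin n => ℂ) i) ζ :=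
    (ContinuousLinearMap.proj (R := ℝ) (φ := fun _ : Fin n => ℂ) i).hasFDerivAt.sub_const (z i)
  have h1 := (Complex.conjCLE.toContinuousLinearMap.hasFDerivAt (x := ζ i - z i)).comp ζ h0
  refine (h1.dbar (k := k)).trans ?_
  by_cases h : i = k
  · subst h
    simp
    norm_num
  · simp [h]

theorem dbar_comp_real {k : Fin n} {u : CE n → ℝ} {g : ℝ → ℝ} {g' : ℝ} {ζ : CE n}
    (hu : DifferentiableAt ℝ u ζ) (hg : HasDerivAt g g' (u ζ)) :
    dbar k (fun x => ((g (u x) : ℝ) : ℂ)) ζ = g' * dbar k (fun x => ((u x : ℝ) : ℂ)) ζ := by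
  have h1 := (Complex.ofRealCLM.hasFDerivAt (x := u ζ)).comp ζ hu.hasFDerivAt
  have h2 := (Complex.ofRealCLM.hasFDerivAt (x := g (u ζ))).comp ζ
    (hg.hasFDerivAt.comp ζ hu.hasFDerivAt)
  refine (h2.dbar (k := k)).trans ?_
  refine Eq.trans ?_ (congrArg (fun t => (g' : ℂ) * t) (h1.dbar (k := k)).symm)
  simp
  ring

theorem dbar_nsq (k : Fin n) (ζ : CE n) :
    dbar k (fun x => ((nsq x : ℝ) : ℂ)) ζ = 2 * ζ k := by
  simp only [nsq_coe]
  have hc : ∀ i, ContDiff ℝ (⊤ : ℕ∞) (fun x : CE n => (starRingEnd ℂ) (x i)) := fun i =>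
    Complex.conjCLE.contDiff.comp (contDiff_apply ℝ ℂ i)
  have hi : ∀ i, ContDiff ℝ (⊤ : ℕ∞) (fun x : CE n => x i) := fun i => (contDiff_apply ℝ ℂ i)
  have key : ∀ s : Finset (Fin n), dbar k (fun x : CE n => ∑ i ∈ s, x i * (starRingEnd ℂ) (x i)) ζ
      = ∑ i ∈ s, ζ i * (if i = k then 2 else 0) := by
    intro s
    induction s using Finset.induction_on with
    | empty => simpa using dbar_const (0 : ℂ) ζ
    | insert a s ha ih =>
      simp only [Finset.sum_insert ha]
      rw [dbar_add, ih, dbar_mul, dbar_coord]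
      · have := dbar_conj a k 0 ζ
        simp only [Pi.zero_apply, sub_zero] at this
        rw [this]; ring
      · exact (hi a).differentiable (by simp) ζ
      · exact (hc a).differentiable (by simp) ζ
      · exact ((hi a).mul (hc a)).differentiable (by simp) ζ
      · exact (ContDiff.sum fun i _ => (hi i).mul (hc i)).differentiable (by simp) ζ
  rw [key]
  simp; ring

/-- Cutoff. -/
noncomputable def kap (e t : ℝ) : ℝ := expNegInvGlue (e - t)

theorem kap_nonneg (e t : ℝ) : 0 ≤ kap e t := expNegInvGlue.nonneg _
theorem kap_zero {e t : ℝ} (h : e ≤ t) : kap e t = 0 := expNegInvGlue.zero_of_nonpos (by linarith)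
theorem kap_contDiff (e : ℝ) : ContDiff ℝ (⊤ : ℕ∞) (kap e) := by
  unfold kap
  exact expNegInvGlue.contDiff.comp (contDiff_const.sub contDiff_id)
theorem kap_den_pos {e t : ℝ} (he : 0 < e) (ht : 0 ≤ t) : 0 < t + kap e t := by
  rcases ht.eq_or_lt with rfl | h
  · simpa [kap] using expNegInvGlue.pos_of_pos he
  · linarith [kap_nonneg e t]
theorem kap_hasDeriv (e t : ℝ) : HasDerivAt (kap e) (- deriv expNegInvGlue (e - t)) t := by
  have h1 : HasDerivAt expNegInvGlue (deriv expNegInvGlue (e - t)) (e - t) :=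
    ((expNegInvGlue.contDiff (n := 1)).differentiable (by simp) _).hasDerivAt
  have h2 : HasDerivAt (fun t => e - t) (-1) t := by
    simpa using (hasDerivAt_id t).const_sub e
  have h3 := h1.comp t h2
  rw [mul_neg_one] at h3
  exact h3

/-- The determinant density. -/
noncomputable def Dr (e : ℝ) (w : CE n) : ℝ :=
  (2 / (nsq w + kap e (nsq w))) ^ n *
    ((kap e (nsq w) + nsq w * deriv expNegInvGlue (e - nsq w)) / (nsq w + kap e (nsq w)))

/-- The local section. -/
noncomputable def s0 (e : ℝ) (z : CE n) (i : Fin n) (ζ : CE n) : ℂ :=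
  (starRingEnd ℂ) (ζ i - z i) * ((1 / (nsq (ζ - z) + kap e (nsq (ζ - z))) : ℝ) : ℂ)

theorem Jac_s0 {e : ℝ} (he : 0 < e) (z ζ : CE n) :
    (Jac (s0 e z) ζ).det = (Dr e (ζ - z) : ℝ) := by
  set t := nsq (ζ - z) with ht
  have hpos : 0 < t + kap e t := kap_den_pos he (nsq_nonneg _)
  set g : ℝ := 1 / (t + kap e t) with hg
  set g' : ℝ := -(1 - deriv expNegInvGlue (e - t)) / (t + kap e t) ^ 2 with hg'
  have hgd : HasDerivAt (fun t => 1 / (t + kap e t)) g' t := by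
    have h1 := ((hasDerivAt_id t).add (kap_hasDeriv e t)).inv hpos.ne'
    have h2 : (fun t => 1 / (t + kap e t)) = (id + kap e)⁻¹ := by
      funext x; simp
    have h3 : g' = -(1 + -deriv expNegInvGlue (e - t)) / (id + kap e : ℝ → ℝ) t ^ 2 := by
      rw [hg', sub_eq_add_neg]; rfl
    rw [h2, h3]
    exact h1
  have hu : ContDiff ℝ (⊤ : ℕ∞) (fun x : CE n => nsq (x - z)) :=
    nsq_contDiff.comp (contDiff_id.sub contDiff_const)
  have hgdiff : DifferentiableAt ℝ
      (fun x : CE n => ((1 / (nsq (x - z) + kap e (nsq (x - z))) : ℝ) : ℂ)) ζ := by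
    have : HasDerivAt (fun t => 1 / (t + kap e t)) g' (nsq (ζ - z)) := hgd
    have h3 := DifferentiableAt.comp (g := fun t => 1 / (t + kap e t)) ζ
      this.differentiableAt (hu.differentiable (by simp) ζ)
    exact DifferentiableAt.comp ζ Complex.ofRealCLM.differentiableAt h3
  have hnz : ∀ k, dbar k (fun x => ((nsq (x - z) : ℝ) : ℂ)) ζ = 2 * (ζ k - z k) := by
    intro k
    have := dbar_nsq k (ζ - z)
    have h2 : dbar k (fun x => ((nsq (x - z) : ℝ) : ℂ)) ζ
        = dbar k (fun x => ((nsq x : ℝ) : ℂ)) (ζ - z) := by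
      unfold dbar
      rw [fderiv_comp_sub (f := fun x : CE n => ((nsq x : ℝ) : ℂ))]
    rw [h2, this]; simp
  have hJ : ∀ i k, Jac (s0 e z) ζ i k = (if i = k then 2 * (g : ℂ) else 0)
      + (starRingEnd ℂ) (ζ i - z i) * (g' * (2 * (ζ k - z k))) := by
    intro i k
    show dbar k (s0 e z i) ζ = _
    unfold s0
    rw [dbar_mul _ hgdiff, dbar_conj]
    · have h3 : dbar k (fun x => ((1 / (nsq (x - z) + kap e (nsq (x - z))) : ℝ) : ℂ)) ζ
          = g' * (2 * (ζ k - z k)) := by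
        rw [← hnz]
        exact dbar_comp_real (g := fun t => 1 / (t + kap e t)) (u := fun x => nsq (x - z))
          (hu.differentiable (by simp) ζ) hgd
      rw [h3]
      split_ifs <;> simp [hg, ht] <;> ring
    · exact Complex.conjCLE.differentiableAt.comp ζ
        (((contDiff_apply ℝ ℂ i).sub contDiff_const).differentiable (n := (⊤ : ℕ∞)) (by simp) ζ)
  have hgne : (g : ℂ) ≠ 0 := by
    rw [Ne, Complex.ofReal_eq_zero]; positivity
  have hMat : Jac (s0 e z) ζ = (2 * (g : ℂ)) • (1 + Matrix.replicateCol Unit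
      (fun i => (starRingEnd ℂ) (ζ i - z i)) *
      Matrix.replicateRow Unit (fun k => (g' / g : ℂ) * (ζ k - z k))) := by
    ext i k
    rw [hJ]
    simp only [Matrix.smul_apply, Matrix.add_apply, Matrix.mul_apply, Matrix.one_apply,
      Matrix.replicateCol_apply, Matrix.replicateRow_apply, smul_eq_mul]
    simp only [Finset.univ_unique, Finset.sum_const, Finset.card_singleton, one_smul]
    split_ifs <;> field_simp <;> ring
  rw [hMat, Matrix.det_smul, Matrix.det_one_add_replicateCol_mul_replicateRow]
  have hdot : (fun k => (g' / g : ℂ) * (ζ k - z k)) ⬝ᵥ (fun i => (starRingEnd ℂ) (ζ i - z i))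
      = (g' / g : ℂ) * t := by
    rw [ht, nsq_coe, dotProduct, Finset.mul_sum]
    exact Finset.sum_congr rfl fun i _ => by simp; ring
  rw [hdot, Dr, ← ht, Fintype.card_fin]
  have e1 : 1 + g' / g * t = (kap e t + t * deriv expNegInvGlue (e - t)) / (t + kap e t) := by
    rw [hg, hg']; field_simp; ring
  rw [← e1, div_eq_mul_one_div 2, ← hg]
  push_cast
  ring

theorem deriv_glue_nonneg (x : ℝ) : 0 ≤ deriv expNegInvGlue x :=
  expNegInvGlue.monotone.deriv_nonneg

theorem deriv_glue_zero {x : ℝ} (h : x ≤ 0) : deriv expNegInvGlue x = 0 := by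
  apply IsLocalMin.deriv_eq_zero
  refine Filter.Eventually.of_forall fun y => ?_
  rw [expNegInvGlue.zero_of_nonpos h]
  exact expNegInvGlue.nonneg y

theorem Dr_nonneg {e : ℝ} (he : 0 < e) (w : CE n) : 0 ≤ Dr e w := by
  have := kap_den_pos he (nsq_nonneg w)
  have h1 := kap_nonneg e (nsq w)
  have h2 := nsq_nonneg w
  have h3 := deriv_glue_nonneg (e - nsq w)
  unfold Dr
  positivity

theorem Dr_zero {e : ℝ} {w : CE n} (h : e ≤ nsq w) : Dr e w = 0 := by
  unfold Dr
  rw [kap_zero h, deriv_glue_zero (by linarith)]; simp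

theorem Dr_pos {e : ℝ} (he : 0 < e) : Dr e (0 : CE n) ≠ 0 := by
  have h0 : nsq (0 : CE n) = 0 := by simp [nsq]
  have : 0 < kap e 0 := expNegInvGlue.pos_of_pos (by simpa using he)
  unfold Dr
  rw [h0]
  simp only [zero_add, zero_mul, add_zero]
  positivity

theorem Dr_continuous {e : ℝ} (he : 0 < e) : Continuous (Dr (n := n) e) := by
  have h1 : Continuous (nsq (n := n)) := nsq_contDiff.continuous
  have h2 : Continuous (fun w : CE n => kap e (nsq w)) := (kap_contDiff e).continuous.comp h1
  have h3 : Continuous (deriv expNegInvGlue) :=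
    (expNegInvGlue.contDiff (n := 1)).continuous_deriv le_rfl
  have h4 : ∀ w : CE n, nsq w + kap e (nsq w) ≠ 0 := fun w => (kap_den_pos he (nsq_nonneg w)).ne'
  unfold Dr
  exact ((continuous_const.div (h1.add h2) h4).pow n).mul
    ((h2.add (h1.mul (h3.comp (continuous_const.sub h1)))).div (h1.add h2) h4)

theorem nsq_ball_compact (e : ℝ) : IsCompact {w : CE n | nsq w ≤ e} := by
  apply Metric.isCompact_of_isClosed_isBounded
  · exact isClosed_le nsq_contDiff.continuous continuous_const
  · rw [isBounded_iff_forall_norm_le]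
    refine ⟨Real.sqrt e, fun w hw => Real.le_sqrt_of_sq_le ((norm_sq_le_nsq w).trans hw)⟩

theorem Dr_support {e : ℝ} : HasCompactSupport (Dr (n := n) e) := by
  refine HasCompactSupport.intro (nsq_ball_compact e) fun w hw => Dr_zero ?_
  have : ¬ nsq w ≤ e := hw
  linarith

theorem Dr_integral_pos {e : ℝ} (he : 0 < e) : 0 < ∫ w : CE n, Dr e w :=
  (Dr_continuous he).integral_pos_of_hasCompactSupport_nonneg_nonzero Dr_support
    (fun w => Dr_nonneg he w) (Dr_pos he)

theorem Dr_rot {e : ℝ} {c : ℂ} (hc : ‖c‖ = 1) (w : CE n) : Dr e (c • w) = Dr e w := by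
  unfold Dr; rw [nsq_smul, hc]; simp

theorem rot_integral {c : ℂ} (hc : ‖c‖ = 1) (G : CE n → ℂ) :
    ∫ w, G (c • w) = ∫ w, G w := by
  let c' : Circle := ⟨c, by simpa [Submonoid.unitSphere] using hc⟩
  have h1 := MeasureTheory.volume_preserving_pi (ι := Fin n)
    (fun _ : Fin n => (rotation c').measurePreserving)
  have h2 : MeasureTheory.MeasurePreserving (fun w : CE n => c • w) := h1
  have h3 : MeasurableEmbedding (fun w : CE n => c • w) := by
    have : c ≠ 0 := by rw [← norm_pos_iff, hc]; exact one_pos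
    exact (Homeomorph.smulOfNeZero c this).measurableEmbedding
  exact h2.integral_comp h3 G

theorem mean_value {e : ℝ} (he : 0 < e) {F : CE n → ℂ} (hF : Continuous F) (z : CE n)
    (hd : ∀ w, nsq w ≤ e → DifferentiableAt ℂ F (z + w)) :
    ∫ w, F (z + w) * (Dr e w : ℂ) = F z * ((∫ w : CE n, Dr e w : ℝ) : ℂ) := by
  have hDc : Continuous (fun w : CE n => (Dr e w : ℂ)) :=
    Complex.continuous_ofReal.comp (Dr_continuous he)
  have h1 : ∀ θ : ℝ, ∫ w, F (z + circleMap 0 1 θ • w) * (Dr e w : ℂ)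
      = ∫ w, F (z + w) * (Dr e w : ℂ) := by
    intro θ
    have hc : ‖circleMap 0 1 θ‖ = 1 := by simp
    rw [← rot_integral hc (fun w => F (z + w) * (Dr e w : ℂ))]
    simp only [Dr_rot hc]
  have h2 : ∀ w, ∫ θ in (0:ℝ)..(2 * Real.pi), F (z + circleMap 0 1 θ • w) * (Dr e w : ℂ)
      = (2 * Real.pi : ℂ) * F z * (Dr e w : ℂ) := by
    intro w
    by_cases hw : nsq w ≤ e
    · have hdc : DiffContOnCl ℂ (fun c : ℂ => F (z + c • w)) (Metric.ball 0 |1|) := by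
        apply DifferentiableOn.diffContOnCl
        rw [abs_one, closure_ball _ one_ne_zero]
        intro c hc
        have hc' : ‖c‖ ≤ 1 := by simpa using hc
        have h3 : nsq (c • w) ≤ e := by
          rw [nsq_smul]
          have : ‖c‖ ^ 2 ≤ 1 := pow_le_one₀ (norm_nonneg _) hc'
          nlinarith [nsq_nonneg w]
        exact ((hd _ h3).comp c (by fun_prop)).differentiableWithinAt
      have h4 := hdc.circleAverage
      rw [Real.circleAverage_def] at h4
      rw [intervalIntegral.integral_mul_const]
      congr 1
      simp only [zero_smul, add_zero] at h4
      rw [← h4, Complex.real_smul]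
      push_cast
      have : (Real.pi : ℂ) ≠ 0 := by exact_mod_cast Real.pi_ne_zero
      field_simp
    · rw [Dr_zero (by linarith)]; simp
  have hintegr : MeasureTheory.Integrable
      (Function.uncurry fun (θ : ℝ) (w : CE n) => F (z + circleMap 0 1 θ • w) * (Dr e w : ℂ))
      ((MeasureTheory.volume.restrict (Set.uIoc 0 (2 * Real.pi))).prod MeasureTheory.volume) := by
    have hcont : Continuous
      (Function.uncurry fun (θ : ℝ) (w : CE n) => F (z + circleMap 0 1 θ • w) * (Dr e w : ℂ)) := by
      have hm : Continuous (circleMap 0 1) := continuous_circleMap 0 1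
      exact (hF.comp (continuous_const.add ((hm.comp continuous_fst).smul continuous_snd))).mul
        (hDc.comp continuous_snd)
    have hK : IsCompact (Set.Icc 0 (2 * Real.pi) ×ˢ {w : CE n | nsq w ≤ e}) :=
      isCompact_Icc.prod (nsq_ball_compact e)
    have h5 := hcont.continuousOn.integrableOn_compact (μ :=
      (MeasureTheory.volume : MeasureTheory.Measure ℝ).prod
        (MeasureTheory.volume : MeasureTheory.Measure (CE n))) hK
    have h6 : (MeasureTheory.volume.restrict (Set.uIoc 0 (2 * Real.pi))).prod
        (MeasureTheory.volume : MeasureTheory.Measure (CE n))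
        = ((MeasureTheory.volume : MeasureTheory.Measure ℝ).prod
        (MeasureTheory.volume : MeasureTheory.Measure (CE n))).restrict
          (Set.uIoc 0 (2 * Real.pi) ×ˢ Set.univ) := by
      rw [← MeasureTheory.Measure.prod_restrict, MeasureTheory.Measure.restrict_univ]
    rw [h6]
    refine MeasureTheory.IntegrableOn.of_forall_sdiff_eq_zero h5
      (measurableSet_uIoc.prod MeasurableSet.univ) ?_
    rintro ⟨θ, w⟩ ⟨⟨hθ, -⟩, hnot⟩
    have hθ' : θ ∈ Set.Icc 0 (2 * Real.pi) := by
      rw [Set.uIoc_of_le (by positivity)] at hθ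
      exact Set.Ioc_subset_Icc_self hθ
    have : ¬ nsq w ≤ e := fun hw => hnot ⟨hθ', hw⟩
    simp [Function.uncurry, Dr_zero (le_of_not_ge this)]
  have h7 := MeasureTheory.intervalIntegral_integral_swap hintegr
  simp only [h1, h2] at h7
  rw [intervalIntegral.integral_const, MeasureTheory.integral_const_mul,
    integral_complex_ofReal] at h7
  rw [Complex.real_smul] at h7
  push_cast at h7
  have hpi : (2 * Real.pi : ℂ) ≠ 0 := by
    exact_mod_cast (by positivity : (2 * Real.pi) ≠ 0)
  apply mul_left_cancel₀ hpi
  simp only [sub_zero] at h7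
  rw [h7]; ring
end Local


section Global
variable {n : ℕ} {L : Type*} [Fintype L]

/-- Sum of squares of moduli of polynomials. -/
noncomputable def Nq (Q : L → MvPolynomial (Fin n) ℂ) (ζ : CE n) : ℝ := ∑ l, ‖eval ζ (Q l)‖ ^ 2

theorem eval_contDiff (p : MvPolynomial (Fin n) ℂ) :
    ContDiff ℝ (⊤ : ℕ∞) (fun ζ : CE n => eval ζ p) := by
  induction p using MvPolynomial.induction_on with
  | C a => simpa using contDiff_const
  | add p q hp hq => simpa using hp.add hq
  | mul_X p i hp => simpa using hp.mul (contDiff_apply ℝ ℂ i)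

theorem Nq_contDiff (Q : L → MvPolynomial (Fin n) ℂ) : ContDiff ℝ (⊤ : ℕ∞) (Nq Q) := by
  unfold Nq
  exact ContDiff.sum fun l _ => (eval_contDiff (Q l)).norm_sq ℝ

variable {B : Type*} [NormedCommRing B] [NormedAlgebra ℂ B]

theorem hefer (X : Fin n → B) (p : MvPolynomial (Fin n) ℂ) :
    ∃ h : Fin n → CE n → B, (∀ i, ContDiff ℝ (⊤ : ℕ∞) (h i)) ∧
      ∀ ζ, algebraMap ℂ B (eval ζ p) - aeval X p = ∑ i, h i ζ * (algebraMap ℂ B (ζ i) - X i) := by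
  induction p using MvPolynomial.induction_on with
  | C a => exact ⟨fun _ _ => 0, fun _ => contDiff_const, fun ζ => by simp⟩
  | add p q hp hq =>
    obtain ⟨h, h1, h2⟩ := hp
    obtain ⟨g, g1, g2⟩ := hq
    refine ⟨fun i ζ => h i ζ + g i ζ, fun i => (h1 i).add (g1 i), fun ζ => ?_⟩
    simp only [add_mul, Finset.sum_add_distrib, ← h2, ← g2, map_add]
    ring
  | mul_X p m hp =>
    obtain ⟨h, h1, h2⟩ := hp
    refine ⟨fun i ζ => ζ m • h i ζ + if i = m then aeval X p else 0, fun i => ?_, fun ζ => ?_⟩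
    · exact ((contDiff_apply ℝ ℂ m).smul (h1 i)).add contDiff_const
    · simp only [add_mul, Finset.sum_add_distrib, smul_mul_assoc, ← Finset.smul_sum, ← h2, ite_mul,
        zero_mul, Finset.sum_ite_eq', Finset.mem_univ, if_true, map_mul, eval_X, aeval_X]
      rw [Algebra.smul_def]
      ring

/-- Numerator of the outer section. -/
noncomputable def tB (Q : L → MvPolynomial (Fin n) ℂ) (h : L → Fin n → CE n → B) (i : Fin n)
    (ζ : CE n) : B := ∑ l, (starRingEnd ℂ) (eval ζ (Q l)) • h l i ζ

/-- Denominator of the outer section. -/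
noncomputable def aB (Q : L → MvPolynomial (Fin n) ℂ) (X : Fin n → B) (ζ : CE n) : B :=
  ∑ l, (starRingEnd ℂ) (eval ζ (Q l)) • (algebraMap ℂ B (eval ζ (Q l)) - aeval X (Q l))

/-- The outer section. -/
noncomputable def sB (Q : L → MvPolynomial (Fin n) ℂ) (X : Fin n → B) (h : L → Fin n → CE n → B)
    (i : Fin n) (ζ : CE n) : B := tB Q h i ζ * Ring.inverse (aB Q X ζ)

theorem conj_contDiff (p : MvPolynomial (Fin n) ℂ) :
    ContDiff ℝ (⊤ : ℕ∞) (fun ζ : CE n => (starRingEnd ℂ) (eval ζ p)) :=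
  Complex.conjCLE.contDiff.comp (eval_contDiff p)

theorem tB_contDiff (Q : L → MvPolynomial (Fin n) ℂ) (h : L → Fin n → CE n → B)
    (hh : ∀ l i, ContDiff ℝ (⊤ : ℕ∞) (h l i)) (i : Fin n) : ContDiff ℝ (⊤ : ℕ∞) (tB Q h i) := by
  unfold tB
  exact ContDiff.sum fun l _ => (conj_contDiff (Q l)).smul (hh l i)

theorem aB_contDiff (Q : L → MvPolynomial (Fin n) ℂ) (X : Fin n → B) :
    ContDiff ℝ (⊤ : ℕ∞) (aB Q X) := by
  unfold aB
  refine ContDiff.sum fun l _ => (conj_contDiff (Q l)).smul (ContDiff.sub ?_ contDiff_const)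
  simp only [Algebra.algebraMap_eq_smul_one]
  exact (eval_contDiff (Q l)).smul contDiff_const

theorem aB_eq (Q : L → MvPolynomial (Fin n) ℂ) (X : Fin n → B) (ζ : CE n) :
    aB Q X ζ = algebraMap ℂ B (Nq Q ζ : ℂ) -
      ∑ l, (starRingEnd ℂ) (eval ζ (Q l)) • aeval X (Q l) := by
  unfold aB Nq
  simp only [smul_sub, Finset.sum_sub_distrib]
  congr 1
  rw [Complex.ofReal_sum, map_sum]
  refine Finset.sum_congr rfl fun l _ => ?_
  rw [Algebra.smul_def, ← map_mul, mul_comm, Complex.mul_conj, Complex.normSq_eq_norm_sq]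

theorem aB_unit [CompleteSpace B] (Q : L → MvPolynomial (Fin n) ℂ) (X : Fin n → B) (ζ : CE n)
    (hN : 0 < Nq Q ζ)
    (hX : ‖∑ l, (starRingEnd ℂ) (eval ζ (Q l)) • aeval X (Q l)‖ < Nq Q ζ) :
    IsUnit (aB Q X ζ) := by
  rw [aB_eq]
  set y := ∑ l, (starRingEnd ℂ) (eval ζ (Q l)) • aeval X (Q l)
  have hne : (Nq Q ζ : ℂ) ≠ 0 := by exact_mod_cast hN.ne'
  have h1 : ‖(Nq Q ζ : ℂ)⁻¹ • y‖ < 1 := by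
    rw [norm_smul, norm_inv, Complex.norm_real, Real.norm_of_nonneg hN.le, inv_mul_lt_one₀ hN]
    exact hX
  have h2 : algebraMap ℂ B (Nq Q ζ : ℂ) - y
      = algebraMap ℂ B (Nq Q ζ : ℂ) * (1 - (Nq Q ζ : ℂ)⁻¹ • y) := by
    rw [mul_sub, mul_one, ← Algebra.smul_def, smul_smul, mul_inv_cancel₀ hne, one_smul]
  rw [h2]
  exact ((IsUnit.mk0 _ hne).map (algebraMap ℂ B)).mul (Units.oneSub _ h1).isUnit

theorem sB_contDiffAt [CompleteSpace B] (Q : L → MvPolynomial (Fin n) ℂ) (X : Fin n → B)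
    (h : L → Fin n → CE n → B) (hh : ∀ l i, ContDiff ℝ (⊤ : ℕ∞) (h l i)) (i : Fin n) (ζ : CE n)
    (hu : IsUnit (aB Q X ζ)) : ContDiffAt ℝ (⊤ : ℕ∞) (sB Q X h i) ζ := by
  obtain ⟨u, hu⟩ := hu
  have h1 : ContDiffAt ℝ (⊤ : ℕ∞) Ring.inverse (aB Q X ζ) := hu ▸ contDiffAt_ringInverse ℝ u
  exact (tB_contDiff Q h hh i).contDiffAt.mul (h1.comp ζ (aB_contDiff Q X).contDiffAt)

theorem Vf_continuousOn (s : Fin n → CE n → B) (Ω : Set (CE n)) (hΩ : IsOpen Ω)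
    (hs : ∀ i, ∀ ζ ∈ Ω, ContDiffAt ℝ (⊤ : ℕ∞) (s i) ζ) (a k : Fin n) :
    ContinuousOn (Vf s a k) Ω := by
  have h1 : ∀ i, ContDiffOn ℝ (⊤ : ℕ∞) (s i) Ω := fun i ζ hζ => (hs i ζ hζ).contDiffWithinAt
  have h2 : ∀ i k, ContinuousOn (dbar k (s i)) Ω := by
    intro i k
    have := (h1 i).continuousOn_fderiv_of_isOpen hΩ (by simp)
    unfold dbar
    exact (this.clm_apply continuousOn_const).add
      ((this.clm_apply continuousOn_const).const_smul Complex.I)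
  have h3 : ContinuousOn (Jac s) Ω := continuousOn_pi.mpr fun i => continuousOn_pi.mpr fun k => h2 i k
  have h4 : ContinuousOn (fun ζ => (Jac s ζ).adjugate) Ω :=
    (Continuous.matrix_adjugate continuous_id).comp_continuousOn h3
  exact (h1 a).continuousOn.mul (continuousOn_pi.mp (continuousOn_pi.mp h4 k) a)

theorem Jac_congr {s t : Fin n → CE n → B} {ζ : CE n} (h : ∀ i, s i =ᶠ[𝓝 ζ] t i) :
    Jac s ζ = Jac t ζ := by
  ext i k; exact dbar_congr (h i)

theorem Vf_congr {s t : Fin n → CE n → B} {ζ : CE n} (h : ∀ i, s i =ᶠ[𝓝 ζ] t i) (a k : Fin n) :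
    Vf s a k ζ = Vf t a k ζ := by
  unfold Vf; rw [Jac_congr h, (h a).eq_of_nhds]

theorem Vf_hom (φ : B →ₐ[ℂ] ℂ) (hφ : Continuous φ) {s : Fin n → CE n → B} {ζ : CE n}
    (hs : ∀ i, DifferentiableAt ℝ (s i) ζ) (a k : Fin n) :
    Vf (fun i x => φ (s i x)) a k ζ = φ (Vf s a k ζ) := by
  let φL : B →L[ℂ] ℂ := ⟨φ.toLinearMap, hφ⟩
  have hJ : Jac (fun i x => φ (s i x)) ζ = (φ : B →+* ℂ).mapMatrix (Jac s ζ) := by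
    ext i k
    exact dbar_clm φL (hs i)
  unfold Vf
  rw [hJ, ← RingHom.map_adjugate, map_mul]
  rfl

/-- Inner cutoff. -/
noncomputable def cut (Q : L → MvPolynomial (Fin n) ℂ) (r : ℝ) (ζ : CE n) : ℝ :=
  Real.smoothTransition (r - Nq Q ζ)

theorem cut_contDiff (Q : L → MvPolynomial (Fin n) ℂ) (r : ℝ) :
    ContDiff ℝ (⊤ : ℕ∞) (fun ζ => ((cut Q r ζ : ℝ) : ℂ)) := by
  unfold cut
  exact Complex.ofRealCLM.contDiff.comp
    (Real.smoothTransition.contDiff.comp (contDiff_const.sub (Nq_contDiff Q)))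

theorem cut_one {Q : L → MvPolynomial (Fin n) ℂ} {r : ℝ} {ζ : CE n} (h : Nq Q ζ ≤ r - 1) :
    cut Q r ζ = 1 := Real.smoothTransition.one_of_one_le (by linarith)

theorem cut_zero {Q : L → MvPolynomial (Fin n) ℂ} {r : ℝ} {ζ : CE n} (h : r ≤ Nq Q ζ) :
    cut Q r ζ = 0 := Real.smoothTransition.zero_of_nonpos (by linarith)

/-- Denominator of the global section. -/
noncomputable def den (Q : L → MvPolynomial (Fin n) ℂ) (X : Fin n → B) (φ : B →ₐ[ℂ] ℂ)
    (r e : ℝ) (z ζ : CE n) : ℂ :=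
  cut Q r ζ * (nsq (ζ - z) : ℝ) + (1 - cut Q r ζ) * φ (aB Q X ζ)
    + (kap e (nsq (ζ - z)) : ℝ)

/-- The global section. -/
noncomputable def sG (Q : L → MvPolynomial (Fin n) ℂ) (X : Fin n → B) (h : L → Fin n → CE n → B)
    (φ : B →ₐ[ℂ] ℂ) (r e : ℝ) (z : CE n) (i : Fin n) (ζ : CE n) : ℂ :=
  (cut Q r ζ * (starRingEnd ℂ) (ζ i - z i) + (1 - cut Q r ζ) * φ (tB Q h i ζ))
    * (den Q X φ r e z ζ)⁻¹

theorem phi_aeval {X : Fin n → B} {φ : B →ₐ[ℂ] ℂ} {z : CE n} (hz : ∀ i, φ (X i) = z i)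
    (p : MvPolynomial (Fin n) ℂ) : φ (aeval X p) = eval z p := by
  rw [← AlgHom.comp_apply, MvPolynomial.comp_aeval, show (fun i => φ (X i)) = z from funext hz,
    MvPolynomial.aeval_eq_eval]

theorem phi_aB (Q : L → MvPolynomial (Fin n) ℂ) {X : Fin n → B} {φ : B →ₐ[ℂ] ℂ} {z : CE n}
    (hz : ∀ i, φ (X i) = z i) (ζ : CE n) :
    φ (aB Q X ζ) = (Nq Q ζ : ℂ) - ∑ l, (starRingEnd ℂ) (eval ζ (Q l)) * eval z (Q l) := by
  rw [aB_eq, map_sub, map_sum]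
  simp only [map_smul, phi_aeval hz, smul_eq_mul, AlgHom.commutes]
  rfl

theorem phi_aB_re (Q : L → MvPolynomial (Fin n) ℂ) {X : Fin n → B} {φ : B →ₐ[ℂ] ℂ} {z : CE n}
    (hz : ∀ i, φ (X i) = z i) (ζ : CE n) :
    (Nq Q ζ - Nq Q z) / 2 ≤ (φ (aB Q X ζ)).re := by
  rw [phi_aB Q hz]
  have : (∑ l, (starRingEnd ℂ) (eval ζ (Q l)) * eval z (Q l)).re ≤ (Nq Q ζ + Nq Q z) / 2 := by
    rw [Complex.re_sum, Nq, Nq, ← Finset.sum_add_distrib, Finset.sum_div]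
    refine Finset.sum_le_sum fun l _ => ?_
    refine (Complex.re_le_norm _).trans ?_
    rw [norm_mul, RCLike.norm_conj]
    nlinarith [sq_nonneg (‖eval ζ (Q l)‖ - ‖eval z (Q l)‖)]
  simp only [Complex.sub_re, Complex.ofReal_re]
  linarith

theorem den_ne (Q : L → MvPolynomial (Fin n) ℂ) {X : Fin n → B} {φ : B →ₐ[ℂ] ℂ} {z : CE n}
    (hz : ∀ i, φ (X i) = z i) {r e : ℝ} (he : 0 < e) (hr : Nq Q z ≤ r - 2) (ζ : CE n) :
    den Q X φ r e z ζ ≠ 0 := by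
  intro h0
  have h1 := congrArg Complex.re h0
  have h2 := phi_aB_re Q hz ζ
  have hk := kap_nonneg e (nsq (ζ - z))
  have hre : (den Q X φ r e z ζ).re = cut Q r ζ * nsq (ζ - z)
      + (1 - cut Q r ζ) * (φ (aB Q X ζ)).re + kap e (nsq (ζ - z)) := by
    unfold den
    simp [← Complex.ofReal_one, ← Complex.ofReal_sub, -Complex.ofReal_one]
  rw [hre, Complex.zero_re] at h1
  by_cases hN : Nq Q ζ ≤ r - 1
  · rw [cut_one hN] at h1
    have := kap_den_pos he (nsq_nonneg (ζ - z))
    linarith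
  · push Not at hN
    have hne : ζ - z ≠ 0 := by
      intro h; rw [sub_eq_zero.mp h] at hN; linarith
    have hp := nsq_pos hne
    have hc0 : 0 ≤ cut Q r ζ := Real.smoothTransition.nonneg _
    have hc1 : cut Q r ζ ≤ 1 := Real.smoothTransition.le_one _
    have ha : 0 < (φ (aB Q X ζ)).re := by linarith
    rcases hc0.eq_or_lt with h | h
    · rw [← h] at h1; linarith
    · have := mul_pos h hp
      have := mul_nonneg (sub_nonneg.mpr hc1) ha.le
      linarith

theorem nsq_sub_contDiff (z : CE n) : ContDiff ℝ (⊤ : ℕ∞) (fun x : CE n => nsq (x - z)) :=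
    nsq_contDiff.comp (contDiff_id.sub contDiff_const)

theorem phi_contDiff {φ : B →ₐ[ℂ] ℂ} (hφ : Continuous φ) {g : CE n → B}
    (hg : ContDiff ℝ (⊤ : ℕ∞) g) : ContDiff ℝ (⊤ : ℕ∞) (fun x => φ (g x)) := by
  let φL : B →L[ℂ] ℂ := ⟨φ.toLinearMap, hφ⟩
  exact (φL.restrictScalars ℝ).contDiff.comp hg

theorem sG_contDiff (Q : L → MvPolynomial (Fin n) ℂ) {X : Fin n → B} {φ : B →ₐ[ℂ] ℂ}
    (hφ : Continuous φ) {z : CE n}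
    (hz : ∀ i, φ (X i) = z i) {r e : ℝ} (he : 0 < e) (hr : Nq Q z ≤ r - 2)
    {h : L → Fin n → CE n → B} (hh : ∀ l i, ContDiff ℝ (⊤ : ℕ∞) (h l i)) (i : Fin n) :
    ContDiff ℝ (⊤ : ℕ∞) (sG Q X h φ r e z i) := by
  have hc := cut_contDiff Q r
  have hd : ContDiff ℝ (⊤ : ℕ∞) (den Q X φ r e z) := by
    unfold den
    exact ((hc.mul (Complex.ofRealCLM.contDiff.comp (nsq_sub_contDiff z))).add
      ((contDiff_const.sub hc).mul (phi_contDiff hφ (aB_contDiff Q X)))).add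
      (Complex.ofRealCLM.contDiff.comp ((kap_contDiff e).comp (nsq_sub_contDiff z)))
  unfold sG
  refine ContDiff.mul ?_ (hd.inv fun ζ => den_ne Q hz he hr ζ)
  exact (hc.mul (Complex.conjCLE.contDiff.comp ((contDiff_apply ℝ ℂ i).sub contDiff_const))).add
      ((contDiff_const.sub hc).mul (phi_contDiff hφ (tB_contDiff Q h hh i)))

theorem det_sG (Q : L → MvPolynomial (Fin n) ℂ) {X : Fin n → B} {φ : B →ₐ[ℂ] ℂ}
    (hφ : Continuous φ) {z : CE n}
    (hz : ∀ i, φ (X i) = z i) {r e : ℝ} (he : 0 < e) (hr : Nq Q z ≤ r - 2)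
    {h : L → Fin n → CE n → B} (hh : ∀ l i, ContDiff ℝ (⊤ : ℕ∞) (h l i))
    (hX : ∀ l ζ, algebraMap ℂ B (eval ζ (Q l)) - aeval X (Q l)
      = ∑ i, h l i ζ * (algebraMap ℂ B (ζ i) - X i))
    (hball : ∀ ζ, nsq (ζ - z) ≤ e → Nq Q ζ < r - 1) (ζ : CE n) :
    (Jac (sG Q X h φ r e z) ζ).det = (Dr e (ζ - z) : ℝ) := by
  by_cases hζ : nsq (ζ - z) ≤ e
  · rw [← Jac_s0 he]
    congr 1
    apply Jac_congr
    intro i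
    have h1 : ∀ᶠ x in 𝓝 ζ, Nq Q x < r - 1 :=
      (Nq_contDiff Q).continuous.continuousAt.eventually_lt continuousAt_const (hball ζ hζ)
    filter_upwards [h1] with x hx
    unfold sG den s0
    rw [cut_one hx.le]
    push_cast
    simp
  · push Not at hζ
    rw [Dr_zero hζ.le, Complex.ofReal_zero]
    have h1 : ∀ᶠ x in 𝓝 ζ, e < nsq (x - z) :=
      continuousAt_const.eventually_lt (nsq_sub_contDiff z).continuous.continuousAt hζ
    have hsum : (fun x => ∑ i, (x i - z i) * sG Q X h φ r e z i x) =ᶠ[𝓝 ζ] fun _ => 1 := by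
      filter_upwards [h1] with x hx
      have hd := den_ne Q hz he hr x (X := X)
      unfold sG
      simp only [← mul_assoc, ← Finset.sum_mul]
      rw [mul_inv_eq_one₀ hd]
      unfold den
      rw [kap_zero hx.le, nsq_coe]
      have ha : φ (aB Q X x) = ∑ i, (x i - z i) * φ (tB Q h i x) := by
        unfold aB tB
        simp only [hX, Finset.smul_sum, map_sum]
        rw [Finset.sum_comm]
        refine Finset.sum_congr rfl fun i _ => ?_
        rw [Finset.mul_sum]
        refine Finset.sum_congr rfl fun l _ => ?_
        simp only [map_smul, map_mul, map_sub, hz, AlgHom.commutes, smul_eq_mul]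
        simp only [Algebra.algebraMap_self, RingHom.id_apply]
        ring
      rw [ha]
      simp only [Finset.mul_sum, mul_add, Finset.sum_add_distrib, Complex.ofReal_zero, add_zero]
      congr 1
      · exact Finset.sum_congr rfl fun i _ => by simp only [Pi.sub_apply]; ring
      · exact Finset.sum_congr rfl fun i _ => by ring
    have hs : ∀ i, DifferentiableAt ℝ (sG Q X h φ r e z i) ζ := fun i =>
      (sG_contDiff Q hφ hz he hr hh i).differentiable (by simp) ζ
    have hw : ∀ i, DifferentiableAt ℂ (fun x : CE n => x i - z i) ζ := fun i => by fun_prop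
    have hwr : ∀ i, DifferentiableAt ℝ (fun x : CE n => x i - z i) ζ := fun i => by fun_prop
    have hder : ∀ (s : Finset (Fin n)) k,
        dbar k (fun x => ∑ i ∈ s, (x i - z i) * sG Q X h φ r e z i x) ζ
        = ∑ i ∈ s, (ζ i - z i) * dbar k (sG Q X h φ r e z i) ζ := by
      intro s k
      induction s using Finset.induction_on with
      | empty => simpa using dbar_const (0 : ℂ) ζ
      | insert a s ha ih =>
        simp only [Finset.sum_insert ha]
        rw [dbar_add, ih, dbar_mul (hwr a) (hs a), dbar_holo (hw a), mul_zero, add_zero]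
        · exact (hwr a).mul (hs a)
        · exact DifferentiableAt.fun_sum fun i _ => (hwr i).mul (hs i)
    have hne : ζ - z ≠ 0 := by
      intro h0
      rw [h0] at hζ
      simp [nsq] at hζ
      linarith
    refine Matrix.exists_vecMul_eq_zero_iff.mp ⟨ζ - z, hne, ?_⟩
    funext k
    have h3 := hder Finset.univ k
    rw [dbar_congr hsum, dbar_const] at h3
    exact h3.symm

theorem Vf_sG [CompleteSpace B] (Q : L → MvPolynomial (Fin n) ℂ) {X : Fin n → B} {φ : B →ₐ[ℂ] ℂ}
    (hφ : Continuous φ) {z : CE n} {r e : ℝ} 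
    {h : L → Fin n → CE n → B} (hh : ∀ l i, ContDiff ℝ (⊤ : ℕ∞) (h l i))
    (hu : ∀ ζ, r < Nq Q ζ → IsUnit (aB Q X ζ))
    (hball : ∀ ζ, nsq (ζ - z) ≤ e → Nq Q ζ < r - 1) (ζ : CE n) (hζ : r < Nq Q ζ) (a k : Fin n) :
    Vf (sG Q X h φ r e z) a k ζ = φ (Vf (sB Q X h) a k ζ) := by
  rw [← Vf_hom φ hφ]
  · apply Vf_congr
    intro i
    have h1 : ∀ᶠ x in 𝓝 ζ, r < Nq Q x :=
      continuousAt_const.eventually_lt (Nq_contDiff Q).continuous.continuousAt hζ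
    filter_upwards [h1] with x hx
    have h2 : e ≤ nsq (x - z) := by
      by_contra hlt
      push Not at hlt
      linarith [hball x hlt.le]
    unfold sG den sB
    rw [cut_zero hx.le, kap_zero h2]
    obtain ⟨u, hu'⟩ := hu x hx
    rw [← hu', Ring.inverse_unit, map_mul]
    have : φ (↑u⁻¹ : B) = (φ (u : B))⁻¹ := by
      apply eq_inv_of_mul_eq_one_left
      rw [← map_mul]; simp
    rw [this]
    simp
  · exact fun i => (sB_contDiffAt Q X h hh i ζ (hu ζ hζ)).differentiableAt (by simp)

end Global


section Main
variable {n : ℕ} {L : Type*} [Fintype L]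
variable {B : Type*} [NormedCommRing B] [NormedAlgebra ℂ B] [CompleteSpace B]

theorem main_formula (a : Fin n) (Q : L → MvPolynomial (Fin n) ℂ) (X : Fin n → B) {ρ e : ℝ}
    (hρ : 0 ≤ ρ) (he : 0 < e) {U : Set (CE n)} {f : CE n → ℂ} (hf : AnalyticOnNhd ℂ f U)
    (hU : ∀ ζ, Nq Q ζ ≤ ρ + 4 → ζ ∈ U) (hK : IsCompact {ζ : CE n | Nq Q ζ ≤ ρ + 4})
    (hX : ∀ ζ, ρ + 2 < Nq Q ζ →
      ‖∑ l, (starRingEnd ℂ) (eval ζ (Q l)) • aeval X (Q l)‖ < Nq Q ζ) :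
    ∃ y : B, ∀ (φ : B →ₐ[ℂ] ℂ), Continuous φ → ∀ z : CE n, (∀ i, φ (X i) = z i) →
      Nq Q z ≤ ρ → (∀ ζ, nsq (ζ - z) ≤ e → Nq Q ζ < ρ + 1) → φ y = f z := by
  choose h hh hX' using fun l => hefer X (Q l)
  have hNc : Continuous (Nq Q) := (Nq_contDiff Q).continuous
  have hu : ∀ ζ, ρ + 2 < Nq Q ζ → IsUnit (aB Q X ζ) := fun ζ hζ =>
    aB_unit Q X ζ (by linarith) (hX ζ hζ)
  set F : CE n → ℂ := fun ζ => (cut Q (ρ + 4) ζ : ℂ) * f ζ with hFdef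
  have hFz : ∀ ζ, ρ + 4 ≤ Nq Q ζ → F ζ = 0 := fun ζ hζ => by simp [hFdef, cut_zero hζ]
  have hFs : ContDiff ℝ (⊤ : ℕ∞) F := by
    rw [contDiff_iff_contDiffAt]
    intro ζ
    by_cases hζ : Nq Q ζ ≤ ρ + 4
    · exact (cut_contDiff Q _).contDiffAt.mul
        (((hf ζ (hU ζ hζ)).contDiffAt).restrict_scalars ℝ)
    · push Not at hζ
      have h1 : ∀ᶠ x in 𝓝 ζ, ρ + 4 < Nq Q x := hNc.continuousAt.eventually_const_lt hζ
      have h2 : F =ᶠ[𝓝 ζ] fun _ => 0 := h1.mono fun x hx => hFz x hx.le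
      exact contDiffAt_const.congr_of_eventuallyEq h2
  have hFc : HasCompactSupport F := HasCompactSupport.intro hK fun ζ hζ => by
    rw [Set.mem_ofPred_eq] at hζ; push Not at hζ; exact hFz ζ hζ.le
  have hFf : ∀ ζ, Nq Q ζ < ρ + 3 → F =ᶠ[𝓝 ζ] f := fun ζ hζ => by
    have h1 : ∀ᶠ x in 𝓝 ζ, Nq Q x < ρ + 3 := hNc.continuousAt.eventually_lt_const hζ
    refine h1.mono fun x hx => ?_
    have : cut Q (ρ + 4) x = 1 := cut_one (by linarith)
    simp [hFdef, this]
  have hfd : ∀ ζ, Nq Q ζ < ρ + 3 → DifferentiableAt ℂ f ζ := fun ζ hζ =>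
    (hf ζ (hU ζ (by linarith))).differentiableAt
  have hdF : ∀ k ζ, Nq Q ζ < ρ + 3 → dbar k F ζ = 0 := fun k ζ hζ => by
    rw [dbar_congr (hFf ζ hζ)]; exact dbar_holo (hfd ζ hζ)
  have hdF0 : ∀ k ζ, ρ + 4 < Nq Q ζ → dbar k F ζ = 0 := fun k ζ hζ => by
    have h1 : ∀ᶠ x in 𝓝 ζ, ρ + 4 < Nq Q x := hNc.continuousAt.eventually_const_lt hζ
    have h2 : F =ᶠ[𝓝 ζ] fun _ => 0 := h1.mono fun x hx => hFz x hx.le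
    rw [dbar_congr h2]; exact dbar_const _ _
  set G : CE n → B := fun ζ => ∑ k, dbar k F ζ • Vf (sB Q X h) a k ζ with hG
  have hGc : Continuous G := by
    rw [continuous_iff_continuousAt]
    intro ζ
    by_cases hζ : Nq Q ζ < ρ + 3
    · have h1 : ∀ᶠ x in 𝓝 ζ, Nq Q x < ρ + 3 := hNc.continuousAt.eventually_lt_const hζ
      have h2 : G =ᶠ[𝓝 ζ] fun _ => 0 := h1.mono fun x hx => by
        simp [hG, hdF _ x hx]
      exact continuousAt_const.congr h2.symm
    · push Not at hζ
      have hΩ : IsOpen {x : CE n | ρ + 2 < Nq Q x} := isOpen_lt continuous_const hNc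
      refine tendsto_finsetSum _ fun k _ => ?_
      have h1 : ContinuousAt (Vf (sB Q X h) a k) ζ :=
        (Vf_continuousOn (sB Q X h) _ hΩ
          (fun i x hx => sB_contDiffAt Q X h hh i x (hu x hx)) a k).continuousAt
          (hΩ.mem_nhds (show ρ + 2 < Nq Q ζ by linarith))
      exact ((dbar_contDiff hFs).continuous.continuousAt).smul h1
  have hGs : HasCompactSupport G := HasCompactSupport.intro hK fun ζ hζ => by
    rw [Set.mem_ofPred_eq] at hζ; push Not at hζ
    simp [hG, hdF0 _ ζ hζ]
  have hGi : MeasureTheory.Integrable G := hGc.integrable_of_hasCompactSupport hGs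
  set c : ℂ := ((∫ w : CE n, Dr e w : ℝ) : ℂ) with hc
  have hc0 : c ≠ 0 := by
    rw [hc]; exact_mod_cast (Dr_integral_pos he).ne'
  refine ⟨-(c⁻¹ • ∫ ζ, G ζ), fun φ hφ z hz hNz hball => ?_⟩
  let φL : B →L[ℂ] ℂ := ⟨φ.toLinearMap, hφ⟩
  have e1 : φ (∫ ζ, G ζ) = ∫ ζ, φ (G ζ) := (φL.integral_comp_comm hGi).symm
  have hball' : ∀ ζ, nsq (ζ - z) ≤ e → Nq Q ζ < (ρ + 2) - 1 := fun ζ hζ => by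
    linarith [hball ζ hζ]
  have e2 : ∀ ζ, φ (G ζ) = ∑ k, dbar k F ζ * Vf (sG Q X h φ (ρ + 2) e z) a k ζ := fun ζ => by
    simp only [hG, map_sum, map_smul, smul_eq_mul]
    refine Finset.sum_congr rfl fun k _ => ?_
    by_cases hζ : Nq Q ζ < ρ + 3
    · simp [hdF k ζ hζ]
    · push Not at hζ
      rw [Vf_sG Q hφ hh hu hball' ζ (by linarith) a k]
  have e3 := integral_div_parts hFs hFc (sG Q X h φ (ρ + 2) e z)
    (sG_contDiff Q hφ hz he (by linarith) hh) a
  have e4 : ∫ ζ, F ζ * (Jac (sG Q X h φ (ρ + 2) e z) ζ).det = f z * c := by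
    simp only [det_sG Q hφ hz he (by linarith : Nq Q z ≤ ρ + 2 - 2) hh hX' hball']
    rw [← MeasureTheory.integral_add_left_eq_self _ z]
    simp only [add_sub_cancel_left]
    rw [mean_value he hFs.continuous z, (hFf z (by linarith)).eq_of_nhds]
    intro w hw
    have : Nq Q (z + w) < ρ + 3 := by
      have := hball (z + w) (by simpa using hw)
      linarith
    exact (hfd _ this).congr_of_eventuallyEq (hFf _ this)
  have e5 : φ (∫ ζ, G ζ) = - (f z * c) := by
    rw [e1, ← e4, e3, neg_neg]
    exact MeasureTheory.integral_congr_ae (Eventually.of_forall e2)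
  rw [map_neg, map_smul, e5, smul_eq_mul]
  field_simp

end Main


section Runge
variable {n : ℕ} 

theorem approx_normalized {L : Type*} [Fintype L] (a : Fin n) (p : L → MvPolynomial (Fin n) ℂ)
    {K : Set (CE n)} (hKc : IsCompact K) (hKn : K.Nonempty)
    (hK : ∀ z ∈ K, ∀ l, ‖eval z (p l)‖ < 1)
    (hb : Bornology.IsBounded {z : CE n | ∀ l, ‖eval z (p l)‖ < 1})
    {f : CE n → ℂ} (hf : AnalyticOnNhd ℂ f {z : CE n | ∀ l, ‖eval z (p l)‖ < 1})
    {ε : ℝ} (hε : 0 < ε) : ∃ g : MvPolynomial (Fin n) ℂ, ∀ z ∈ K, ‖f z - eval z g‖ < ε := by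
  classical
  -- choose the exponent
  obtain ⟨m, hm⟩ : ∃ m : ℕ, ∀ z ∈ K, ∑ l, (‖eval z (p l)‖ ^ m) ^ 2 ≤ 1 / 2 := by
    have h1 : ∀ l, ∃ r : ℝ, 0 ≤ r ∧ r < 1 ∧ ∀ z ∈ K, ‖eval z (p l)‖ ≤ r := fun l => by
      obtain ⟨w, hw, hmax⟩ := hKc.exists_isMaxOn hKn
        ((eval_contDiff (p l)).continuous.norm.continuousOn)
      exact ⟨_, norm_nonneg _, hK w hw l, fun z hz => hmax hz⟩
    choose r hr0 hr1 hr using h1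
    have h2 : Tendsto (fun m : ℕ => ∑ l, (r l ^ m) ^ 2) atTop (𝓝 (∑ _l : L, (0 : ℝ) ^ 2)) :=
      tendsto_finsetSum _ fun l _ =>
        (tendsto_pow_atTop_nhds_zero_of_lt_one (hr0 l) (hr1 l)).pow 2
    have h3 : (∑ _l : L, (0 : ℝ) ^ 2) < 1 / 2 := by simp
    obtain ⟨m, hm⟩ := (h2.eventually_lt_const h3).exists
    refine ⟨m, fun z hz => le_trans (Finset.sum_le_sum fun l _ => ?_) hm.le⟩
    have := hr l z hz
    gcongr
  set Q : L → MvPolynomial (Fin n) ℂ := fun l => C ((Real.sqrt 20 : ℝ) : ℂ) * p l ^ m with hQ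
  have hQn : ∀ z l, ‖eval z (Q l)‖ ^ 2 = 20 * (‖eval z (p l)‖ ^ m) ^ 2 := fun z l => by
    have : ‖((Real.sqrt 20 : ℝ) : ℂ)‖ ^ 2 = 20 := by
      rw [Complex.norm_real, Real.norm_of_nonneg (Real.sqrt_nonneg _), Real.sq_sqrt (by norm_num)]
    simp only [hQ, map_mul, map_pow, eval_C, norm_mul, mul_pow, this, norm_pow]
  have hQK : ∀ z ∈ K, Nq Q z ≤ 10 := fun z hz => by
    unfold Nq
    simp only [hQn, ← Finset.mul_sum]
    linarith [hm z hz]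
  have hNc : Continuous (Nq Q) := (Nq_contDiff Q).continuous
  have hsub : ∀ ζ, Nq Q ζ ≤ 10 + 4 → ζ ∈ {z : CE n | ∀ l, ‖eval z (p l)‖ < 1} := fun ζ hζ => by
    rw [Set.mem_ofPred_eq]
    intro l
    by_contra hcon
    push Not at hcon
    have h1 : ‖eval ζ (Q l)‖ ^ 2 ≤ Nq Q ζ :=
      Finset.single_le_sum (f := fun l => ‖eval ζ (Q l)‖ ^ 2) (fun _ _ => by positivity)
        (Finset.mem_univ l)
    rw [hQn] at h1
    have h2 : 1 ≤ (‖eval ζ (p l)‖ ^ m) ^ 2 := one_le_pow₀ (one_le_pow₀ hcon)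
    linarith
  have hcomp : IsCompact {ζ : CE n | Nq Q ζ ≤ 10 + 4} :=
    Metric.isCompact_of_isClosed_isBounded (isClosed_le hNc continuous_const)
      (hb.subset fun ζ hζ => hsub ζ hζ)
  obtain ⟨δ, hδ, hth⟩ := hKc.exists_thickening_subset_open
    (isOpen_lt hNc continuous_const : IsOpen {ζ : CE n | Nq Q ζ < 10 + 1})
    (fun z hz => by rw [Set.mem_ofPred_eq]; linarith [hQK z hz])
  have : CompactSpace K := isCompact_iff_compactSpace.mp hKc
  let crd : Fin n → C(K, ℂ) := fun i => ⟨fun z => z.1 i, (continuous_apply i).comp continuous_subtype_val⟩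
  let A : Subalgebra ℂ C(K, ℂ) := (aeval (R := ℂ) crd).range.topologicalClosure
  have : CompleteSpace A := (Subalgebra.isClosed_topologicalClosure _).completeSpace_coe
  have hcrd : ∀ i, crd i ∈ A := fun i =>
    Subalgebra.le_topologicalClosure _ ⟨X i, by simp⟩
  let Y : Fin n → A := fun i => ⟨crd i, hcrd i⟩
  let ev : K → A →ₐ[ℂ] ℂ := fun z => (ContinuousMap.evalAlgHom ℂ ℂ z).comp A.val
  have hevc : ∀ z, Continuous (ev z) := fun z =>
    (continuous_eval_const z).comp continuous_subtype_val
  have hevY : ∀ z i, ev z (Y i) = z.1 i := fun z i => rfl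
  have hY : ∀ ζ, (10 : ℝ) + 2 < Nq Q ζ →
      ‖∑ l, (starRingEnd ℂ) (eval ζ (Q l)) • aeval Y (Q l)‖ < Nq Q ζ := fun ζ hζ => by
    refine lt_of_le_of_lt ?_ (by linarith : (Nq Q ζ + 10) / 2 < Nq Q ζ)
    set y := ∑ l, (starRingEnd ℂ) (eval ζ (Q l)) • aeval Y (Q l) with hy
    have hny : ‖y‖ = ‖(y : C(K, ℂ))‖ := rfl
    rw [hny, ContinuousMap.norm_le _ (by linarith)]
    intro z
    have h1 : (y : C(K, ℂ)) z = ev z y := rfl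
    rw [h1, hy, map_sum]
    simp only [map_smul, phi_aeval (hevY z), smul_eq_mul]
    have h2 : (Nq Q ζ + Nq Q z.1) / 2 ≤ (Nq Q ζ + 10) / 2 := by linarith [hQK z.1 z.2]
    refine le_trans ((norm_sum_le _ _).trans ?_) h2
    rw [Nq, Nq, ← Finset.sum_add_distrib, Finset.sum_div]
    refine Finset.sum_le_sum fun l _ => ?_
    rw [norm_mul, RCLike.norm_conj]
    nlinarith [sq_nonneg (‖eval ζ (Q l)‖ - ‖eval z.1 (Q l)‖)]
  obtain ⟨y, hy⟩ := main_formula a Q Y (by norm_num : (0 : ℝ) ≤ 10)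
    (by positivity : 0 < (δ / 2) ^ 2) hf hsub hcomp hY
  have hyK : ∀ z : K, (y : C(K, ℂ)) z = f z.1 := fun z => by
    refine hy (ev z) (hevc z) z.1 (hevY z) (hQK z.1 z.2) fun ζ hζ => ?_
    refine hth (Metric.mem_thickening_iff.mpr ⟨z.1, z.2, ?_⟩)
    rw [dist_eq_norm]
    have h1 := (norm_sq_le_nsq (ζ - z.1)).trans hζ
    have h2 := (sq_le_sq₀ (norm_nonneg _) (by positivity)).mp h1
    linarith
  obtain ⟨g, ⟨q, hq⟩, hg⟩ := Metric.mem_closure_iff.mp y.2 ε hε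
  refine ⟨q, fun z hz => ?_⟩
  have h1 : g ⟨z, hz⟩ = eval z q := by
    rw [← hq]
    exact phi_aeval (φ := ContinuousMap.evalAlgHom ℂ ℂ (⟨z, hz⟩ : K)) (X := crd)
      (fun i => rfl) q
  rw [← hyK ⟨z, hz⟩, ← h1, ← dist_eq_norm]
  exact (ContinuousMap.dist_apply_le_dist _).trans_lt hg

theorem approx_poly (s : Finset (MvPolynomial (Fin n) ℂ)) (c : MvPolynomial (Fin n) ℂ → ℝ)
    {K : Set (CE n)} (hKc : IsCompact K) 
    (hK : ∀ z ∈ K, ∀ q ∈ s, ‖eval z q‖ < c q)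
    {f : CE n → ℂ} (hf : AnalyticOnNhd ℂ f {z : CE n | ∀ q ∈ s, ‖eval z q‖ < c q})
    {ε : ℝ} (hε : 0 < ε) : ∃ g : MvPolynomial (Fin n) ℂ, ∀ z ∈ K, ‖f z - eval z g‖ < ε := by
  rcases K.eq_empty_or_nonempty with rfl | hKn
  · exact ⟨0, by simp⟩
  rcases Nat.eq_zero_or_pos n with rfl | hn
  · refine ⟨C (f 0), fun z _ => ?_⟩
    rw [Subsingleton.elim z 0]; simpa using hε
  obtain ⟨R, hR0, hR⟩ := hKc.isBounded.exists_pos_norm_le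
  have hcpos : ∀ q ∈ s, 0 < c q := fun q hq => by
    obtain ⟨z, hz⟩ := hKn
    exact (norm_nonneg _).trans_lt (hK z hz q hq)
  let p : s ⊕ Fin n → MvPolynomial (Fin n) ℂ :=
    Sum.elim (fun q => C (((c q.1)⁻¹ : ℝ) : ℂ) * q.1) (fun i => C (((R + 1)⁻¹ : ℝ) : ℂ) * X i)
  have h1 : ∀ (z : CE n) (q : s), ‖eval z (p (Sum.inl q))‖ < 1 ↔ ‖eval z q.1‖ < c q.1 :=
    fun z q => by
      have := hcpos q.1 q.2
      simp only [p, Sum.elim_inl, map_mul, eval_C, norm_mul, Complex.norm_real, norm_inv,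
        Real.norm_of_nonneg this.le]
      exact inv_mul_lt_one₀ this
  have h2 : ∀ (z : CE n) (i : Fin n), ‖eval z (p (Sum.inr i))‖ < 1 ↔ ‖z i‖ < R + 1 :=
    fun z i => by
      have : 0 < R + 1 := by linarith
      simp only [p, Sum.elim_inr, map_mul, eval_C, norm_mul, Complex.norm_real, norm_inv,
        Real.norm_of_nonneg this.le, eval_X]
      exact inv_mul_lt_one₀ this
  refine approx_normalized ⟨0, hn⟩ p hKc hKn ?_ ?_ (hf.mono ?_) hε
  · rintro z hz (q | i)
    · exact (h1 z q).mpr (hK z hz q.1 q.2)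
    · rw [h2]
      linarith [norm_le_pi_norm z i, hR z hz]
  · rw [isBounded_iff_forall_norm_le]
    refine ⟨R + 1, fun z hz => ?_⟩
    rw [Set.mem_ofPred_eq] at hz
    rw [pi_norm_le_iff_of_nonneg (by linarith)]
    exact fun i => ((h2 z i).mp (hz _)).le
  · intro z hz
    rw [Set.mem_ofPred_eq] at *
    exact fun q hq => (h1 z ⟨q, hq⟩).mp (hz _)

end Runge


section Final
variable {n : ℕ} 

theorem eval_analytic (p : MvPolynomial (Fin n) ℂ) (U : Set (CE n)) :
    AnalyticOnNhd ℂ (fun ζ : CE n => eval ζ p) U := by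
  intro z _
  induction p using MvPolynomial.induction_on with
  | C a => simpa using analyticAt_const
  | add p q hp hq => simp only [map_add]; exact hp.add hq
  | mul_X p i hp =>
    simp only [map_mul, eval_X]
    exact hp.mul ((ContinuousLinearMap.proj (R := ℂ) (φ := fun _ : Fin n => ℂ) i).analyticAt z)

theorem open_polyhedron (s : Finset (MvPolynomial (Fin n) ℂ)) (c : MvPolynomial (Fin n) ℂ → ℝ) :
    IsOpen {z : CE n | ∀ q ∈ s, ‖eval z q‖ < c q} := by
  have : {z : CE n | ∀ q ∈ s, ‖eval z q‖ < c q}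
      = ⋂ q ∈ s, {z : CE n | ‖eval z q‖ < c q} := by
    ext z; simp
  rw [this]
  exact isOpen_biInter_finset fun q _ =>
    isOpen_lt (eval_contDiff q).continuous.norm continuous_const

theorem runge_open (s : Finset (MvPolynomial (Fin n) ℂ)) (c : MvPolynomial (Fin n) ℂ → ℝ) :
    IsRungeDomain {z : CE n | ∀ q ∈ s, ‖eval z q‖ < c q} := by
  refine ⟨⟨open_polyhedron s c, ?_⟩, fun f hf K hK hKU ε hε => approx_poly s c hK hKU hf hε⟩
  rintro ⟨U₁, U₂, h1, h2, ⟨w, hw⟩, h12, hconn, hnot, hext⟩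
  obtain ⟨b, hb, hbU⟩ := Set.not_subset.mp hnot
  rw [Set.mem_ofPred_eq] at hbU
  push Not at hbU
  obtain ⟨q, hq, hcq⟩ := hbU
  have hne : ∀ z ∈ {z : CE n | ∀ q ∈ s, ‖eval z q‖ < c q}, eval z q - eval b q ≠ 0 := by
    intro z hz h0
    rw [Set.mem_ofPred_eq] at hz
    have := hz q hq
    rw [sub_eq_zero.mp h0] at this
    linarith
  have han : ∀ V : Set (CE n), AnalyticOnNhd ℂ (fun z => eval z q - eval b q) V := fun V =>
    (eval_analytic q V).sub analyticOnNhd_const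
  obtain ⟨F, hF, hFe⟩ := hext (fun z => (eval z q - eval b q)⁻¹) ((han _).inv hne)
  have hev : (fun z => F z * (eval z q - eval b q)) =ᶠ[𝓝 w] fun _ => 1 := by
    filter_upwards [h1.mem_nhds hw] with z hz
    rw [← hFe hz]
    exact inv_mul_cancel₀ (hne z (h12 hz).1)
  have := (hF.mul (han U₂)).eqOn_of_preconnected_of_eventuallyEq analyticOnNhd_const
    hconn.isPreconnected (h12 hw).2 hev hb
  simp at this

theorem runge_empty : IsRungeDomain (∅ : Set (CE n)) := by
  refine ⟨⟨isOpen_empty, ?_⟩, fun f _ K _ hK ε _ => ⟨0, fun z hz => absurd (hK hz) (by simp)⟩⟩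
  rintro ⟨U₁, U₂, h1, h2, ⟨w, hw⟩, h12, -⟩
  exact (h12 hw).1

theorem const_of_max (q : MvPolynomial (Fin n) ℂ) (z : CE n)
    (h : IsLocalMax (norm ∘ fun ζ : CE n => eval ζ q) z) : ∀ x : CE n, eval x q = eval z q := by
  have h1 := Complex.eventually_eq_of_isLocalMax_norm
    (Eventually.of_forall fun x => (eval_analytic q univ x trivial).differentiableAt) h
  intro x
  exact (eval_analytic q univ).eqOn_of_preconnected_of_eventuallyEq analyticOnNhd_const
    isPreconnected_univ (mem_univ z) h1 (mem_univ x)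

theorem runge_final (P : Set (CE n)) (hP : IsPolyPolyhedron P) : IsRungeDomain (interior P) := by
  classical
  obtain ⟨s, c, rfl⟩ := hP
  set P := {z : CE n | ∀ q ∈ s, ‖eval z q‖ ≤ c q} with hPdef
  rcases (interior P).eq_empty_or_nonempty with he | ⟨z₀, hz₀⟩
  · rw [he]; exact runge_empty
  have key : interior P = {z : CE n | ∀ q ∈ s.filter (fun q => ∃ x, eval x q ≠ eval z₀ q),
      ‖eval z q‖ < c q} := by
    apply Subset.antisymm
    · intro z hz
      rw [Set.mem_ofPred_eq]
      intro q hq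
      obtain ⟨hqs, x, hx⟩ := Finset.mem_filter.mp hq
      have hle : ∀ y ∈ P, ‖eval y q‖ ≤ c q := fun y hy => by
        rw [hPdef, Set.mem_ofPred_eq] at hy; exact hy q hqs
      refine lt_of_le_of_ne (hle z (interior_subset hz)) fun heq => hx ?_
      have hmax : IsLocalMax (norm ∘ fun ζ : CE n => eval ζ q) z := by
        filter_upwards [mem_interior_iff_mem_nhds.mp hz] with y hy
        simpa [heq] using hle y hy
      rw [const_of_max q z hmax x, const_of_max q z hmax z₀]
    · refine interior_maximal (fun z hz => ?_) (open_polyhedron _ c)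
      rw [Set.mem_ofPred_eq] at hz
      rw [hPdef, Set.mem_ofPred_eq]
      intro q hq
      by_cases h : ∃ x, eval x q ≠ eval z₀ q
      · exact (hz q (Finset.mem_filter.mpr ⟨hq, h⟩)).le
      · push Not at h
        rw [h z]
        have := interior_subset hz₀
        rw [hPdef, Set.mem_ofPred_eq] at this
        exact this q hq
  rw [key]
  exact runge_open _ c

end Final

/-- Claim 2.4. The interior of any polynomial polyhedron in `ℂ^n` is a
Runge domain in `ℂ^n`. -/
theorem interior_polyhedron_runge (n : ℕ) (P : Set (CE n)) (hP : IsPolyPolyhedron P) :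
    IsRungeDomain (interior P) :=
  runge_final P hP
end
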